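/- Lost Melody Theorem: there is a real c ∈ 2^ℕ such that the singleton {c} is infinite time decidable but c is not writable; consequently the set {(x,y) ∈ 2^ℕ × 2^ℕ : y = c} is infinite time decidable, while the total constant function f(x) = c is not infinite time computable (there is no program p with φ_p(x) = c for all x ∈ 2^ℕ). -/

import Mathlib

open scoped Classical

namespace ITTM

/-- A real is an element of Cantor space. -/
abbrev R := ℕ → Bool

/-- The constant-zero real. -/
def zeroR : R := fun _ => false

/-- The real ⟨1,0,0,...⟩ coding the answer "Yes". -/
def oneR : R := fun n => decide (n = 0)

/-- The real coding a natural number `p`: `p` ones followed by zeros. -/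
def natR (p : ℕ) : R := fun n => decide (n < p)

/-- The real coding the pair of reals `(y, z)`. -/
def pairR (y z : R) : R := fun n => if n % 2 = 0 then y (n / 2) else z (n / 2)

/-- A snapshot of an infinite time Turing machine computation with state set
`Fin (Q+1)`: the current state, the head position, and the contents of the
three tapes (tape 0 is the input tape, tape 1 the scratch tape, tape 2 the
output tape); cells hold values in `Bool` (`true` = 1, `false` = 0). -/
structure Snapshot (Q : ℕ) where
  state : Fin (Q + 1)
  head : ℕ
  tape : Fin 3 → ℕ → Bool

/-- An infinite time Turing machine program: a finite set of states
`Fin (Q+1)` with distinguished start, limit and halt states, and a finite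
transition table which, given the current state and the three cell values
read by the head, specifies the next state, the three values to write, and
the direction to move (`true` = right, `false` = left). -/
structure Machine where
  Q : ℕ
  start : Fin (Q + 1)
  limit : Fin (Q + 1)
  halt : Fin (Q + 1)
  trans : Fin (Q + 1) × (Fin 3 → Bool) → Fin (Q + 1) × (Fin 3 → Bool) × Bool

instance : Inhabited Machine := ⟨⟨0, 0, 0, 0, fun _ => (0, fun _ => false, true)⟩⟩

namespace Machine

/-- The initial snapshot on input `x`: head on cell 0 in the start state, `x`
on the input tape, the other tapes filled with zeros. -/
def init (M : Machine) (x : R) : Snapshot M.Q where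
  state := M.start
  head := 0
  tape := fun i n => if i = 0 then x n else false

/-- One step of computation applied to a snapshot. -/
def stepSnap (M : Machine) (s : Snapshot M.Q) : Snapshot M.Q :=
  let t := M.trans (s.state, fun i => s.tape i s.head)
  { state := t.1
    head := if t.2.2 then s.head + 1 else s.head - 1
    tape := fun i n => if n = s.head then t.2.1 i else s.tape i n }

/-- The snapshot of the computation of machine `M` on input `x` at ordinal
stage `α`, defined by transfinite recursion: at stage 0 the initial snapshot,
at successor stages the transition table is applied, and at limit stages the
head is on cell 0 in the limit state and each cell holds the `limsup` of its
earlier values (1 iff its value was 1 cofinally often below the limit). -/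
noncomputable def snap (M : Machine) (x : R) : Ordinal.{0} → Snapshot M.Q :=
  WellFounded.fix Ordinal.lt_wf fun α ih =>
    if _h0 : α = 0 then M.init x
    else if hs : ∃ β, β < α ∧ α = β + 1 then
      M.stepSnap (ih hs.choose hs.choose_spec.1)
    else
      { state := M.limit
        head := 0
        tape := fun i n =>
          decide (∀ β < α, ∃ γ, β ≤ γ ∧ ∃ hγ : γ < α, (ih γ hγ).tape i n = true) }

/-- The machine is in the halt state at stage `α`. -/
def haltedAt (M : Machine) (x : R) (α : Ordinal) : Prop :=
  (M.snap x α).state = M.halt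

/-- The computation of `M` on input `x` halts exactly at stage `α`: stage `α`
is the first stage at which the machine is in the halt state. -/
def haltsAt (M : Machine) (x : R) (α : Ordinal) : Prop :=
  M.haltedAt x α ∧ ∀ β < α, ¬ M.haltedAt x β

/-- The computation of `M` on input `x` halts. -/
def halts (M : Machine) (x : R) : Prop := ∃ α, M.haltedAt x α

/-- The computation of `M` on input `x` halts with output `y`: at the first
stage at which the machine is in the halt state, the output tape reads `y`. -/
def outputs (M : Machine) (x y : R) : Prop :=
  ∃ α, M.haltsAt x α ∧ (M.snap x α).tape 2 = y

end Machine

/-- Machines are coded by natural numbers. -/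
noncomputable instance : Encodable Machine :=
  Encodable.ofEquiv
    (Σ Q : ℕ, (Fin (Q + 1) × Fin (Q + 1) × Fin (Q + 1)) ×
      ((Fin (Q + 1) × (Fin 3 → Bool)) → Fin (Q + 1) × (Fin 3 → Bool) × Bool))
    { toFun := fun M => ⟨M.Q, (M.start, M.limit, M.halt), M.trans⟩
      invFun := fun s => ⟨s.1, s.2.1.1, s.2.1.2.1, s.2.1.2.2, s.2.2⟩
      left_inv := fun _ => rfl
      right_inv := fun _ => rfl }

/-- The machine coded by the natural number `p`; every natural number codes a
machine, and every machine is coded by some natural number. -/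
noncomputable def prog (p : ℕ) : Machine :=
  ((Encodable.decode p : Option Machine)).getD default

/-- `φ_p(x)` halts with output `y`. -/
noncomputable def phiOutputs (p : ℕ) (x y : R) : Prop := (prog p).outputs x y

/-- A set of reals is infinite time decidable when some machine, on any input
`x`, halts with output ⟨1,0,0,...⟩ if `x ∈ A` and output ⟨0,0,0,...⟩ if
`x ∉ A`. -/
def ITTMDecidable (A : Set R) : Prop :=
  ∃ M : Machine, ∀ x : R, (x ∈ A → M.outputs x oneR) ∧ (x ∉ A → M.outputs x zeroR)

/-- A set of reals is infinite time semi-decidable when it is the halting set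
of some machine. -/
def ITTMSemiDecidable (A : Set R) : Prop :=
  ∃ M : Machine, A = {x : R | M.halts x}

/-- The binary relation on ℕ coded by the real `x`:
`n ◁ k ⟺ x(⟨n,k⟩) = 1` where `⟨·,·⟩` is the pairing function. -/
def rel (x : R) (n k : ℕ) : Prop := x (Nat.pair n k) = true

/-- The field of the relation coded by `x`. -/
def field (x : R) : Set ℕ := {n | ∃ k, rel x n k ∨ rel x k n}

/-- The relation coded by `x`, restricted to its field. -/
def relOn (x : R) : field x → field x → Prop := fun a b => rel x a.1 b.1

/-- The real `x` codes a well-order of (a subset of) ℕ, namely its field. -/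
def codesWellOrder (x : R) : Prop := IsWellOrder (field x) (relOn x)

/-- The set of reals coding well-orders. -/
def WO : Set R := {x | codesWellOrder x}

/-- The real `x` codes a well-order of order type `α`. -/
def codesOrdinal (x : R) (α : Ordinal) : Prop :=
  ∃ h : codesWellOrder x, @Ordinal.type _ (relOn x) h = α

/-- An ordinal is clockable when some machine on input 0 halts exactly at
stage `α`. -/
def Clockable (α : Ordinal) : Prop := ∃ M : Machine, M.haltsAt zeroR α

/-- A real is writable when it is the output of some machine on input 0. -/
def WritableReal (x : R) : Prop := ∃ M : Machine, M.outputs zeroR x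

/-- An ordinal is writable when some writable real codes a well-order of that
order type. -/
def WritableOrdinal (α : Ordinal) : Prop :=
  ∃ x : R, WritableReal x ∧ codesOrdinal x α

/-- A real is eventually writable when some machine on input 0 never halts,
but from some stage onward the content of its output tape is exactly `x`. -/
def EventuallyWritableReal (x : R) : Prop :=
  ∃ M : Machine, ¬ M.halts zeroR ∧ ∃ α : Ordinal, ∀ β ≥ α, (M.snap zeroR β).tape 2 = x

/-- An ordinal is eventually writable when some eventually writable real codes
a well-order of that order type. -/
def EventuallyWritableOrdinal (α : Ordinal) : Prop :=
  ∃ x : R, EventuallyWritableReal x ∧ codesOrdinal x α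

end ITTM

/-- The first component of the pair coded by the real `w`. -/
def leftR (w : ITTM.R) : ITTM.R := fun n => w (2 * n)

/-- The second component of the pair coded by the real `w`. -/
def rightR (w : ITTM.R) : ITTM.R := fun n => w (2 * n + 1)

/-- The set of reals coding (via the pair coding `w(2n) = y(n)`,
`w(2n+1) = z(n)`) the pairs in a set `A ⊆ 2^ℕ × 2^ℕ`; a set of pairs of reals
is called decidable (or semi-decidable) when this set of codes is. -/
def pairCodes (A : Set (ITTM.R × ITTM.R)) : Set ITTM.R :=
  {w : ITTM.R | (leftR w, rightR w) ∈ A}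

namespace ITTM

/-- The `limsup` at stage `α` of a Boolean-valued function of the earlier stages. -/
noncomputable def limsupBelow (f : Ordinal.{0} → Bool) (α : Ordinal.{0}) : Bool :=
  decide (∀ β < α, ∃ γ, β ≤ γ ∧ γ < α ∧ f γ = true)

theorem limsupBelow_eq_true {f : Ordinal.{0} → Bool} {α : Ordinal.{0}} :
    limsupBelow f α = true ↔ ∀ β < α, ∃ γ, β ≤ γ ∧ γ < α ∧ f γ = true := by
  simp [limsupBelow]

theorem limsupBelow_of_eventually {f : Ordinal.{0} → Bool} {α β : Ordinal.{0}} {b : Bool}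
    (hβ : β < α) (h : ∀ γ, β ≤ γ → γ < α → f γ = b) : limsupBelow f α = b := by
  cases b with
  | true =>
    rw [limsupBelow_eq_true]
    intro δ hδ
    exact ⟨max β δ, le_max_right _ _, max_lt hβ hδ, h _ (le_max_left _ _) (max_lt hβ hδ)⟩
  | false =>
    rw [← Bool.not_eq_true, limsupBelow_eq_true]
    intro H
    obtain ⟨γ, h1, h2, h3⟩ := H β hβ
    rw [h γ h1 h2] at h3
    exact Bool.noConfusion h3

theorem not_exists_lt_eq_add_one {α : Ordinal.{0}} (hα : Order.IsSuccLimit α) :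
    ¬ ∃ β, β < α ∧ α = β + 1 := by
  rintro ⟨β, hβ, rfl⟩
  exact hα.succ_ne β (Order.succ_eq_add_one β)

namespace Machine

theorem snap_zero (M : Machine) (x : R) : M.snap x 0 = Machine.init M x := by
  rw [snap, WellFounded.fix_eq, dif_pos rfl]

theorem snap_add_one (M : Machine) (x : R) (β : Ordinal.{0}) :
    M.snap x (β + 1) = M.stepSnap (M.snap x β) := by
  have hex : ∃ γ, γ < β + 1 ∧ β + 1 = γ + 1 := ⟨β, lt_add_one β, rfl⟩
  rw [snap, WellFounded.fix_eq, dif_neg (by simp), dif_pos hex]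
  have : hex.choose = β := by
    exact (Order.add_one_inj.1 hex.choose_spec.2).symm
  change M.stepSnap (M.snap x hex.choose) = M.stepSnap (M.snap x β)
  rw [this]

theorem snap_limit (M : Machine) (x : R) {α : Ordinal.{0}} (hα : Order.IsSuccLimit α) :
    M.snap x α = ⟨M.limit, 0, fun i n => limsupBelow (fun γ => (M.snap x γ).tape i n) α⟩ := by
  have h0 : α ≠ 0 := hα.ne_bot
  conv_lhs => rw [snap, WellFounded.fix_eq, dif_neg h0, dif_neg (not_exists_lt_eq_add_one hα)]
  congr 1
  funext i n
  simp only [limsupBelow, exists_prop]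
  rfl

theorem snap_add_nat (M : Machine) (x : R) (α : Ordinal.{0}) (k : ℕ) :
    M.snap x (α + k) = M.stepSnap^[k] (M.snap x α) := by
  induction k with
  | zero => simp
  | succ k ih => rw [Nat.cast_succ, ← add_assoc, snap_add_one, ih, Function.iterate_succ_apply']

end Machine

/-- A machine whose cells are blocks of tracks and whose input is read through a window on the
corresponding block of the input tape. -/
structure Macro (S : Type) where
  start : S
  limit : S
  act : S → (ℕ → Bool) → (ℕ → Bool) → Bool ⊕ (S × (ℕ → Bool) × Bool)

/-- A configuration of a block machine. -/
structure Cfg (S : Type) where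
  state : S
  head : ℕ
  tr : ℕ → ℕ → Bool

namespace Macro

variable {S : Type}

/-- The part of the input visible from block `n`. -/
def window (W : ℕ) (x : R) (n : ℕ) : ℕ → Bool := fun k => if k < W then x (n * W + k) else false

/-- The action of a block machine in a configuration. -/
def actOn (P : Macro S) (W : ℕ) (x : R) (c : Cfg S) : Bool ⊕ (S × (ℕ → Bool) × Bool) :=
  P.act c.state (window W x c.head) (c.tr c.head)

/-- The configuration reached by carrying out an action; only tracks below `W` are written. -/
def apply (W : ℕ) (c : Cfg S) (v : S × (ℕ → Bool) × Bool) : Cfg S where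
  state := v.1
  head := if v.2.2 then c.head + 1 else c.head - 1
  tr := fun n k => if n = c.head ∧ k < W then v.2.1 k else c.tr n k

/-- One step of a block machine; a halting action leaves the configuration unchanged. -/
def step (P : Macro S) (W : ℕ) (x : R) (c : Cfg S) : Cfg S :=
  match P.actOn W x c with
  | .inl _ => c
  | .inr v => apply W c v

/-- The configuration of a block machine at an ordinal stage. -/
noncomputable def run (P : Macro S) (W : ℕ) (x : R) (α : Ordinal.{0}) : Cfg S :=
  Ordinal.limitRecOn (motive := fun _ => Cfg S) α ⟨P.start, 0, fun _ _ => false⟩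
    (fun _ c => P.step W x c)
    (fun α _ ih => ⟨P.limit, 0, fun n k =>
      decide (∀ β < α, ∃ γ, β ≤ γ ∧ ∃ h : γ < α, (ih γ h).tr n k = true)⟩)

theorem run_zero (P : Macro S) (W : ℕ) (x : R) :
    P.run W x 0 = ⟨P.start, 0, fun _ _ => false⟩ := by
  simp [run]

theorem run_add_one (P : Macro S) (W : ℕ) (x : R) (α : Ordinal.{0}) :
    P.run W x (α + 1) = P.step W x (P.run W x α) := by
  rw [run, Ordinal.limitRecOn_add_one]
  rfl

theorem run_limit (P : Macro S) (W : ℕ) (x : R) {α : Ordinal.{0}} (hα : Order.IsSuccLimit α) :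
    P.run W x α = ⟨P.limit, 0, fun n k => limsupBelow (fun γ => (P.run W x γ).tr n k) α⟩ := by
  rw [run, Ordinal.limitRecOn_limit _ _ _ _ hα]
  simp only [limsupBelow, exists_prop]
  rfl

theorem run_add_nat (P : Macro S) (W : ℕ) (x : R) (α : Ordinal.{0}) (k : ℕ) :
    P.run W x (α + k) = (P.step W x)^[k] (P.run W x α) := by
  induction k with
  | zero => simp
  | succ k ih => rw [Nat.cast_succ, ← add_assoc, run_add_one, ih, Function.iterate_succ_apply']

/-- Tracks outside the block width stay empty. -/
theorem run_tr_of_le (P : Macro S) (W : ℕ) (x : R) (α : Ordinal.{0}) (n : ℕ) {k : ℕ} (hk : W ≤ k) :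
    (P.run W x α).tr n k = false := by
  induction α using Ordinal.limitRecOn with
  | zero => rw [run_zero]
  | add_one α ih =>
    rw [run_add_one, step]
    split
    · exact ih
    · simp only [apply]
      rw [if_neg (by omega)]
      exact ih
  | limit α hα ih =>
    rw [run_limit P W x hα]
    exact limsupBelow_of_eventually (β := 0) hα.bot_lt fun γ _ hγ => ih γ hγ

end Macro
namespace Macro

variable {S : Type}

/-- States simulating a block machine: the simulated state, a phase counter, and the contents of
the current block of the input and scratch tapes. -/
abbrev MState (S : Type) (W : ℕ) := Option (S × Fin (3 * W) × (Fin W → Bool × Bool))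

/-- The next value of the phase counter. -/
def nextPhase {W : ℕ} (t : Fin (3 * W)) : Fin (3 * W) :=
  ⟨(t.1 + 1) % (3 * W), Nat.mod_lt _ (Nat.pos_of_ne_zero fun h => by have := t.2; omega)⟩

/-- The action determined by a completely filled buffer. -/
def resolve (P : Macro S) {W : ℕ} (s : S) (buf : Fin W → Bool × Bool) :
    Bool ⊕ (S × (ℕ → Bool) × Bool) :=
  P.act s (fun k => if h : k < W then (buf ⟨k, h⟩).1 else false)
    (fun k => if h : k < W then (buf ⟨k, h⟩).2 else false)

/-- The transition function simulating one step of a block machine in `3 * W` steps. -/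
def micro (P : Macro S) (W : ℕ) :
    MState S W → (Fin 3 → Bool) → MState S W × (Fin 3 → Bool) × Bool
  | none, r => (none, r, true)
  | some (s, t, buf), r =>
    if h : t.1 < W then (some (s, nextPhase t, Function.update buf ⟨t.1, h⟩ (r 0, r 1)), r, true)
    else if t.1 = W then (some (s, nextPhase t, buf), r, false)
    else match P.resolve s buf with
      | .inl b =>
        if t.1 = 2 * W then (none, ![r 0, r 1, b], true) else (some (s, nextPhase t, buf), r, false)
      | .inr v =>
        (some (if t.1 + 1 < 3 * W then s else v.1, nextPhase t, buf),
          if t.1 ≤ 2 * W then ![r 0, v.2.1 (2 * W - t.1), r 2] else r,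
          if t.1 < 2 * W then false else v.2.2)

theorem block_eq_iff {W m j n i : ℕ} (hj : j < W) (hi : i < W) :
    m * W + j = n * W + i ↔ m = n ∧ j = i := by
  constructor
  · intro h
    have h1 : (m * W + j) / W = m := by
      rw [mul_comm, Nat.mul_add_div (by omega), Nat.div_eq_of_lt hj, add_zero]
    have h2 : (n * W + i) / W = n := by
      rw [mul_comm, Nat.mul_add_div (by omega), Nat.div_eq_of_lt hi, add_zero]
    have : m = n := by rw [← h1, ← h2, h]
    subst this
    exact ⟨rfl, by omega⟩
  · rintro ⟨rfl, rfl⟩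
    rfl

/-- A machine carrying out `micro`, with states identified with an initial segment of `ℕ`. -/
def machineOf (P : Macro S) (W Q : ℕ) (hW : 0 < W) (e : MState S W ≃ Fin (Q + 1)) : Machine where
  Q := Q
  start := e (some (P.start, ⟨0, by omega⟩, fun _ => (false, false)))
  limit := e (some (P.limit, ⟨0, by omega⟩, fun _ => (false, false)))
  halt := e none
  trans := fun a => (e (P.micro W (e.symm a.1) a.2).1, (P.micro W (e.symm a.1) a.2).2)

section Simulation

variable (P : Macro S) {W Q : ℕ} (hW0 : 0 < W) (e : MState S W ≃ Fin (Q + 1)) (x : R)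

/-- A snapshot encodes a configuration of the block machine. -/
def Enc (c : Cfg S) (sn : Snapshot Q) : Prop :=
  (∃ buf, sn.state = e (some (c.state, ⟨0, by omega⟩, buf))) ∧ sn.head = c.head * W ∧
  sn.tape 0 = x ∧ (∀ n k, k < W → sn.tape 1 (n * W + k) = c.tr n k) ∧ sn.tape 2 = zeroR

/-- A snapshot is `k` steps into the simulation of a step from `c` carrying out `v`. -/
def Mid (c : Cfg S) (v : S × (ℕ → Bool) × Bool) (k : ℕ) (sn : Snapshot Q) : Prop :=
  (∃ buf t, sn.state = e (some (c.state, t, buf)) ∧ t.1 = k ∧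
    ∀ j : Fin W, j.1 < k → buf j = (x (c.head * W + j.1), c.tr c.head j.1)) ∧
  sn.head = (if k ≤ W then c.head * W + k else if k ≤ 2 * W then c.head * W + (2 * W - k)
    else if v.2.2 then c.head * W + (k - 2 * W) else c.head * W - (k - 2 * W)) ∧
  sn.tape 0 = x ∧
  (∀ n j, j < W → sn.tape 1 (n * W + j) =
    if n = c.head ∧ 2 * W < k + j then v.2.1 j else c.tr n j) ∧
  sn.tape 2 = zeroR

theorem nextPhase_val {W k : ℕ} (t : Fin (3 * W)) (h : t.1 = k) (hk : k + 1 < 3 * W) :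
    (nextPhase t).1 = k + 1 := by
  simp only [nextPhase, h]
  exact Nat.mod_eq_of_lt hk

theorem ite_tape_self (f : ℕ → Bool) (h n : ℕ) : (if n = h then f h else f n) = f n := by
  split
  · simp_all
  · rfl

theorem resolve_eq {c : Cfg S} {buf : Fin W → Bool × Bool}
    (hc : ∀ k, W ≤ k → c.tr c.head k = false)
    (hbuf : ∀ j : Fin W, buf j = (x (c.head * W + j.1), c.tr c.head j.1)) :
    P.resolve c.state buf = P.actOn W x c := by
  unfold resolve actOn
  congr 1
  · funext k
    simp [window, hbuf]
  · funext k
    by_cases h : k < W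
    · simp [h, hbuf]
    · simp [h, hc k (not_lt.1 h)]

theorem mid_step (hW : 2 ≤ W) {c : Cfg S} {v : S × (ℕ → Bool) × Bool} {k : ℕ} {sn : Snapshot Q}
    (hc : ∀ k, W ≤ k → c.tr c.head k = false)
    (hv : P.actOn W x c = .inr v ∨ (∃ b, P.actOn W x c = .inl b) ∧ v.2.1 = c.tr c.head ∧ k < 2 * W)
    (hk : k + 1 < 3 * W) (h : Mid e x c v k sn) :
    Mid e x c v (k + 1) ((P.machineOf W Q hW0 e).stepSnap sn) := by
  obtain ⟨⟨buf, t, hst, ht, hbuf⟩, hh, h0, h1, h2⟩ := h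
  have hnext := nextPhase_val t ht hk
  have htr : (P.machineOf W Q hW0 e).trans (sn.state, fun i => sn.tape i sn.head) =
      (e (P.micro W (some (c.state, t, buf)) fun i => sn.tape i sn.head).1,
        (P.micro W (some (c.state, t, buf)) fun i => sn.tape i sn.head).2) := by
    simp [machineOf, hst]
  simp only [Mid, Machine.stepSnap]
  rw [htr]
  by_cases hkW : k < W
  · have hm : P.micro W (some (c.state, t, buf)) (fun i => sn.tape i sn.head) =
        (some (c.state, nextPhase t, Function.update buf ⟨t.1, ht ▸ hkW⟩
          (sn.tape 0 sn.head, sn.tape 1 sn.head)), fun i => sn.tape i sn.head, true) := by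
      rw [micro, dif_pos (ht ▸ hkW)]
    rw [hm]
    simp only [ite_tape_self, if_true]
    rw [if_pos (by omega)] at hh
    refine ⟨⟨_, nextPhase t, rfl, hnext, ?_⟩, ?_, h0, ?_, h2⟩
    · intro j hj
      by_cases hjk : j.1 = k
      · have hj' : j = ⟨t.1, ht ▸ hkW⟩ := Fin.ext (by simp [hjk, ht])
        rw [hj', Function.update_self, hh, h0]
        simp only [ht]
        rw [h1 _ _ hkW, if_neg (by omega)]
      · rw [Function.update_of_ne (by intro hj'; apply hjk; rw [hj']; exact ht)]
        exact hbuf j (by omega)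
    · rw [if_pos (by omega), hh, add_assoc]
    · intro n j hj
      rw [h1 n j hj, if_neg (by omega), if_neg (by omega)]
  · by_cases hkW' : k = W
    · have hm : P.micro W (some (c.state, t, buf)) (fun i => sn.tape i sn.head) =
          (some (c.state, nextPhase t, buf), fun i => sn.tape i sn.head, false) := by
        rw [micro, dif_neg (by omega), if_pos (by omega)]
      rw [hm]
      simp only [ite_tape_self, Bool.false_eq_true, if_false]
      rw [if_pos (by omega)] at hh
      refine ⟨⟨_, nextPhase t, rfl, hnext, fun j hj => hbuf j (by omega)⟩, ?_, h0, ?_, h2⟩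
      · rw [if_neg (by omega), if_pos (by omega), hh]
        omega
      · intro n j hj
        rw [h1 n j hj, if_neg (by omega), if_neg (by omega)]
    · have hres := P.resolve_eq x hc fun j => hbuf j (by omega)
      rcases hv with hv | ⟨⟨b, hb⟩, hv, hk2⟩
      · have hm : P.micro W (some (c.state, t, buf)) (fun i => sn.tape i sn.head) =
            (some (c.state, nextPhase t, buf),
              if k ≤ 2 * W then ![sn.tape 0 sn.head, v.2.1 (2 * W - k), sn.tape 2 sn.head]
              else fun i => sn.tape i sn.head, if k < 2 * W then false else v.2.2) := by
          rw [micro, dif_neg (by omega), if_neg (by omega), hres, hv]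
          simp only [ht, if_pos hk]
        rw [hm]
        refine ⟨⟨_, nextPhase t, rfl, hnext, fun j hj => hbuf j (by omega)⟩, ?_, ?_, ?_, ?_⟩
        · simp only [hh]
          rw [if_neg (show ¬ k ≤ W by omega), if_neg (show ¬ k + 1 ≤ W by omega)]
          rcases lt_trichotomy k (2 * W) with h | h | h
          · rw [if_pos h, if_pos h.le, if_pos (show k + 1 ≤ 2 * W by omega)]
            simp only [Bool.false_eq_true, if_false]
            omega
          · rw [if_neg (show ¬ k < 2 * W by omega), if_pos h.le,
              if_neg (show ¬ k + 1 ≤ 2 * W by omega)]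
            split <;> omega
          · rw [if_neg (show ¬ k < 2 * W by omega), if_neg (show ¬ k ≤ 2 * W by omega),
              if_neg (show ¬ k + 1 ≤ 2 * W by omega)]
            split <;> omega
        · split
          · exact (funext (ite_tape_self _ _)).trans h0
          · exact (funext (ite_tape_self _ _)).trans h0
        · intro n j hj
          by_cases hk2 : k ≤ 2 * W
          · simp only [if_pos hk2]
            rw [if_neg (show ¬ k ≤ W by omega), if_pos hk2] at hh
            have hiff := block_eq_iff (m := n) (n := c.head) hj (show 2 * W - k < W by omega)
            rw [← hh] at hiff
            by_cases hnj : n = c.head ∧ j = 2 * W - k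
            · rw [if_pos (hiff.2 hnj), if_pos (by omega), hnj.2]
              rfl
            · rw [if_neg (mt hiff.1 hnj), h1 n j hj]
              by_cases hnj2 : n = c.head ∧ 2 * W < k + j
              · rw [if_pos hnj2, if_pos (by omega)]
              · rw [if_neg hnj2, if_neg (by omega)]
          · simp only [if_neg hk2]
            rw [ite_tape_self (sn.tape 1) sn.head, h1 n j hj]
            by_cases hn : n = c.head
            · rw [if_pos (by omega), if_pos (by omega)]
            · rw [if_neg (by omega), if_neg (by omega)]
        · split
          · exact (funext (ite_tape_self _ _)).trans h2
          · exact (funext (ite_tape_self _ _)).trans h2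
      · have hm : (P.micro W (some (c.state, t, buf)) (fun i => sn.tape i sn.head)) =
            (some (c.state, nextPhase t, buf), fun i => sn.tape i sn.head, false) := by
          rw [micro, dif_neg (by omega), if_neg (by omega), hres]
          simp only [hb, if_neg (show ¬ t.1 = 2 * W by omega)]
        rw [hm]
        simp only [ite_tape_self, Bool.false_eq_true, if_false]
        rw [if_neg (by omega), if_pos (by omega)] at hh
        refine ⟨⟨_, nextPhase t, rfl, hnext, fun j hj => hbuf j (by omega)⟩, ?_, h0, ?_, h2⟩
        · rw [if_neg (by omega), if_pos (by omega), hh]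
          omega
        · intro n j hj
          rw [h1 n j hj, hv]
          by_cases hn : n = c.head
          · subst hn
            simp
          · rw [if_neg (by omega), if_neg (by omega)]

theorem enc_apply (hW : 2 ≤ W) {c : Cfg S} {v : S × (ℕ → Bool) × Bool} {sn : Snapshot Q}
    (hc : ∀ k, W ≤ k → c.tr c.head k = false) (hv : P.actOn W x c = .inr v)
    (h : Mid e x c v (3 * W - 1) sn) :
    Enc hW0 e x (apply W c v) ((P.machineOf W Q hW0 e).stepSnap sn) := by
  obtain ⟨⟨buf, t, hst, ht, hbuf⟩, hh, h0, h1, h2⟩ := h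
  have hres := P.resolve_eq x hc fun j => hbuf j (by omega)
  have hnext : nextPhase t = ⟨0, by omega⟩ := by
    simp only [nextPhase, ht, Nat.sub_add_cancel (show 1 ≤ 3 * W by omega), Nat.mod_self]
  have htr : (P.machineOf W Q hW0 e).trans (sn.state, fun i => sn.tape i sn.head) =
      (e (some (v.1, ⟨0, by omega⟩, buf)), fun i => sn.tape i sn.head, v.2.2) := by
    simp only [machineOf, hst, Equiv.symm_apply_apply]
    rw [micro, dif_neg (by omega), if_neg (by omega), hres, hv]
    simp only [if_neg (show ¬ t.1 + 1 < 3 * W by omega), if_neg (show ¬ t.1 ≤ 2 * W by omega),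
      if_neg (show ¬ t.1 < 2 * W by omega), hnext]
  simp only [Enc, Machine.stepSnap]
  rw [htr]
  simp only [ite_tape_self]
  rw [if_neg (by omega), if_neg (by omega)] at hh
  refine ⟨⟨buf, rfl⟩, ?_, h0, ?_, h2⟩
  · simp only [apply, hh]
    split
    · rw [add_mul]
      omega
    · rw [Nat.sub_mul]
      omega
  · intro n k hk
    rw [h1 n k hk]
    simp only [apply]
    by_cases hn : n = c.head
    · rw [if_pos (by omega), if_pos (by omega)]
    · rw [if_neg (by omega), if_neg (by omega)]

theorem halt_step (hW : 2 ≤ W) {c : Cfg S} {v : S × (ℕ → Bool) × Bool} {b : Bool} {sn : Snapshot Q}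
    (hc : ∀ k, W ≤ k → c.tr c.head k = false) (hb : P.actOn W x c = .inl b) (hhead : c.head = 0)
    (h : Mid e x c v (2 * W) sn) :
    ((P.machineOf W Q hW0 e).stepSnap sn).state = e none ∧
    ((P.machineOf W Q hW0 e).stepSnap sn).tape 2 = if b then oneR else zeroR := by
  obtain ⟨⟨buf, t, hst, ht, hbuf⟩, hh, h0, h1, h2⟩ := h
  have hres := P.resolve_eq x hc fun j => hbuf j (by omega)
  have htr : (P.machineOf W Q hW0 e).trans (sn.state, fun i => sn.tape i sn.head) =
      (e none, ![sn.tape 0 sn.head, sn.tape 1 sn.head, b], true) := by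
    simp only [machineOf, hst, Equiv.symm_apply_apply]
    rw [micro, dif_neg (by omega), if_neg (by omega), hres, hb]
    simp only [if_pos ht]
  simp only [Machine.stepSnap]
  rw [htr]
  refine ⟨rfl, ?_⟩
  funext n
  have hh0 : sn.head = 0 := by rw [hh, if_neg (by omega), if_pos le_rfl, hhead]; omega
  simp only [hh0, h2]
  change (if n = 0 then b else zeroR n) = _
  cases b <;> simp [oneR, zeroR]

theorem mid_zero {c : Cfg S} {sn : Snapshot Q} (v : S × (ℕ → Bool) × Bool)
    (h : Enc hW0 e x c sn) : Mid e x c v 0 sn := by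
  obtain ⟨⟨buf, hst⟩, hh, h0, h1, h2⟩ := h
  refine ⟨⟨buf, _, hst, rfl, fun j hj => by omega⟩, by simpa using hh, h0, fun n j hj => ?_, h2⟩
  rw [h1 n j hj, if_neg (by omega)]

theorem mid_iterate (hW : 2 ≤ W) {c : Cfg S} {v : S × (ℕ → Bool) × Bool} {sn : Snapshot Q}
    (hc : ∀ k, W ≤ k → c.tr c.head k = false) (h : Enc hW0 e x c sn) {k : ℕ} (hk : k < 3 * W)
    (hv : P.actOn W x c = .inr v ∨
      (∃ b, P.actOn W x c = .inl b) ∧ v.2.1 = c.tr c.head ∧ k ≤ 2 * W) :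
    Mid e x c v k ((P.machineOf W Q hW0 e).stepSnap^[k] sn) := by
  induction k with
  | zero => exact mid_zero hW0 e x v h
  | succ k ih =>
    refine (congrArg (Mid e x c v (k + 1))
      (Function.iterate_succ_apply' (P.machineOf W Q hW0 e).stepSnap k sn)).mpr ?_
    refine P.mid_step hW0 e x hW hc ?_ hk (ih (by omega) ?_)
    · rcases hv with hv | ⟨h1, h2, h3⟩
      · exact .inl hv
      · exact .inr ⟨h1, h2, by omega⟩
    · rcases hv with hv | ⟨h1, h2, h3⟩
      · exact .inl hv
      · exact .inr ⟨h1, h2, by omega⟩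

theorem exists_stage {T : ℕ} (hT : 0 < T) {η α : Ordinal.{0}} (h : η < T * α) :
    ∃ γ < α, ∃ k < T, η = T * γ + (k : ℕ) := by
  have hT0 : (T : Ordinal.{0}) ≠ 0 := by exact_mod_cast hT.ne'
  obtain ⟨k, hk⟩ := Ordinal.lt_omega0.1 ((Ordinal.mod_lt η hT0).trans (Ordinal.natCast_lt_omega0 T))
  refine ⟨η / T, (Ordinal.lt_mul_iff_div_lt hT0).1 h, k, ?_, ?_⟩
  · have := Ordinal.mod_lt η hT0
    rw [hk] at this
    exact_mod_cast this
  · rw [← hk, Ordinal.div_add_mod]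

theorem enc_run (hW : 2 ≤ W) (α : Ordinal.{0}) (h : ∀ β < α, ∃ v, P.actOn W x (P.run W x β) = .inr v) :
    Enc hW0 e x (P.run W x α) ((P.machineOf W Q hW0 e).snap x ((3 * W : ℕ) * α)) := by
  have hc : ∀ β k, W ≤ k → (P.run W x β).tr (P.run W x β).head k = false :=
    fun β k hk => P.run_tr_of_le W x β _ hk
  have hT0 : (0 : Ordinal.{0}) < (3 * W : ℕ) := by exact_mod_cast (by omega : 0 < 3 * W)
  induction α using Ordinal.limitRecOn with
  | zero =>
    rw [mul_zero, Machine.snap_zero, run_zero]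
    refine ⟨⟨_, rfl⟩, by simp [Machine.init], ?_, fun n k hk => ?_, ?_⟩
    · funext n; simp [Machine.init]
    · simp [Machine.init]
    · funext n; simp [Machine.init, zeroR]
  | add_one α ih =>
    have hE := ih fun β hβ => h β (hβ.trans (lt_add_one α))
    obtain ⟨v, hv⟩ := h α (lt_add_one α)
    rw [mul_add_one, Machine.snap_add_nat, run_add_one]
    have hm := P.mid_iterate hW0 e x hW (hc α) hE (show 3 * W - 1 < 3 * W by omega) (.inl hv)
    have := P.enc_apply hW0 e x hW (hc α) hv hm
    rw [← Function.iterate_succ_apply' (P.machineOf W Q hW0 e).stepSnap,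
      Nat.succ_eq_add_one, Nat.sub_add_cancel (by omega)] at this
    rw [step, hv]
    exact this
  | limit α hα ih =>
    have hE : ∀ β < α, _ := fun β hβ => ih β hβ fun γ hγ => h γ (hγ.trans hβ)
    have hlim : Order.IsSuccLimit (((3 * W : ℕ) : Ordinal.{0}) * α) :=
      Ordinal.isSuccLimit_mul_right hT0 hα
    have hpos : (0 : Ordinal.{0}) < (3 * W : ℕ) * α := hlim.bot_lt
    have hmid : ∀ η < ((3 * W : ℕ) : Ordinal.{0}) * α, ∃ γ < α, ∃ k < 3 * W, ∃ v,
        η = (3 * W : ℕ) * γ + (k : ℕ) ∧ P.actOn W x (P.run W x γ) = .inr v ∧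
        Mid e x (P.run W x γ) v k ((P.machineOf W Q hW0 e).snap x η) := by
      intro η hη
      obtain ⟨γ, hγ, k, hk, rfl⟩ := exists_stage (by omega) hη
      obtain ⟨v, hv⟩ := h γ hγ
      refine ⟨γ, hγ, k, hk, v, rfl, hv, ?_⟩
      rw [Machine.snap_add_nat]
      exact P.mid_iterate hW0 e x hW (hc γ) (hE γ hγ) hk (.inl hv)
    rw [Machine.snap_limit _ _ hlim, run_limit P W x hα]
    refine ⟨⟨_, rfl⟩, by simp, ?_, ?_, ?_⟩
    · funext n
      refine limsupBelow_of_eventually (β := 0) hpos fun η _ hη => ?_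
      obtain ⟨γ, _, k, _, v, _, _, _, _, h0, _⟩ := hmid η hη
      simp only [h0]
    · intro n j hj
      rw [Bool.eq_iff_iff, limsupBelow_eq_true, limsupBelow_eq_true]
      constructor
      · intro H β hβ
        obtain ⟨η, h1, h2, h3⟩ := H ((3 * W : ℕ) * β) ((mul_lt_mul_iff_right₀ hT0).2 hβ)
        obtain ⟨γ, hγ, k, hk, v, rfl, hv, _, _, _, htape, _⟩ := hmid η h2
        have hβγ : β ≤ γ := by
          by_contra hlt
          have h4 : (3 * W : ℕ) * (γ + 1) ≤ ((3 * W : ℕ) : Ordinal.{0}) * β :=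
            mul_le_mul_right (Order.add_one_le_of_lt (not_le.1 hlt)) _
          rw [mul_add_one] at h4
          have h5 : ((3 * W : ℕ) : Ordinal.{0}) * γ + (k : ℕ) < (3 * W : ℕ) * γ + (3 * W : ℕ) :=
            by gcongr
          exact absurd (h5.trans_le h4) (not_lt.2 h1)
        simp only [htape n j hj] at h3
        split at h3
        next hcond =>
          refine ⟨γ + 1, hβγ.trans (le_of_lt (lt_add_one γ)), hα.add_one_lt hγ, ?_⟩
          rw [run_add_one, step, hv]
          simp only [apply]
          rw [if_pos ⟨hcond.1, hj⟩, h3]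
        next => exact ⟨γ, hβγ, hγ, h3⟩
      · intro H β hβ
        obtain ⟨β', hβ', hlt⟩ := (Ordinal.lt_mul_iff_of_isSuccLimit hα).1 hβ
        obtain ⟨γ, h1, h2, h3⟩ := H β' hβ'
        refine ⟨(3 * W : ℕ) * γ, hlt.le.trans (mul_le_mul_right h1 _),
          (mul_lt_mul_iff_right₀ hT0).2 h2, ?_⟩
        rw [(hE γ h2).2.2.2.1 n j hj, h3]
    · funext n
      refine limsupBelow_of_eventually (β := 0) hpos fun η _ hη => ?_
      obtain ⟨γ, _, k, _, v, _, _, _, _, _, _, h2⟩ := hmid η hη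
      simp only [h2]

end Simulation

/-- Every block machine with finitely many states is simulated by an infinite time Turing
machine. -/
theorem exists_machine [Fintype S] (P : Macro S) {W : ℕ} (hW : 2 ≤ W) :
    ∃ M : Machine, ∀ x α b, (∀ β < α, ∃ v, P.actOn W x (P.run W x β) = .inr v) →
      (P.run W x α).head = 0 → P.actOn W x (P.run W x α) = .inl b →
      M.outputs x (if b then oneR else zeroR) := by
  have hW0 : 0 < W := by omega
  let e : MState S W ≃ Fin (Fintype.card (S × Fin (3 * W) × (Fin W → Bool × Bool)) + 1) :=
    Fintype.equivFinOfCardEq (by simp)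
  refine ⟨P.machineOf W _ hW0 e, fun x α b h hhead hb => ?_⟩
  have hc : ∀ β k, W ≤ k → (P.run W x β).tr (P.run W x β).head k = false :=
    fun β k hk => P.run_tr_of_le W x β _ hk
  have hm : ∀ k, k ≤ 2 * W → Mid e x (P.run W x α)
      ((P.run W x α).state, (P.run W x α).tr (P.run W x α).head, true) k
      ((P.machineOf W _ hW0 e).snap x ((3 * W : ℕ) * α + (k : ℕ))) := by
    intro k hk
    rw [Machine.snap_add_nat]
    exact P.mid_iterate hW0 e x hW (hc α) (P.enc_run hW0 e x hW α h) (by omega)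
      (.inr ⟨⟨b, hb⟩, rfl, hk⟩)
  have hh := P.halt_step hW0 e x hW (hc α) hb hhead (hm _ le_rfl)
  rw [← Machine.snap_add_one] at hh
  refine ⟨_, ⟨hh.1, fun η hη hhalt => ?_⟩, hh.2⟩
  have hη' : η < (3 * W : ℕ) * (α + 1) := by
    refine hη.trans ?_
    rw [mul_add_one, add_assoc]
    gcongr
    exact_mod_cast (by omega : 2 * W + 1 < 3 * W)
  obtain ⟨γ, hγ, k, hk, rfl⟩ := exists_stage (by omega) hη'
  have : ∃ v, Mid e x (P.run W x γ) v k
      ((P.machineOf W _ hW0 e).snap x ((3 * W : ℕ) * γ + (k : ℕ))) := by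
    rcases (Order.lt_add_one_iff.1 hγ).lt_or_eq with hlt | rfl
    · obtain ⟨v, hv⟩ := h γ hlt
      refine ⟨v, ?_⟩
      rw [Machine.snap_add_nat]
      exact P.mid_iterate hW0 e x hW (hc γ)
        (P.enc_run hW0 e x hW γ fun β hβ => h β (hβ.trans hlt)) hk (.inl hv)
    · refine ⟨_, hm k ?_⟩
      rw [add_assoc] at hη
      have := (add_lt_add_iff_left _).1 hη
      exact Nat.lt_succ_iff.1 (by exact_mod_cast this)
  obtain ⟨v, ⟨buf, t, hst, _⟩, _⟩ := this
  rw [Machine.haltedAt, hst] at hhalt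
  have := e.injective hhalt
  simp at this

end Macro

/-- What an elementary operation does at the block indexed by the value of its register. -/
inductive Kind
  | inc
  | clr
  | lt (r : ℕ)
  | rdN
  | rdNold
  | rdY
  | rdInv
  | setB
  | setE

/-- The data a program can only read. -/
structure Ctx where
  y : ℕ → Bool
  inv : ℕ → Bool
  N : ℕ → Bool
  Nold : ℕ → Bool

/-- The data a program can modify. -/
@[ext] structure Mem where
  reg : ℕ → ℕ
  B : ℕ → Bool
  E : ℕ → Bool

/-- The truth value returned by an elementary operation. -/
def Kind.res (C : Ctx) (μ : Mem) (i : ℕ) : Kind → Bool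
  | .lt r => decide (μ.reg i < μ.reg r)
  | .rdN => C.N (μ.reg i)
  | .rdNold => C.Nold (μ.reg i)
  | .rdY => C.y (μ.reg i)
  | .rdInv => C.inv (μ.reg i)
  | _ => false

/-- The effect of an elementary operation. -/
def Kind.eff (μ : Mem) (i : ℕ) : Kind → Mem
  | .inc => { μ with reg := Function.update μ.reg i (μ.reg i + 1) }
  | .clr => { μ with reg := Function.update μ.reg i 0 }
  | .setB => { μ with B := Function.update μ.B (μ.reg i) true }
  | .setE => { μ with E := Function.update μ.E (μ.reg i) true }
  | _ => μ

/-- Structured programs. -/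
inductive Cmd
  | op (i : ℕ) (k : Kind)
  | seq (a b : Cmd)
  | ite (i : ℕ) (k : Kind) (a b : Cmd)
  | loop (i : ℕ) (k : Kind) (a : Cmd)

/-- Big-step semantics of structured programs. -/
inductive Exec (C : Ctx) : Cmd → Mem → Mem → Prop
  | op {i k μ} : Exec C (.op i k) μ (k.eff μ i)
  | seq {a b μ ν ξ} : Exec C a μ ν → Exec C b ν ξ → Exec C (.seq a b) μ ξ
  | ite_true {i k a b μ ν} : k.res C μ i = true → Exec C a (k.eff μ i) ν →
      Exec C (.ite i k a b) μ ν
  | ite_false {i k a b μ ν} : k.res C μ i = false → Exec C b (k.eff μ i) ν →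
      Exec C (.ite i k a b) μ ν
  | loop_false {i k a μ} : k.res C μ i = false → Exec C (.loop i k a) μ (k.eff μ i)
  | loop_true {i k a μ ν ξ} : k.res C μ i = true → Exec C a (k.eff μ i) ν →
      Exec C (.loop i k a) ν ξ → Exec C (.loop i k a) μ ξ

/-- A program acting on registers only. -/
def RExec (c : Cmd) (ρ ρ' : ℕ → ℕ) : Prop := ∀ C B E, Exec C c ⟨ρ, B, E⟩ ⟨ρ', B, E⟩

namespace Cmd

/-- The program that does nothing. -/
def skip : Cmd := .op 0 (.lt 0)

/-- Increase register `o` to the value of register `i`. -/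
def copy (i o : ℕ) : Cmd := .loop o (.lt i) (.op o .inc)

end Cmd

namespace RExec

theorem skip (ρ : ℕ → ℕ) : RExec .skip ρ ρ := fun _ _ _ => .op

theorem inc (ρ : ℕ → ℕ) (i : ℕ) : RExec (.op i .inc) ρ (Function.update ρ i (ρ i + 1)) :=
  fun _ _ _ => .op

theorem clr (ρ : ℕ → ℕ) (i : ℕ) : RExec (.op i .clr) ρ (Function.update ρ i 0) :=
  fun _ _ _ => .op

theorem seq {a b : Cmd} {ρ ρ' ρ'' : ℕ → ℕ} (h : RExec a ρ ρ') (h' : RExec b ρ' ρ'') :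
    RExec (.seq a b) ρ ρ'' := fun C B E => .seq (h C B E) (h' C B E)

theorem of_eq {c : Cmd} {ρ ρ' ρ'' : ℕ → ℕ} (h : RExec c ρ ρ') (h' : ρ' = ρ'') : RExec c ρ ρ'' :=
  h' ▸ h

theorem loop_lt {a : Cmd} {i r : ℕ} (f : ℕ → ℕ → ℕ) (m : ℕ)
    (hlt : ∀ k, k ≤ m → (f k i < f k r ↔ k < m)) (h : ∀ k < m, RExec a (f k) (f (k + 1)))
    (k : ℕ) (hk : k ≤ m) : RExec (.loop i (.lt r) a) (f k) (f m) := by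
  induction hk using Nat.decreasingInduction with
  | self => exact fun C B E => .loop_false (by simp [Kind.res, hlt m le_rfl])
  | of_succ k hk ih =>
    exact fun C B E => .loop_true (by simpa [Kind.res, hlt k hk.le] using hk) (h k hk C B E)
      (ih C B E)

theorem copy (ρ : ℕ → ℕ) {i o : ℕ} (hio : i ≠ o) (ho : ρ o = 0) :
    RExec (.copy i o) ρ (Function.update ρ o (ρ i)) := by
  have := loop_lt (a := .op o .inc) (i := o) (r := i) (fun k => Function.update ρ o k) (ρ i)
    (fun k _ => by simp [Function.update_of_ne hio])
    (fun k _ => (inc _ o).of_eq (by simp)) 0 (Nat.zero_le _)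
  simpa [← ho, Cmd.copy] using this

end RExec

/-- A function of several arguments is computed by a program using only registers from `b` on as
temporary storage. -/
def RegComputable {n : ℕ} (f : List.Vector ℕ n → ℕ) : Prop :=
  ∀ (b : ℕ) (ins : Fin n → ℕ) (out : ℕ), (∀ i, ins i < b) → out < b → (∀ i, ins i ≠ out) →
    ∃ c : Cmd, ∀ ρ : ℕ → ℕ, (∀ r, b ≤ r → ρ r = 0) → ρ out = 0 →
      RExec c ρ (Function.update ρ out (f (List.Vector.ofFn fun i => ρ (ins i))))

namespace RegComputable

theorem exists_fill {n m b : ℕ} {g : Fin m → List.Vector ℕ n → ℕ} (hg : ∀ i, RegComputable (g i))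
    (ins : Fin n → ℕ) (hins : ∀ i, ins i < b) (k : ℕ) (hk : k ≤ m) :
    ∃ c : Cmd, ∀ ρ : ℕ → ℕ, (∀ r, b ≤ r → ρ r = 0) →
      RExec c ρ (fun r => if h : b ≤ r ∧ r < b + k then
        g ⟨r - b, by omega⟩ (List.Vector.ofFn fun i => ρ (ins i)) else ρ r) := by
  induction k with
  | zero =>
    refine ⟨.skip, fun ρ _ => (RExec.skip ρ).of_eq ?_⟩
    funext r
    rw [dif_neg (by omega)]
  | succ k ih =>
    obtain ⟨c, hc⟩ := ih (by omega)
    obtain ⟨d, hd⟩ := hg ⟨k, by omega⟩ (b + k + 1) ins (b + k) (fun i => by have := hins i; omega)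
      (by omega) (fun i => by have := hins i; omega)
    refine ⟨.seq c d, fun ρ hρ => ((hc ρ hρ).seq (hd _ ?_ ?_)).of_eq ?_⟩
    · intro r hr
      rw [dif_neg (by omega), hρ r (by omega)]
    · rw [dif_neg (by omega), hρ _ (by omega)]
    · have hold : (fun i => if h : b ≤ ins i ∧ ins i < b + k then
          g ⟨ins i - b, by omega⟩ (List.Vector.ofFn fun i => ρ (ins i)) else ρ (ins i)) =
          fun i => ρ (ins i) := by
        funext i
        rw [dif_neg (by have := hins i; omega)]
      rw [hold]
      funext r
      by_cases hr : r = b + k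
      · subst hr
        rw [Function.update_self, dif_pos (by omega)]
        congr 1
        simp
      · rw [Function.update_of_ne hr]
        by_cases h : b ≤ r ∧ r < b + k
        · rw [dif_pos h, dif_pos (by omega)]
        · rw [dif_neg h, dif_neg (by omega)]

theorem exists_clear (b k : ℕ) :
    ∃ c : Cmd, ∀ ρ : ℕ → ℕ, RExec c ρ (fun r => if b ≤ r ∧ r < b + k then 0 else ρ r) := by
  induction k with
  | zero =>
    refine ⟨.skip, fun ρ => (RExec.skip ρ).of_eq ?_⟩
    funext r
    rw [if_neg (by omega)]
  | succ k ih =>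
    obtain ⟨c, hc⟩ := ih
    refine ⟨.seq c (.op (b + k) .clr), fun ρ => ((hc ρ).seq (RExec.clr _ _)).of_eq ?_⟩
    funext r
    by_cases hr : r = b + k
    · subst hr
      simp
    · rw [Function.update_of_ne hr]
      exact if_congr (by omega) rfl rfl

theorem get {n : ℕ} (i : Fin n) : RegComputable fun v : List.Vector ℕ n => v.get i := by
  intro b ins out _ _ hne
  refine ⟨.copy (ins i) out, fun ρ _ h0 => (RExec.copy ρ (hne i) h0).of_eq ?_⟩
  simp

theorem comp {m n : ℕ} {f : List.Vector ℕ n → ℕ} (g : Fin n → List.Vector ℕ m → ℕ)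
    (hf : RegComputable f) (hg : ∀ i, RegComputable (g i)) :
    RegComputable fun v => f (List.Vector.ofFn fun i => g i v) := by
  intro b ins out hins hout hne
  obtain ⟨c, hc⟩ := exists_fill hg ins hins n le_rfl
  obtain ⟨d, hd⟩ := hf (b + n) (fun i => b + i) out (fun i => by have := i.2; omega) (by omega)
    (fun i => by omega)
  obtain ⟨z, hz⟩ := exists_clear b n
  refine ⟨.seq c (.seq d z), fun ρ hρ h0 => ((hc ρ hρ).seq ((hd _ ?_ ?_).seq (hz _))).of_eq ?_⟩
  · intro r hr
    rw [dif_neg (by omega), hρ r (by omega)]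
  · rw [dif_neg (by omega), h0]
  · funext r
    by_cases hr : r = out
    · subst hr
      rw [if_neg (by omega), Function.update_self, Function.update_self]
      congr 2
      funext i
      rw [dif_pos (by have := i.2; omega)]
      congr 1
      simp
    · rw [Function.update_of_ne hr, Function.update_of_ne hr]
      by_cases h : b ≤ r ∧ r < b + n
      · rw [if_pos h, hρ r h.1]
      · rw [if_neg h, dif_neg h]

theorem ofFn_cons {n : ℕ} (f : Fin (n + 1) → ℕ) :
    List.Vector.ofFn f = f 0 ::ᵥ List.Vector.ofFn fun i => f i.succ := rfl

theorem prec {n : ℕ} {f : List.Vector ℕ n → ℕ} {g : List.Vector ℕ (n + 2) → ℕ}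
    (hf : RegComputable f) (hg : RegComputable g) :
    RegComputable fun v : List.Vector ℕ (n + 1) =>
      v.head.rec (f v.tail) fun y IH => g (y ::ᵥ IH ::ᵥ v.tail) := by
  intro b ins out hins hout hne
  obtain ⟨c, hc⟩ := hf (b + 3) (fun i => ins i.succ) (b + 1)
    (fun i => by have := hins i.succ; omega) (by omega) (fun i => by have := hins i.succ; omega)
  obtain ⟨d, hd⟩ := hg (b + 3) (Fin.cons b (Fin.cons (b + 1) fun i => ins i.succ)) (b + 2)
    (by
      refine Fin.cases ?_ (Fin.cases ?_ fun i => ?_)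
      · simp
      · simp
      · have := hins i.succ
        simp only [Fin.cons_succ]
        omega)
    (by omega)
    (by
      refine Fin.cases ?_ (Fin.cases ?_ fun i => ?_)
      · simp
      · simp
      · have := hins i.succ
        simp only [Fin.cons_succ]
        omega)
  obtain ⟨z, hz⟩ := exists_clear b 2
  refine ⟨.seq c (.seq (.loop b (.lt (ins 0)) (.seq d (.seq (.op (b + 1) .clr)
    (.seq (.copy (b + 2) (b + 1)) (.seq (.op (b + 2) .clr) (.op b .inc))))))
    (.seq (.copy (b + 1) out) z)), fun ρ hρ h0 => ?_⟩
  set F : ℕ → ℕ := fun k => Nat.rec (f (List.Vector.ofFn fun i => ρ (ins i.succ)))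
    (fun y IH => g (y ::ᵥ IH ::ᵥ List.Vector.ofFn fun i => ρ (ins i.succ))) k with hF
  set st : ℕ → ℕ → ℕ := fun k r => if r = b then k else if r = b + 1 then F k else ρ r with hst
  have hins' : ∀ k i, st k (ins i) = ρ (ins i) := by
    intro k i
    have := hins i
    simp only [hst]
    rw [if_neg (by omega), if_neg (by omega)]
  have h1 : RExec c ρ (st 0) := by
    refine (hc ρ (fun r hr => hρ r (by omega)) (hρ _ (by omega))).of_eq ?_
    funext r
    simp only [hst, Function.update_apply]
    by_cases hr : r = b
    · subst hr
      simp [hρ r le_rfl]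
    · simp only [if_neg hr]
      rfl
  have h2 := RExec.loop_lt (a := .seq d (.seq (.op (b + 1) .clr)
    (.seq (.copy (b + 2) (b + 1)) (.seq (.op (b + 2) .clr) (.op b .inc))))) (i := b) (r := ins 0)
    st (ρ (ins 0)) (fun k _ => by rw [hins']; simp [hst]) (fun k _ => by
      refine ((hd (st k) ?_ ?_).seq ((RExec.clr _ _).seq ((RExec.copy _ (by omega) ?_).seq
        ((RExec.clr _ _).seq (RExec.inc _ _))))).of_eq ?_
      · intro r hr
        simp only [hst]
        rw [if_neg (by omega), if_neg (by omega), hρ r (by omega)]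
      · simp only [hst]
        rw [if_neg (by omega), if_neg (by omega), hρ _ (by omega)]
      · simp
      · have hv : (List.Vector.ofFn fun i => st k
            ((Fin.cons b (Fin.cons (b + 1) fun i => ins i.succ) : Fin (n + 2) → ℕ) i)) =
            k ::ᵥ F k ::ᵥ List.Vector.ofFn fun i => ρ (ins i.succ) := by
          rw [ofFn_cons, ofFn_cons]
          simp only [Fin.cons_zero, Fin.cons_succ, hins']
          simp [hst]
        rw [hv]
        funext r
        by_cases hr0 : r = b
        · subst hr0
          simp [hst]
        · by_cases hr1 : r = b + 1
          · subst hr1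
            simp [hst, hF]
          · by_cases hr2 : r = b + 2
            · subst hr2
              simp [hst, hρ]
            · simp [hst, hr0, hr1, hr2]) 0 (Nat.zero_le _)
  refine (h1.seq (h2.seq ((RExec.copy _ (by omega) ?_).seq (hz _)))).of_eq ?_
  · simp only [hst]
    rw [if_neg (by omega), if_neg (by omega), h0]
  · funext r
    by_cases hr : r = out
    · subst hr
      rw [if_neg (by omega), Function.update_self, Function.update_self]
      simp only [hst, hF]
      rw [if_neg (by omega), if_pos trivial, ofFn_cons]
      rfl
    · rw [Function.update_of_ne hr]
      by_cases h : b ≤ r ∧ r < b + 2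
      · rw [if_pos h, Function.update_of_ne hr, hρ r h.1]
      · rw [if_neg h, Function.update_of_ne hr]
        simp only [hst]
        rw [if_neg (by omega), if_neg (by omega)]

theorem succ : RegComputable fun v : List.Vector ℕ 1 => Nat.succ v.head := by
  intro b ins out _ _ hne
  refine ⟨.seq (.copy (ins 0) out) (.op out .inc), fun ρ _ h0 =>
    ((RExec.copy ρ (hne 0) h0).seq (RExec.inc _ _)).of_eq ?_⟩
  simp [ofFn_cons]

theorem of_primrec' {n : ℕ} {f : List.Vector ℕ n → ℕ} (hf : Nat.Primrec' f) : RegComputable f := by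
  induction hf with
  | zero =>
    intro b ins out _ _ _
    refine ⟨.skip, fun ρ _ h0 => (RExec.skip ρ).of_eq ?_⟩
    exact ((congrArg (Function.update ρ out) h0.symm).trans (Function.update_eq_self _ _)).symm
  | succ => exact succ
  | get i => exact get i
  | comp g _ _ ihf ihg => exact comp g ihf ihg
  | prec _ _ ihf ihg => exact prec ihf ihg

end RegComputable

theorem exists_cmd₁ {f : ℕ → ℕ} (hf : Primrec f) {b i o : ℕ} (hi : i < b) (ho : o < b)
    (hio : i ≠ o) : ∃ c : Cmd, ∀ ρ : ℕ → ℕ, (∀ r, b ≤ r → ρ r = 0) → ρ o = 0 →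
      RExec c ρ (Function.update ρ o (f (ρ i))) := by
  obtain ⟨c, hc⟩ := RegComputable.of_primrec' (Nat.Primrec'.prim_iff₁.2 hf) b (fun _ => i) o
    (fun _ => hi) ho (fun _ => hio)
  exact ⟨c, fun ρ h1 h2 => (hc ρ h1 h2).of_eq (by simp [RegComputable.ofFn_cons])⟩

theorem exists_cmd₂ {f : ℕ → ℕ → ℕ} (hf : Primrec₂ f) {b i j o : ℕ} (hi : i < b) (hj : j < b)
    (ho : o < b) (hio : i ≠ o) (hjo : j ≠ o) :
    ∃ c : Cmd, ∀ ρ : ℕ → ℕ, (∀ r, b ≤ r → ρ r = 0) → ρ o = 0 →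
      RExec c ρ (Function.update ρ o (f (ρ i) (ρ j))) := by
  obtain ⟨c, hc⟩ := RegComputable.of_primrec' (Nat.Primrec'.prim_iff₂.2 hf) b
    (Fin.cons i fun _ => j) o
    (Fin.cases hi fun _ => hj) ho (Fin.cases hio fun _ => hjo)
  exact ⟨c, fun ρ h1 h2 => (hc ρ h1 h2).of_eq (by simp [RegComputable.ofFn_cons])⟩

/-- A literal `l` asserts that `y (l / 2)` is the truth value of `l % 2 = 1`. -/
def litTrue (y : ℕ → Bool) (l : ℕ) : Prop := y (l / 2) = decide (l % 2 = 1)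

/-- The `j`-th edge is present in the graph described by `y`. -/
def edgeOn (edge : ℕ → ℕ × ℕ × List ℕ) (y : ℕ → Bool) (j : ℕ) : Prop :=
  ∀ l ∈ (edge j).2.2, litTrue y l

/-- The first eight registers. -/
def regs (j a b l k o s t : ℕ) : ℕ → ℕ
  | 0 => j
  | 1 => a
  | 2 => b
  | 3 => l
  | 4 => k
  | 5 => o
  | 6 => s
  | 7 => t
  | _ + 8 => 0

theorem regs_of_le {j a b l k o s t r : ℕ} (h : 9 ≤ r) : regs j a b l k o s t r = 0 := by
  obtain ⟨r, rfl⟩ := Nat.exists_eq_add_of_le' (show 8 ≤ r by omega)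
  rfl

section Update
variable {j a b l k o s t v : ℕ}

theorem update_regs_zero : Function.update (regs j a b l k o s t) 0 v = regs v a b l k o s t := by
  funext r; match r with
  | 0 | 1 | 2 | 3 | 4 | 5 | 6 | 7 | _ + 8 => rfl

theorem update_regs_one : Function.update (regs j a b l k o s t) 1 v = regs j v b l k o s t := by
  funext r; match r with
  | 0 | 1 | 2 | 3 | 4 | 5 | 6 | 7 | _ + 8 => rfl

theorem update_regs_two : Function.update (regs j a b l k o s t) 2 v = regs j a v l k o s t := by
  funext r; match r with
  | 0 | 1 | 2 | 3 | 4 | 5 | 6 | 7 | _ + 8 => rfl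

theorem update_regs_three : Function.update (regs j a b l k o s t) 3 v = regs j a b v k o s t := by
  funext r; match r with
  | 0 | 1 | 2 | 3 | 4 | 5 | 6 | 7 | _ + 8 => rfl

theorem update_regs_four : Function.update (regs j a b l k o s t) 4 v = regs j a b l v o s t := by
  funext r; match r with
  | 0 | 1 | 2 | 3 | 4 | 5 | 6 | 7 | _ + 8 => rfl

theorem update_regs_five : Function.update (regs j a b l k o s t) 5 v = regs j a b l k v s t := by
  funext r; match r with
  | 0 | 1 | 2 | 3 | 4 | 5 | 6 | 7 | _ + 8 => rfl

theorem update_regs_six : Function.update (regs j a b l k o s t) 6 v = regs j a b l k o v t := by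
  funext r; match r with
  | 0 | 1 | 2 | 3 | 4 | 5 | 6 | 7 | _ + 8 => rfl

theorem update_regs_seven : Function.update (regs j a b l k o s t) 7 v = regs j a b l k o s v := by
  funext r; match r with
  | 0 | 1 | 2 | 3 | 4 | 5 | 6 | 7 | _ + 8 => rfl

end Update

/-- The program examining the `j`-th edge, the `j`-th block of the input and the `j`-th entry of
the approximations, where `j` is kept in register `0`. -/
theorem exists_body {edge : ℕ → ℕ × ℕ × List ℕ} (hedge : Primrec edge) :
    ∃ c : Cmd, ∀ (C : Ctx) (B E : ℕ → Bool) (j : ℕ),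
      Exec C c ⟨regs j 0 0 0 0 0 0 0, B, E⟩ ⟨regs (j + 1) 0 0 0 0 0 0 0,
        fun n => B n || decide (n = (edge j).2.1 ∧ edgeOn edge C.y j ∧ C.N (edge j).1 = true) ||
          decide (n = 0 ∧ C.inv j = true),
        fun n => E n || decide (n = 0 ∧ C.Nold j = true ∧ C.N j = false)⟩ := by
  have hlit : Primrec₂ fun j k => ((edge j).2.2.getD k 0) :=
    (Primrec.list_getD 0).comp₂ ((Primrec.snd.comp (Primrec.snd.comp hedge)).comp₂ Primrec₂.left)
      Primrec₂.right
  obtain ⟨ca, hca⟩ := exists_cmd₁ (f := fun j => (edge j).1) (Primrec.fst.comp hedge)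
    (b := 9) (i := 0) (o := 1) (by omega) (by omega) (by omega)
  obtain ⟨cb, hcb⟩ := exists_cmd₁ (f := fun j => (edge j).2.1)
    (Primrec.fst.comp (Primrec.snd.comp hedge))
    (b := 9) (i := 0) (o := 2) (by omega) (by omega) (by omega)
  obtain ⟨cl, hcl⟩ := exists_cmd₁ (f := fun j => (edge j).2.2.length)
    (Primrec.list_length.comp (Primrec.snd.comp (Primrec.snd.comp hedge)))
    (b := 9) (i := 0) (o := 3) (by omega) (by omega) (by omega)
  obtain ⟨co, hco⟩ := exists_cmd₂ (f := fun j k => ((edge j).2.2.getD k 0) / 2)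
    (Primrec.nat_div.comp₂ hlit (Primrec₂.const 2))
    (b := 9) (i := 0) (j := 4) (o := 5) (by omega) (by omega) (by omega) (by omega) (by omega)
  obtain ⟨cs, hcs⟩ := exists_cmd₂ (f := fun j k => ((edge j).2.2.getD k 0) % 2)
    (Primrec.nat_mod.comp₂ hlit (Primrec₂.const 2))
    (b := 9) (i := 0) (j := 4) (o := 6) (by omega) (by omega) (by omega) (by omega) (by omega)
  refine ⟨.seq ca (.seq cb (.seq cl (.seq
    (.loop 4 (.lt 3) (.seq co (.seq cs (.seq
      (.ite 5 .rdY (.ite 8 (.lt 6) .skip (.op 7 .inc)) (.ite 8 (.lt 6) (.op 7 .inc) .skip))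
      (.seq (.op 5 .clr) (.seq (.op 6 .clr) (.op 4 .inc)))))))
    (.seq (.ite 8 (.lt 7) .skip (.ite 1 .rdN (.op 2 .setB) .skip))
    (.seq (.ite 0 .rdInv (.op 8 .setB) .skip)
    (.seq (.ite 0 .rdNold (.ite 0 .rdN .skip (.op 8 .setE)) .skip)
    (.seq (.op 1 .clr) (.seq (.op 2 .clr) (.seq (.op 3 .clr) (.seq (.op 4 .clr)
    (.seq (.op 7 .clr) (.op 0 .inc)))))))))))), fun C B E j => ?_⟩
  set a := (edge j).1
  set b := (edge j).2.1
  set L := (edge j).2.2 with hL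
  set bad : ℕ → ℕ := fun k => ∑ i ∈ Finset.range k, if litTrue C.y (L.getD i 0) then 0 else 1
    with hbad
  have h1 : Exec C ca ⟨regs j 0 0 0 0 0 0 0, B, E⟩ ⟨regs j a 0 0 0 0 0 0, B, E⟩ :=
    (hca _ (fun _ => regs_of_le) rfl).of_eq update_regs_one C B E
  have h2 : Exec C cb ⟨regs j a 0 0 0 0 0 0, B, E⟩ ⟨regs j a b 0 0 0 0 0, B, E⟩ :=
    (hcb _ (fun _ => regs_of_le) rfl).of_eq update_regs_two C B E
  have h3 : Exec C cl ⟨regs j a b 0 0 0 0 0, B, E⟩ ⟨regs j a b L.length 0 0 0 0, B, E⟩ :=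
    (hcl _ (fun _ => regs_of_le) rfl).of_eq update_regs_three C B E
  have hstep : ∀ k, Exec C (.seq co (.seq cs (.seq
      (.ite 5 .rdY (.ite 8 (.lt 6) .skip (.op 7 .inc)) (.ite 8 (.lt 6) (.op 7 .inc) .skip))
      (.seq (.op 5 .clr) (.seq (.op 6 .clr) (.op 4 .inc))))))
      ⟨regs j a b L.length k 0 0 (bad k), B, E⟩
      ⟨regs j a b L.length (k + 1) 0 0 (bad (k + 1)), B, E⟩ := by
    intro k
    refine .seq ((hco _ (fun _ => regs_of_le) rfl).of_eq update_regs_five C B E) ?_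
    refine .seq ((hcs _ (fun _ => regs_of_le) rfl).of_eq update_regs_six C B E) ?_
    refine .seq (ν := ⟨regs j a b L.length k (L.getD k 0 / 2) (L.getD k 0 % 2) (bad (k + 1)),
      B, E⟩) ?_ ?_
    · have hb : bad (k + 1) = bad k + if litTrue C.y (L.getD k 0) then 0 else 1 := by
        simp only [hbad]
        exact Finset.sum_range_succ _ _
      have hgood : litTrue C.y (L.getD k 0) → RExec .skip
          (regs j a b L.length k (L.getD k 0 / 2) (L.getD k 0 % 2) (bad k))
          (regs j a b L.length k (L.getD k 0 / 2) (L.getD k 0 % 2) (bad (k + 1))) := by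
        intro h
        rw [hb, if_pos h, add_zero]
        exact RExec.skip _
      have hbd : ¬ litTrue C.y (L.getD k 0) → RExec (.op 7 .inc)
          (regs j a b L.length k (L.getD k 0 / 2) (L.getD k 0 % 2) (bad k))
          (regs j a b L.length k (L.getD k 0 / 2) (L.getD k 0 % 2) (bad (k + 1))) := by
        intro h
        rw [hb, if_neg h]
        exact (RExec.inc _ _).of_eq update_regs_seven
      by_cases hy : C.y (L.getD k 0 / 2) = true
      · refine .ite_true hy ?_
        by_cases hs : 0 < L.getD k 0 % 2
        · refine .ite_true (by simpa [Kind.res, regs, Kind.eff] using hs) (hgood ?_ C B E)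
          rw [litTrue, hy, eq_comm, decide_eq_true_eq]
          omega
        · refine .ite_false (by simpa [Kind.res, regs, Kind.eff] using hs) (hbd ?_ C B E)
          rw [litTrue, hy, eq_comm, decide_eq_true_eq]
          omega
      · have hy' := Bool.not_eq_true _ ▸ hy
        refine .ite_false hy' ?_
        by_cases hs : 0 < L.getD k 0 % 2
        · refine .ite_true (by simpa [Kind.res, regs, Kind.eff] using hs) (hbd ?_ C B E)
          rw [litTrue, hy', eq_comm, decide_eq_false_iff_not]
          omega
        · refine .ite_false (by simpa [Kind.res, regs, Kind.eff] using hs) (hgood ?_ C B E)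
          rw [litTrue, hy', eq_comm, decide_eq_false_iff_not]
          omega
    · exact .seq ((RExec.clr _ _).of_eq update_regs_five C B E)
        (.seq ((RExec.clr _ _).of_eq update_regs_six C B E)
        ((RExec.inc _ _).of_eq update_regs_four C B E))
  have hloop : ∀ k, k ≤ L.length → Exec C (.loop 4 (.lt 3) (.seq co (.seq cs (.seq
      (.ite 5 .rdY (.ite 8 (.lt 6) .skip (.op 7 .inc)) (.ite 8 (.lt 6) (.op 7 .inc) .skip))
      (.seq (.op 5 .clr) (.seq (.op 6 .clr) (.op 4 .inc)))))))
      ⟨regs j a b L.length k 0 0 (bad k), B, E⟩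
      ⟨regs j a b L.length L.length 0 0 (bad L.length), B, E⟩ := by
    intro k hk
    induction hk using Nat.decreasingInduction with
    | self => exact .loop_false (by simp [Kind.res, regs])
    | of_succ k hk ih =>
      exact .loop_true (decide_eq_true hk) (hstep k) ih
  have hok : bad L.length = 0 ↔ edgeOn edge C.y j := by
    simp only [hbad, Finset.sum_eq_zero_iff, Finset.mem_range, edgeOn, ← hL]
    constructor
    · intro h l hl
      obtain ⟨i, hi, rfl⟩ := List.getElem_of_mem hl
      by_contra hc
      have := h i hi
      rw [List.getD_eq_getElem _ _ hi, if_neg hc] at this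
      omega
    · intro h i hi
      rw [List.getD_eq_getElem _ _ hi, if_pos (h _ (List.getElem_mem hi))]
  refine .seq h1 (.seq h2 (.seq h3 (.seq (hloop 0 (Nat.zero_le _)) ?_)))
  set ρ := regs j a b L.length L.length 0 0 (bad L.length) with hρ
  set B₁ : ℕ → Bool := fun n => B n || decide (n = b ∧ edgeOn edge C.y j ∧ C.N a = true)
  set B₂ : ℕ → Bool := fun n => B₁ n || decide (n = 0 ∧ C.inv j = true)
  have e1 : Exec C (.ite 8 (.lt 7) .skip (.ite 1 .rdN (.op 2 .setB) .skip)) ⟨ρ, B, E⟩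
      ⟨ρ, B₁, E⟩ := by
    by_cases h : edgeOn edge C.y j
    · refine .ite_false (by simp [Kind.res, hρ, regs, hok.2 h]) ?_
      by_cases hN : C.N a = true
      · have : B₁ = Function.update B b true := by
          funext n
          by_cases hn : n = b
          · simp [B₁, hn, h, hN]
          · simp [B₁, hn]
        rw [this]
        exact .ite_true hN .op
      · have : B₁ = B := by
          funext n
          simp [B₁, hN]
        rw [this]
        exact .ite_false (Bool.not_eq_true _ ▸ hN) (RExec.skip _ _ _ _)
    · have : B₁ = B := by
        funext n
        simp [B₁, h]
      rw [this]
      refine .ite_true ?_ (RExec.skip _ _ _ _)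
      have : bad L.length ≠ 0 := mt hok.1 h
      simpa [Kind.res, hρ, regs, Nat.pos_iff_ne_zero] using this
  have e2 : Exec C (.ite 0 .rdInv (.op 8 .setB) .skip) ⟨ρ, B₁, E⟩ ⟨ρ, B₂, E⟩ := by
    by_cases h : C.inv j = true
    · have : B₂ = Function.update B₁ 0 true := by
        funext n
        by_cases hn : n = 0
        · simp [B₂, hn, h]
        · simp [B₂, hn]
      rw [this]
      exact .ite_true h .op
    · have : B₂ = B₁ := by
        funext n
        simp [B₂, h]
      rw [this]
      exact .ite_false (Bool.not_eq_true _ ▸ h) (RExec.skip _ _ _ _)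
  refine .seq e1 (.seq e2 (.seq (ν := ⟨ρ, B₂, fun n => E n ||
    decide (n = 0 ∧ C.Nold j = true ∧ C.N j = false)⟩) ?_ ?_))
  · by_cases h : C.Nold j = true
    · refine .ite_true h ?_
      by_cases hN : C.N j = true
      · simp only [hN, Bool.true_eq_false, and_false, decide_false, Bool.or_false]
        exact .ite_true hN (RExec.skip _ _ _ _)
      · refine .ite_false (Bool.not_eq_true _ ▸ hN) ?_
        have : (fun n => E n || decide (n = 0 ∧ C.Nold j = true ∧ C.N j = false)) =
            Function.update E 0 true := by
          funext n
          by_cases hn : n = 0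
          · simp [hn, h, hN]
          · simp [hn]
        rw [this]
        exact .op
    · refine .ite_false (Bool.not_eq_true _ ▸ h) ?_
      simp only [h, false_and, and_false, decide_false, Bool.or_false, Bool.false_eq_true]
      exact RExec.skip _ _ _ _
  · exact .seq ((RExec.clr _ _).of_eq update_regs_one C _ _)
      (.seq ((RExec.clr _ _).of_eq update_regs_two C _ _)
      (.seq ((RExec.clr _ _).of_eq update_regs_three C _ _)
      (.seq ((RExec.clr _ _).of_eq update_regs_four C _ _)
      (.seq ((RExec.clr _ _).of_eq update_regs_seven C _ _)
      ((RExec.inc _ _).of_eq update_regs_zero C _ _)))))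

/-- A flowchart with program points `P`; leaving the flowchart is encoded by `none`. -/
structure Flow (P : Type) where
  entry : P
  instr : P → ℕ × Kind
  next : P → Bool → Option P

namespace Flow

variable {P P' : Type}

/-- One step of a flowchart. -/
inductive Step (F : Flow P) (C : Ctx) : Option P × Mem → Option P × Mem → Prop
  | mk (p : P) (μ : Mem) : Step F C (some p, μ)
      (F.next p ((F.instr p).2.res C μ (F.instr p).1), (F.instr p).2.eff μ (F.instr p).1)

/-- The flowchart carries out the program. -/
def Simulates (F : Flow P) (c : Cmd) : Prop :=
  ∀ C μ ν, Exec C c μ ν → Relation.ReflTransGen (F.Step C) (some F.entry, μ) (none, ν)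

theorem reach_map {F : Flow P} {G : Flow P'} {C : Ctx} (e : P → P') (k : Option P')
    (hi : ∀ p, G.instr (e p) = F.instr p)
    (hn : ∀ p b, G.next (e p) b = (F.next p b).elim k fun q => some (e q))
    {s t : Option P × Mem} (h : Relation.ReflTransGen (F.Step C) s t) :
    Relation.ReflTransGen (G.Step C) (s.1.elim k fun q => some (e q), s.2)
      (t.1.elim k fun q => some (e q), t.2) := by
  induction h with
  | refl => exact .refl
  | tail _ hst ih =>
    refine ih.tail ?_
    cases hst with
    | mk p μ =>
      have := Step.mk (F := G) (C := C) (e p) μ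
      rw [hn, hi] at this
      exact this

theorem exists_simulates (c : Cmd) : ∃ (P : Type) (_ : Fintype P) (F : Flow P), F.Simulates c := by
  induction c with
  | op i k =>
    refine ⟨Unit, inferInstance, ⟨(), fun _ => (i, k), fun _ _ => none⟩, fun C μ ν h => ?_⟩
    cases h
    exact .single (.mk () μ)
  | seq a b iha ihb =>
    obtain ⟨Pa, _, Fa, ha⟩ := iha
    obtain ⟨Pb, _, Fb, hb⟩ := ihb
    refine ⟨Pa ⊕ Pb, inferInstance, ⟨.inl Fa.entry, Sum.elim Fa.instr Fb.instr,
      Sum.elim (fun p b => (Fa.next p b).elim (some (Sum.inr Fb.entry)) fun q => some (.inl q))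
        (fun p b => (Fb.next p b).elim none fun q => some (.inr q))⟩, fun C μ ν h => ?_⟩
    cases h with
    | seq h h' =>
      exact (reach_map Sum.inl (some (Sum.inr Fb.entry)) (fun _ => rfl) (fun _ _ => rfl)
        (ha C _ _ h)).trans
        (reach_map Sum.inr none (fun _ => rfl) (fun _ _ => rfl) (hb C _ _ h'))
  | ite i k a b iha ihb =>
    obtain ⟨Pa, _, Fa, ha⟩ := iha
    obtain ⟨Pb, _, Fb, hb⟩ := ihb
    let F : Flow (Option (Pa ⊕ Pb)) := ⟨none,
      fun p => p.elim (i, k) (Sum.elim Fa.instr Fb.instr),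
      fun p r => p.elim (some (some (if r then .inl Fa.entry else .inr Fb.entry)))
        (Sum.elim (fun p => (Fa.next p r).elim none fun q => some (some (.inl q)))
        (fun p => (Fb.next p r).elim none fun q => some (some (.inr q))))⟩
    refine ⟨_, inferInstance, F, fun C μ ν h => ?_⟩
    have hstep : F.Step C (some none, μ) (F.next none (k.res C μ i), k.eff μ i) := Step.mk none μ
    cases h with
    | ite_true hr h =>
      rw [hr] at hstep
      exact .head hstep (reach_map (G := F) (fun p => some (.inl p)) none (fun _ => rfl)
        (fun _ _ => rfl) (ha C _ _ h))
    | ite_false hr h =>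
      rw [hr] at hstep
      exact .head hstep (reach_map (G := F) (fun p => some (.inr p)) none (fun _ => rfl)
        (fun _ _ => rfl) (hb C _ _ h))
  | loop i k a iha =>
    obtain ⟨Pa, _, Fa, ha⟩ := iha
    let F : Flow (Option Pa) := ⟨none,
      fun p => p.elim (i, k) Fa.instr,
      fun p r => p.elim (if r then some (some Fa.entry) else none)
        (fun p => (Fa.next p r).elim (some none) fun q => some (some q))⟩
    have hF (μ : Mem) (C : Ctx) :
        F.Step C (some none, μ) (F.next none (k.res C μ i), k.eff μ i) := Step.mk none μ
    refine ⟨_, inferInstance, F, fun C μ ν h => ?_⟩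
    generalize hc : Cmd.loop i k a = c at h
    induction h with
    | op => cases hc
    | seq => cases hc
    | ite_true => cases hc
    | ite_false => cases hc
    | @loop_false _ _ _ μ hr =>
      cases hc
      have hstep := hF μ C
      rw [hr] at hstep
      exact .single hstep
    | @loop_true _ _ _ μ _ _ hr h _ _ ih =>
      cases hc
      have hstep := hF μ C
      rw [hr] at hstep
      exact .head hstep ((reach_map (G := F) (fun p => some p) (some none) (fun _ => rfl)
        (fun _ _ => rfl) (ha C _ _ h)).trans (ih rfl))

end Flow

/-- The control states used outside of the execution of the flowchart. -/
inductive Ctl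
  | start
  | limit
  | fill
  | sweep

noncomputable instance : Fintype Ctl :=
  ⟨{.start, .limit, .fill, .sweep}, fun x => by cases x <;> simp⟩

namespace Kind

/-- The truth value returned by an operation, in terms of the input bits and the letter at the
current block. -/
def letterRes (d : Bool × Bool) (w : ℕ → Bool) : Kind → Bool
  | .lt r => w (r + 7)
  | .rdN => w 4
  | .rdNold => w 5
  | .rdY => d.1
  | .rdInv => d.2
  | _ => false

/-- The letter left by an operation at the block indexed by the value of its register. -/
def letterEff (w : ℕ → Bool) (i : ℕ) : Kind → ℕ → Bool
  | .inc => Function.update w (i + 7) true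
  | .setB => Function.update w 6 true
  | .setE => Function.update w 3 true
  | _ => w

/-- The letter left by an operation at earlier blocks. -/
def letterPass (w : ℕ → Bool) (i : ℕ) : Kind → ℕ → Bool
  | .clr => Function.update w (i + 7) false
  | _ => w

/-- All registers used by the operation on register `i` are below `b`. -/
def Bounded (b i : ℕ) : Kind → Prop
  | .lt r => i < b ∧ r < b
  | _ => i < b

end Kind

/-- The letter at block `n` during the execution of the flowchart. -/
def track (C : Ctx) (μ : Mem) (n : ℕ) : ℕ → Bool
  | 0 => decide (n = 0)
  | 1 => decide (n = 0)
  | 2 => false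
  | 3 => μ.E n
  | 4 => C.N n
  | 5 => C.Nold n
  | 6 => μ.B n
  | r + 7 => decide (n < μ.reg r)

namespace Flow

variable {P : Type} (F : Flow P) (dec : (ℕ → Bool) → Bool × Bool)

/-- The letter written at block `0` when a new round starts. -/
def roundLetter (w : ℕ → Bool) : ℕ → Bool
  | 0 => true
  | 2 => true
  | 3 => w 2
  | 4 => w 6
  | 5 => w 4
  | _ => false

/-- The letter written at the other blocks when a new round starts. -/
def sweepLetter (w : ℕ → Bool) : ℕ → Bool
  | 4 => w 6
  | 5 => w 4
  | _ => false

/-- The action of the block machine iterating the flowchart. -/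
def act : Ctl ⊕ P × Option Bool → (ℕ → Bool) → (ℕ → Bool) →
    Bool ⊕ ((Ctl ⊕ P × Option Bool) × (ℕ → Bool) × Bool)
  | .inl .start, _, _ =>
    .inr (.inl .fill, fun k => decide (k = 0 ∨ k = 2 ∨ k = 3 ∨ k = 4), true)
  | .inl .fill, _, _ => .inr (.inl .fill, fun k => decide (k = 4), true)
  | .inl .sweep, _, w => .inr (.inl .sweep, sweepLetter w, true)
  | .inl .limit, _, w =>
    if w 2 = true ∧ w 1 = false then
      .inr (.inr (F.entry, none), Function.update (Function.update w 2 false) 1 true, false)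
    else if w 3 = false then .inl (!w 4)
    else .inr (.inl .sweep, roundLetter w, true)
  | .inr (p, none), v, w =>
    if w ((F.instr p).1 + 7) = true then
      .inr (.inr (p, none), (F.instr p).2.letterPass w (F.instr p).1, true)
    else
      .inr (.inr (p, some ((F.instr p).2.letterRes (dec v) w)),
        (F.instr p).2.letterEff w (F.instr p).1, false)
  | .inr (p, some b), _, w =>
    .inr (if w 0 = true then .inr ((F.next p b).getD F.entry, none) else .inr (p, some b),
      w, false)

/-- The block machine iterating the flowchart. -/
def macroOf : Macro (Ctl ⊕ P × Option Bool) := ⟨.inl .start, .inl .limit, F.act dec⟩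

variable {F dec} {W : ℕ} {x : R} {C : Ctx}

/-- The configuration is about to execute the program point `p` with memory `μ`. -/
structure Ready (W : ℕ) (C : Ctx) (p : P) (μ : Mem) (c : Cfg (Ctl ⊕ P × Option Bool)) : Prop where
  state : c.state = .inr (p, none)
  head : c.head = 0
  tr : ∀ n k, k < W → c.tr n k = track C μ n k

theorem iterate_return (p : P) (b : Bool) (h : ℕ) (tr : ℕ → ℕ → Bool)
    (htr : ∀ n, tr n 0 = decide (n = 0)) :
    ((F.macroOf dec).step W x)^[h + 1] ⟨.inr (p, some b), h, tr⟩ =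
      ⟨.inr ((F.next p b).getD F.entry, none), 0, tr⟩ := by
  have hsame (h : ℕ) : (fun n k => if n = h ∧ k < W then tr h k else tr n k) = tr := by
    funext n k
    split_ifs with hh
    · rw [hh.1]
    · rfl
  induction h with
  | zero =>
    simp [Macro.step, Macro.actOn, macroOf, act, htr, Macro.apply, hsame]
  | succ h ih =>
    rw [Function.iterate_succ_apply]
    rw [← ih]
    congr 1
    simp [Macro.step, Macro.actOn, macroOf, act, htr, Macro.apply, hsame]

theorem iterate_forward {p : P} {μ : Mem} {c : Cfg (Ctl ⊕ P × Option Bool)}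
    (hc : Ready W C p μ c) (hW : (F.instr p).1 + 7 < W) (h : ℕ) (hh : h ≤ μ.reg (F.instr p).1) :
    ((F.macroOf dec).step W x)^[h] c = ⟨.inr (p, none), h, fun n k =>
      if (F.instr p).2 = .clr ∧ k = (F.instr p).1 + 7 ∧ n < h then false else c.tr n k⟩ := by
  induction h with
  | zero =>
    obtain ⟨st, hd, tr⟩ := c
    obtain ⟨h1, h2, h3⟩ := hc
    simp_all
  | succ h ih =>
    rw [Function.iterate_succ_apply', ih (by omega)]
    have hw : c.tr h ((F.instr p).1 + 7) = true := by
      rw [hc.tr _ _ hW]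
      exact decide_eq_true (by omega)
    simp only [Macro.step, Macro.actOn, macroOf, act, lt_irrefl, and_false, if_false, hw,
      if_true, Macro.apply]
    congr 1
    funext n k
    rcases hk : (F.instr p).2 <;> simp only [Kind.letterPass, true_and, reduceCtorEq, false_and, if_false]
    all_goals by_cases hn : n = h <;> by_cases hkW : k < W <;> by_cases hki : k = (F.instr p).1 + 7
    all_goals try simp [hn, hkW, hki]
    all_goals grind

theorem Ready.iterate {p : P} {μ : Mem} {c : Cfg (Ctl ⊕ P × Option Bool)} {b : ℕ}
    (hc : Ready W C p μ c) (hb : (F.instr p).2.Bounded b (F.instr p).1) (hW : b + 7 ≤ W)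
    (hy : ∀ n, dec (Macro.window W x n) = (C.y n, C.inv n)) :
    ∃ t, Ready W C ((F.next p ((F.instr p).2.res C μ (F.instr p).1)).getD F.entry)
      ((F.instr p).2.eff μ (F.instr p).1) (((F.macroOf dec).step W x)^[t + 1] c) := by
  have hi : (F.instr p).1 < b := by
    cases hk : (F.instr p).2 <;> simp_all [Kind.Bounded]
  set i := (F.instr p).1 with hidef
  set κ := (F.instr p).2 with hκ
  have hforward := iterate_forward (dec := dec) (x := x) hc (by omega) (μ.reg i) le_rfl
  rw [← hidef, ← hκ] at hforward
  have hw : c.tr (μ.reg i) (i + 7) = false := by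
    rw [hc.tr _ _ (by omega)]
    exact decide_eq_false (by omega)
  have hres : κ.letterRes (dec (Macro.window W x (μ.reg i))) (c.tr (μ.reg i)) = κ.res C μ i := by
    rw [hy]
    cases hk : κ with
    | lt r =>
      rw [hk] at hb
      simp only [Kind.letterRes, Kind.res]
      rw [hc.tr _ _ (by have := hb.2; omega)]
      rfl
    | rdN => exact hc.tr _ 4 (by omega)
    | rdNold => exact hc.tr _ 5 (by omega)
    | _ => rfl
  have hstep : ((F.macroOf dec).step W x)^[μ.reg i + 1] c = ⟨.inr (p, some (κ.res C μ i)),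
      μ.reg i - 1, fun n k => if n = μ.reg i ∧ k < W then κ.letterEff (c.tr n) i k else
        if κ = .clr ∧ k = i + 7 ∧ n < μ.reg i then false else c.tr n k⟩ := by
    rw [Function.iterate_succ_apply', hforward]
    simp only [Macro.step, Macro.actOn, macroOf, act, lt_irrefl, and_false, if_false,
      Macro.apply, ← hidef, ← hκ, hw, Bool.false_eq_true, hres]
    congr 1
    funext n k
    by_cases hn : n = μ.reg i ∧ k < W
    · rw [if_pos hn, if_pos hn, hn.1]
    · rw [if_neg hn, if_neg hn]
  have hreturn := iterate_return (F := F) (dec := dec) (W := W) (x := x) p (κ.res C μ i)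
    (μ.reg i - 1) (fun n k => if n = μ.reg i ∧ k < W then κ.letterEff (c.tr n) i k else
        if κ = .clr ∧ k = i + 7 ∧ n < μ.reg i then false else c.tr n k) (by
      intro n
      have h0 := hc.tr n 0 (by omega)
      simp only [track] at h0
      rw [← h0]
      split_ifs with h1 h2
      · cases κ <;> simp [Kind.letterEff]
      · exact absurd h2.2.1 (by simp)
      · rfl)
  rw [← hstep, ← Function.iterate_add_apply] at hreturn
  refine ⟨μ.reg i - 1 + (μ.reg i + 1), ?_⟩
  rw [show μ.reg i - 1 + (μ.reg i + 1) + 1 = μ.reg i - 1 + 1 + (μ.reg i + 1) by omega, hreturn]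
  refine ⟨rfl, rfl, fun n k hk => ?_⟩
  have htr := hc.tr n k hk
  dsimp only
  simp only [hk, and_true]
  have h67 : ∀ m : ℕ, m < 7 → m < W := fun m hm => by omega
  cases hκ' : κ with
  | inc =>
    simp only [Kind.letterEff, Kind.eff, reduceCtorEq, false_and, if_false]
    rcases k with _ | _ | _ | _ | _ | _ | _ | k <;> simp only [track, Function.update_apply] at htr ⊢ <;> grind
  | clr =>
    simp only [Kind.letterEff, Kind.eff, true_and]
    rcases k with _ | _ | _ | _ | _ | _ | _ | k <;> simp only [track, Function.update_apply] at htr ⊢ <;> grind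
  | setB =>
    simp only [Kind.letterEff, Kind.eff, reduceCtorEq, false_and, if_false]
    rcases k with _ | _ | _ | _ | _ | _ | _ | k <;> simp only [track, Function.update_apply] at htr ⊢ <;> grind
  | setE =>
    simp only [Kind.letterEff, Kind.eff, reduceCtorEq, false_and, if_false]
    rcases k with _ | _ | _ | _ | _ | _ | _ | k <;> simp only [track, Function.update_apply] at htr ⊢ <;> grind
  | _ => simp [Kind.letterEff, Kind.eff, htr]

end Flow

theorem isSuccLimit_add_omega0 (α : Ordinal.{0}) : Order.IsSuccLimit (α + Ordinal.omega0) :=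
  Ordinal.isSuccLimit_add α Ordinal.isSuccLimit_omega0

theorem lt_add_omega0 {α β : Ordinal.{0}} (h : β < α + Ordinal.omega0) (h' : α ≤ β) :
    ∃ t : ℕ, β = α + t := by
  obtain ⟨δ, rfl⟩ := exists_add_of_le h'
  obtain ⟨t, rfl⟩ := Ordinal.lt_omega0.1 ((add_lt_add_iff_left α).1 h)
  exact ⟨t, rfl⟩

theorem limsupBelow_add_omega0 {f : Ordinal.{0} → Bool} {α : Ordinal.{0}} :
    limsupBelow f (α + Ordinal.omega0) = true ↔ ∀ m : ℕ, ∃ t : ℕ, m ≤ t ∧ f (α + t) = true := by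
  rw [limsupBelow_eq_true]
  constructor
  · intro h m
    obtain ⟨γ, h1, h2, h3⟩ := h (α + m) ((add_lt_add_iff_left α).2 (Ordinal.natCast_lt_omega0 m))
    obtain ⟨t, rfl⟩ := lt_add_omega0 h2 (le_trans le_self_add h1)
    exact ⟨t, by simpa using h1, h3⟩
  · intro h β hβ
    obtain hβα | hβα := le_total α β
    · obtain ⟨m, rfl⟩ := lt_add_omega0 hβ hβα
      obtain ⟨t, h1, h2⟩ := h m
      exact ⟨α + t, by simpa using h1, (add_lt_add_iff_left α).2 (Ordinal.natCast_lt_omega0 t), h2⟩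
    · obtain ⟨t, h1, h2⟩ := h 0
      exact ⟨α + t, hβα.trans le_self_add,
        (add_lt_add_iff_left α).2 (Ordinal.natCast_lt_omega0 t), h2⟩

theorem limsupBelow_add_omega0_of_eventually {f : Ordinal.{0} → Bool} {α : Ordinal.{0}} {b : Bool}
    (m : ℕ) (h : ∀ t : ℕ, m ≤ t → f (α + t) = b) : limsupBelow f (α + Ordinal.omega0) = b := by
  refine limsupBelow_of_eventually (β := α + m)
    ((add_lt_add_iff_left α).2 (Ordinal.natCast_lt_omega0 m)) fun γ h1 h2 => ?_
  obtain ⟨t, rfl⟩ := lt_add_omega0 h2 (le_trans le_self_add h1)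
  exact h t (by simpa using h1)

namespace Flow

variable {P : Type} {F : Flow P} {dec : (ℕ → Bool) → Bool × Bool} {W b : ℕ} {x : R} {C : Ctx}

theorem Ready.exec {c : Cmd} {μ ν : Mem} {γ : Cfg (Ctl ⊕ P × Option Bool)}
    (hγ : Ready W C F.entry μ γ) (hF : F.Simulates c) (hc : Exec C c μ ν)
    (hb : ∀ p, (F.instr p).2.Bounded b (F.instr p).1) (hW : b + 7 ≤ W)
    (hy : ∀ n, dec (Macro.window W x n) = (C.y n, C.inv n)) :
    ∃ t, Ready W C F.entry ν (((F.macroOf dec).step W x)^[t + 1] γ) := by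
  have key : ∀ s t, Relation.ReflTransGen (F.Step C) s t → ∀ γ,
      Ready W C (s.1.getD F.entry) s.2 γ →
      ∃ m, Ready W C (t.1.getD F.entry) t.2 (((F.macroOf dec).step W x)^[m] γ) := by
    intro s t hst γ hγ
    induction hst with
    | refl => exact ⟨0, hγ⟩
    | tail _ hst ih =>
      obtain ⟨m, hm⟩ := ih
      cases hst with
      | mk p μ =>
        obtain ⟨t, ht⟩ := Ready.iterate (F := F) (dec := dec) (x := x) hm (hb p) hW hy
        rw [← Function.iterate_add_apply] at ht
        exact ⟨_, ht⟩
  obtain h | ⟨s, h1, h2⟩ := (hF C μ ν hc).cases_head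
  · simp at h
  · generalize hs : (some F.entry, μ) = s0 at h1
    cases h1 with
    | mk p μ' =>
      cases hs
      obtain ⟨t, ht⟩ := Ready.iterate (F := F) (dec := dec) (x := x) hγ (hb _) hW hy
      obtain ⟨m, hm⟩ := key _ _ h2 _ ht
      rw [← Function.iterate_add_apply] at hm
      exact ⟨m + t, hm⟩

theorem step_run {γ : Cfg (Ctl ⊕ P × Option Bool)} {s : P × Option Bool} (hs : γ.state = .inr s) :
    (∃ v, (F.macroOf dec).actOn W x γ = .inr v) ∧
    (∃ s', ((F.macroOf dec).step W x γ).state = .inr s') ∧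
    (∀ n k, k = 1 ∨ k = 2 ∨ k = 4 → ((F.macroOf dec).step W x γ).tr n k = γ.tr n k) ∧
    (∀ n k, k = 3 ∨ k = 6 → γ.tr n k = true →
      ((F.macroOf dec).step W x γ).tr n k = true) := by
  obtain ⟨p, _ | r⟩ := s
  · by_cases hw : γ.tr γ.head ((F.instr p).1 + 7) = true
    · have hact : (F.macroOf dec).actOn W x γ = .inr (.inr (p, none),
          (F.instr p).2.letterPass (γ.tr γ.head) (F.instr p).1, true) := by
        simp [Macro.actOn, macroOf, act, hs, hw]
      refine ⟨⟨_, hact⟩, ?_⟩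
      simp only [Macro.step, hact, Macro.apply]
      refine ⟨⟨_, rfl⟩, fun n k hk => ?_, fun n k hk hn => ?_⟩
      · have : k ≠ (F.instr p).1 + 7 := by omega
        split_ifs with h
        · cases (F.instr p).2 <;> simp [Kind.letterPass, Function.update_of_ne this, h.1]
        · rfl
      · have : k ≠ (F.instr p).1 + 7 := by omega
        split_ifs with h
        · rw [← hn, h.1]
          cases (F.instr p).2 <;> simp [Kind.letterPass, Function.update_of_ne this]
        · exact hn
    · have hact : (F.macroOf dec).actOn W x γ = .inr (.inr (p,
            some ((F.instr p).2.letterRes (dec (Macro.window W x γ.head)) (γ.tr γ.head))),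
          (F.instr p).2.letterEff (γ.tr γ.head) (F.instr p).1, false) := by
        simp [Macro.actOn, macroOf, act, hs, hw]
      refine ⟨⟨_, hact⟩, ?_⟩
      simp only [Macro.step, hact, Macro.apply]
      refine ⟨⟨_, rfl⟩, fun n k hk => ?_, fun n k hk hn => ?_⟩
      · split_ifs with h
        · rw [h.1]
          cases (F.instr p).2 <;> simp only [Kind.letterEff] <;>
            exact Function.update_of_ne (by omega) _ _
        · rfl
      · split_ifs with h
        · rw [h.1] at hn
          cases (F.instr p).2 <;> simp only [Kind.letterEff, Function.update_apply, hn] <;>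
            simp
        · exact hn
  · have hact : (F.macroOf dec).actOn W x γ = .inr (if γ.tr γ.head 0 = true then
        .inr ((F.next p r).getD F.entry, none) else .inr (p, some r), γ.tr γ.head, false) := by
      simp [Macro.actOn, macroOf, act, hs]
    refine ⟨⟨_, hact⟩, ?_⟩
    simp only [Macro.step, hact, Macro.apply]
    refine ⟨?_, fun n k hk => ?_, fun n k hk hn => ?_⟩
    · split_ifs <;> exact ⟨_, rfl⟩
    · split_ifs with h
      · rw [h.1]
      · rfl
    · split_ifs with h
      · rw [← h.1, hn]
      · exact hn

theorem iterate_run {γ : Cfg (Ctl ⊕ P × Option Bool)} {s : P × Option Bool}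
    (hs : γ.state = .inr s) (t : ℕ) :
    (∃ s', (((F.macroOf dec).step W x)^[t] γ).state = .inr s') ∧
    (∀ n k, k = 1 ∨ k = 2 ∨ k = 4 → (((F.macroOf dec).step W x)^[t] γ).tr n k = γ.tr n k) ∧
    (∀ n k m, k = 3 ∨ k = 6 → m ≤ t → (((F.macroOf dec).step W x)^[m] γ).tr n k = true →
      (((F.macroOf dec).step W x)^[t] γ).tr n k = true) := by
  induction t with
  | zero => 
    refine ⟨⟨s, hs⟩, fun _ _ _ => rfl, fun n k m _ hm h => ?_⟩
    obtain rfl : m = 0 := by omega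
    exact h
  | succ t ih =>
    obtain ⟨⟨s', hs'⟩, h1, h2⟩ := ih
    obtain ⟨-, h3, h4, h5⟩ := step_run (F := F) (dec := dec) (W := W) (x := x) hs'
    rw [Function.iterate_succ_apply']
    refine ⟨h3, fun n k hk => (h4 n k hk).trans (h1 n k hk), fun n k m hk hm h => ?_⟩
    obtain rfl | hm := hm.eq_or_lt
    · rwa [Function.iterate_succ_apply'] at h
    · exact h5 n k hk (h2 n k m hk (by omega) h)

end Flow

namespace Flow

variable {P : Type} {F : Flow P} {dec : (ℕ → Bool) → Bool × Bool} {W : ℕ} {x : R}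
  {hit : (ℕ → Bool) → ℕ → ℕ → Bool}

/-- The read-only data during the execution of the flowchart on input `x`. -/
def ctx (dec : (ℕ → Bool) → Bool × Bool) (W : ℕ) (x : R) (N Nold : ℕ → Bool) : Ctx :=
  ⟨fun n => (dec (Macro.window W x n)).1, fun n => (dec (Macro.window W x n)).2, N, Nold⟩

/-- The `j`-th pass through the flowchart adds the elements of `hit N j` to `B` and records in
`E 0` whether `j` belongs to `Nold` but not to `N`. -/
structure Body (F : Flow P) (dec : (ℕ → Bool) → Bool × Bool) (W : ℕ) (x : R)
    (hit : (ℕ → Bool) → ℕ → ℕ → Bool) : Prop where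
  width : 7 ≤ W
  pass : ∀ N Nold B E j γ, Ready W (ctx dec W x N Nold) F.entry ⟨regs j 0 0 0 0 0 0 0, B, E⟩ γ →
    ∃ t, Ready W (ctx dec W x N Nold) F.entry ⟨regs (j + 1) 0 0 0 0 0 0 0,
      fun n => B n || hit N j n, fun n => E n || decide (n = 0 ∧ Nold j = true ∧ N j = false)⟩
      (((F.macroOf dec).step W x)^[t + 1] γ)

theorem Body.passes (h : Body F dec W x hit) {N Nold E : ℕ → Bool}
    {γ : Cfg (Ctl ⊕ P × Option Bool)}
    (hγ : Ready W (ctx dec W x N Nold) F.entry ⟨regs 0 0 0 0 0 0 0 0, fun _ => false, E⟩ γ)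
    (j : ℕ) : ∃ t, j ≤ t ∧ Ready W (ctx dec W x N Nold) F.entry ⟨regs j 0 0 0 0 0 0 0,
      fun n => decide (∃ i < j, hit N i n = true),
      fun n => E n || decide (n = 0 ∧ ∃ i < j, Nold i = true ∧ N i = false)⟩
      (((F.macroOf dec).step W x)^[t] γ) := by
  induction j with
  | zero => exact ⟨0, le_rfl, by simpa using hγ⟩
  | succ j ih =>
    obtain ⟨t, hjt, ht⟩ := ih
    obtain ⟨t', ht'⟩ := h.pass _ _ _ _ _ _ ht
    rw [← Function.iterate_add_apply] at ht'
    refine ⟨t' + 1 + t, by omega, ?_⟩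
    · convert ht' using 2
      · funext n
        simp only [Nat.lt_succ_iff_lt_or_eq, or_and_right, exists_or, exists_eq_left]
        simp
      · funext n
        by_cases hn : n = 0
        · simp only [hn, true_and, Nat.lt_succ_iff_lt_or_eq, or_and_right, exists_or,
            exists_eq_left, Bool.or_assoc, Bool.decide_or]
        · simp [hn]

/-- The configuration at a limit stage at which the flowchart is about to be started. -/
structure Primed (W : ℕ) (N Nold E : ℕ → Bool) (γ : Cfg (Ctl ⊕ P × Option Bool)) : Prop where
  state : γ.state = .inl .limit
  head : γ.head = 0
  tr : ∀ n k, k < W → γ.tr n k = if k = 1 then false else if k = 2 then decide (n = 0) else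
    track ⟨N, N, N, Nold⟩ ⟨fun _ => 0, fun _ => false, E⟩ n k

theorem Body.work (h : Body F dec W x hit) {N Nold E : ℕ → Bool} {α : Ordinal.{0}}
    (hα : Primed W N Nold E ((F.macroOf dec).run W x α)) :
    (∀ t : ℕ, (∃ v, (F.macroOf dec).actOn W x ((F.macroOf dec).run W x (α + t)) = .inr v) ∧
      ∀ n, ((F.macroOf dec).run W x (α + t)).tr n 4 = N n ∧
      (((F.macroOf dec).run W x (α + t)).tr n 6 = true → ∃ j, hit N j n = true)) ∧
    ∃ γ, (F.macroOf dec).run W x (α + Ordinal.omega0) = γ ∧ γ.state = .inl .limit ∧ γ.head = 0 ∧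
      γ.tr 0 1 = true ∧ γ.tr 0 2 = false ∧
      (γ.tr 0 3 = true ↔ E 0 = true ∨ ∃ j, Nold j = true ∧ N j = false) ∧
      (∀ n, γ.tr n 4 = N n) ∧ (∀ n, γ.tr n 6 = true ↔ ∃ j, hit N j n = true) := by
  have hW := h.width
  set Q := F.macroOf dec with hQ
  have hact : Q.actOn W x (Q.run W x α) = .inr (.inr (F.entry, none), Function.update
      (Function.update ((Q.run W x α).tr 0) 2 false) 1 true, false) := by
    have h1 := hα.tr 0 1 (by omega)
    have h2 := hα.tr 0 2 (by omega)
    have hl : Q.act = F.act dec := rfl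
    simp only [Macro.actOn, hα.state, hα.head, hl, act, h1, h2]
    simp
  have hready : Ready W (ctx dec W x N Nold) F.entry ⟨regs 0 0 0 0 0 0 0 0, fun _ => false, E⟩
      (Q.step W x (Q.run W x α)) := by
    simp only [Macro.step, hact, Macro.apply]
    refine ⟨rfl, by simp [hα.head], fun n k hk => ?_⟩
    simp only [hα.head, hk, and_true]
    have h0 := hα.tr n k hk
    have hregs (r : ℕ) : regs 0 0 0 0 0 0 0 0 r = 0 := by
      unfold regs
      grind
    by_cases hn : n = 0
    · subst hn
      rw [if_pos rfl]
      rcases k with _ | _ | _ | _ | _ | _ | _ | k <;>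
        simp_all [track, ctx]
    · rw [if_neg hn]
      rcases k with _ | _ | _ | _ | _ | _ | _ | k <;>
        simp_all [track, ctx]
  set γ₁ := Q.step W x (Q.run W x α) with hγ₁
  have hrun (t : ℕ) : Q.run W x (α + (t + 1 : ℕ)) = (Q.step W x)^[t] γ₁ := by
    rw [Macro.run_add_nat, Function.iterate_succ_apply]
  have hinv (t : ℕ) := iterate_run (F := F) (dec := dec) (W := W) (x := x) hready.state t
  have hpass := h.passes hready
  have hB (t n : ℕ) : ((Q.step W x)^[t] γ₁).tr n 6 = true → ∃ j, hit N j n = true := by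
    intro ht
    obtain ⟨t', htt', ht'⟩ := hpass t
    have h1 := (hinv t').2.2 n 6 t (by simp) htt' ht
    rw [ht'.tr _ _ (by omega)] at h1
    obtain ⟨i, -, hi⟩ := of_decide_eq_true h1
    exact ⟨i, hi⟩
  have hE (t : ℕ) : ((Q.step W x)^[t] γ₁).tr 0 3 = true →
      E 0 = true ∨ ∃ j, Nold j = true ∧ N j = false := by
    intro ht
    obtain ⟨t', htt', ht'⟩ := hpass t
    have h1 := (hinv t').2.2 0 3 t (by simp) htt' ht
    rw [ht'.tr _ _ (by omega)] at h1
    simp only [track, Bool.or_eq_true] at h1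
    obtain h1 | h1 := h1
    · exact .inl h1
    · obtain ⟨-, i, -, hi⟩ := of_decide_eq_true h1
      exact .inr ⟨i, hi⟩
  have hconst (k : ℕ) (hk : k = 1 ∨ k = 2 ∨ k = 4) (n t : ℕ) :
      (Q.run W x (α + (t + 1 : ℕ))).tr n k = track (ctx dec W x N Nold)
        ⟨regs 0 0 0 0 0 0 0 0, fun _ => false, E⟩ n k := by
    rw [hrun, (hinv t).2.1 n k hk, hready.tr _ _ (by omega)]
  have hlimconst (k : ℕ) (hk : k = 1 ∨ k = 2 ∨ k = 4) (n : ℕ) :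
      (Q.run W x (α + Ordinal.omega0)).tr n k = track (ctx dec W x N Nold)
        ⟨regs 0 0 0 0 0 0 0 0, fun _ => false, E⟩ n k := by
    rw [Macro.run_limit _ _ _ (isSuccLimit_add_omega0 α)]
    refine limsupBelow_add_omega0_of_eventually 1 fun t ht => ?_
    obtain ⟨t, rfl⟩ : ∃ s, t = s + 1 := ⟨t - 1, by omega⟩
    exact hconst k hk n t
  have hlimmono (k : ℕ) (hk : k = 3 ∨ k = 6) (n : ℕ) :
      (Q.run W x (α + Ordinal.omega0)).tr n k = true ↔
        ∃ t, ((Q.step W x)^[t] γ₁).tr n k = true := by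
    rw [Macro.run_limit _ _ _ (isSuccLimit_add_omega0 α)]
    simp only [limsupBelow_add_omega0]
    constructor
    · intro h'
      obtain ⟨t, ht, h''⟩ := h' 1
      obtain ⟨t, rfl⟩ : ∃ s, t = s + 1 := ⟨t - 1, by omega⟩
      rw [hrun] at h''
      exact ⟨t, h''⟩
    · rintro ⟨t, ht⟩ m
      refine ⟨max t m + 1, by omega, ?_⟩
      rw [hrun]
      exact (hinv _).2.2 n k t hk (by omega) ht
  refine ⟨fun t => ?_, _, rfl, ?_, ?_, ?_, ?_, ?_, ?_, ?_⟩
  · rcases t with _ | t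
    · simp only [Nat.cast_zero, add_zero]
      refine ⟨⟨_, hact⟩, fun n => ⟨?_, fun h6 => ?_⟩⟩
      · rw [hα.tr n 4 (by omega)]; rfl
      · rw [hα.tr n 6 (by omega)] at h6
        simp [track] at h6
    · refine ⟨?_, fun n => ⟨hconst 4 (by simp) n t, fun h6 => ?_⟩⟩
      · rw [hrun]
        obtain ⟨s, hs⟩ := (hinv t).1
        exact (step_run hs).1
      · rw [hrun] at h6
        exact hB t n h6
  · rw [Macro.run_limit _ _ _ (isSuccLimit_add_omega0 α)]; rfl
  · rw [Macro.run_limit _ _ _ (isSuccLimit_add_omega0 α)]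
  · exact hlimconst 1 (by simp) 0
  · exact hlimconst 2 (by simp) 0
  · rw [hlimmono 3 (by simp)]
    refine ⟨fun ⟨t, ht⟩ => hE t ht, fun hE' => ?_⟩
    obtain hE' | ⟨j, hj⟩ := hE'
    · refine ⟨0, ?_⟩
      rw [Function.iterate_zero_apply, hready.tr _ _ (by omega)]
      exact hE'
    · obtain ⟨t, -, ht⟩ := hpass (j + 1)
      refine ⟨t, ?_⟩
      rw [ht.tr _ _ (by omega)]
      simp only [track, Bool.or_eq_true]
      exact .inr (decide_eq_true ⟨trivial, j, by omega, hj⟩)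
  · exact hlimconst 4 (by simp)
  · intro n
    rw [hlimmono 6 (by simp)]
    refine ⟨fun ⟨t, ht⟩ => hB t n ht, fun ⟨j, hj⟩ => ?_⟩
    obtain ⟨t, -, ht⟩ := hpass (j + 1)
    refine ⟨t, ?_⟩
    rw [ht.tr _ _ (by omega)]
    exact decide_eq_true ⟨j, by omega, hj⟩

theorem sweep {α : Ordinal.{0}} {γ : Cfg (Ctl ⊕ P × Option Bool)}
    (hα : (F.macroOf dec).run W x α = γ)
    (hs : γ.state = .inl .limit) (hh : γ.head = 0) (h12 : ¬(γ.tr 0 2 = true ∧ γ.tr 0 1 = false))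
    (h3 : γ.tr 0 3 = true) :
    (∀ t : ℕ, (∃ v, (F.macroOf dec).actOn W x ((F.macroOf dec).run W x (α + t)) = .inr v) ∧
      ∀ n, (((F.macroOf dec).run W x (α + t)).tr n 4 = true → γ.tr n 4 = true ∨ γ.tr n 6 = true) ∧
      (((F.macroOf dec).run W x (α + t)).tr n 6 = true → γ.tr n 6 = true)) ∧
    Primed W (fun n => γ.tr n 6) (fun n => γ.tr n 4) (fun n => decide (n = 0) && γ.tr n 2)
      ((F.macroOf dec).run W x (α + Ordinal.omega0)) := by
  set Q := F.macroOf dec with hQ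
  have hact : Q.actOn W x γ = .inr (.inl .sweep, roundLetter (γ.tr 0), true) := by
    simp only [Macro.actOn, hs, hh, hQ, macroOf, act, h12, h3, if_false, Bool.true_eq_false]
  have hrun (t : ℕ) : Q.run W x (α + (t + 1 : ℕ)) = ⟨.inl .sweep, t + 1, fun n k =>
      if n < t + 1 ∧ k < W then (if n = 0 then roundLetter (γ.tr n) k else sweepLetter (γ.tr n) k)
      else γ.tr n k⟩ := by
    induction t with
    | zero =>
      rw [Nat.cast_succ, Nat.cast_zero, zero_add, Macro.run_add_one, hα]
      simp only [Macro.step, hact, Macro.apply, hh]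
      congr 1
      funext n k
      grind
    | succ t ih =>
      rw [Nat.cast_succ, ← add_assoc, Macro.run_add_one, ih]
      simp only [Macro.step, Macro.actOn, hQ, macroOf, act, lt_irrefl, false_and, if_false,
        Macro.apply, if_true]
      congr 1
      funext n k
      grind
  refine ⟨fun t => ?_, ?_, ?_, fun n k hk => ?_⟩
  · rcases t with _ | t
    · simp only [Nat.cast_zero, add_zero, hα]
      exact ⟨⟨_, hact⟩, fun n => ⟨.inl, id⟩⟩
    · rw [hrun]
      refine ⟨⟨_, rfl⟩, fun n => ⟨?_, ?_⟩⟩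
      · simp only
        split_ifs
        · exact .inr
        · exact .inr
        · exact .inl
      · simp only
        split_ifs
        · simp [roundLetter]
        · simp [sweepLetter]
        · exact id
  · rw [Macro.run_limit _ _ _ (isSuccLimit_add_omega0 α)]; rfl
  · rw [Macro.run_limit _ _ _ (isSuccLimit_add_omega0 α)]
  · rw [Macro.run_limit _ _ _ (isSuccLimit_add_omega0 α)]
    refine limsupBelow_add_omega0_of_eventually (n + 1) fun t ht => ?_
    obtain ⟨t, rfl⟩ : ∃ s, t = s + 1 := ⟨t - 1, by omega⟩
    rw [hrun]
    simp only
    rw [if_pos ⟨by omega, hk⟩]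
    by_cases hn : n = 0
    · subst hn
      rw [if_pos rfl]
      rcases k with _ | _ | _ | _ | _ | _ | _ | k <;> simp [track, roundLetter]
    · rw [if_neg hn]
      rcases k with _ | _ | _ | _ | _ | _ | _ | k <;> simp [track, sweepLetter, hn]

theorem fill :
    (∀ t : ℕ, ∃ v, (F.macroOf dec).actOn W x ((F.macroOf dec).run W x t) = .inr v) ∧
    Primed W (fun _ => true) (fun _ => false) (fun n => decide (n = 0))
      ((F.macroOf dec).run W x Ordinal.omega0) := by
  set Q := F.macroOf dec with hQ
  have hrun (t : ℕ) : Q.run W x (t + 1 : ℕ) = ⟨.inl .fill, t + 1, fun n k =>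
      if n < t + 1 ∧ k < W then decide (k = 4 ∨ n = 0 ∧ (k = 0 ∨ k = 2 ∨ k = 3))
      else false⟩ := by
    induction t with
    | zero =>
      rw [Nat.cast_succ, Nat.cast_zero, Macro.run_add_one, Macro.run_zero]
      simp only [Macro.step, Macro.actOn, hQ, macroOf, act, Macro.apply, if_true]
      congr 1
      funext n k
      rw [Bool.eq_iff_iff]
      split_ifs <;> simp only [decide_eq_true_eq] <;> grind
    | succ t ih =>
      rw [Nat.cast_succ, Macro.run_add_one, ih]
      simp only [Macro.step, Macro.actOn, hQ, macroOf, act, Macro.apply, if_true]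
      congr 1
      funext n k
      rw [Bool.eq_iff_iff]
      split_ifs <;> simp only [decide_eq_true_eq] <;> grind
  refine ⟨fun t => ?_, ?_, ?_, fun n k hk => ?_⟩
  · rcases t with _ | t
    · rw [Nat.cast_zero, Macro.run_zero]
      exact ⟨_, rfl⟩
    · rw [hrun]
      exact ⟨_, rfl⟩
  · rw [Macro.run_limit _ _ _ Ordinal.isSuccLimit_omega0]; rfl
  · rw [Macro.run_limit _ _ _ Ordinal.isSuccLimit_omega0]
  · rw [Macro.run_limit _ _ _ Ordinal.isSuccLimit_omega0]
    rw [← zero_add Ordinal.omega0]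
    refine limsupBelow_add_omega0_of_eventually (n + 1) fun t ht => ?_
    obtain ⟨t, rfl⟩ : ∃ s, t = s + 1 := ⟨t - 1, by omega⟩
    rw [zero_add, hrun]
    simp only
    rw [if_pos ⟨by omega, hk⟩]
    rcases k with _ | _ | _ | _ | _ | _ | _ | k <;> simp [track]

end Flow

/-- The decreasing iteration of an operator on sets of natural numbers. -/
noncomputable def deriv (G : Set ℕ → Set ℕ) : Ordinal.{0} → Set ℕ :=
  WellFounded.fix Ordinal.lt_wf fun ρ ih => {n | ∀ σ, ∀ h : σ < ρ, n ∈ G (ih σ h)}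

theorem mem_deriv {G : Set ℕ → Set ℕ} {ρ : Ordinal.{0}} {n : ℕ} :
    n ∈ deriv G ρ ↔ ∀ σ < ρ, n ∈ G (deriv G σ) := by
  rw [deriv, WellFounded.fix_eq]
  rfl

theorem deriv_antitone (G : Set ℕ → Set ℕ) : Antitone (deriv G) := fun _ _ h _ hn =>
  mem_deriv.2 fun σ hσ => mem_deriv.1 hn σ (hσ.trans_le h)

/-- The intersection of the earlier stages of the iteration. -/
def derivBelow (G : Set ℕ → Set ℕ) (ρ : Ordinal.{0}) : Set ℕ := {n | ∀ σ < ρ, n ∈ deriv G σ}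

theorem derivBelow_antitone (G : Set ℕ → Set ℕ) : Antitone (derivBelow G) := fun _ _ h _ hn σ hσ =>
  hn σ (hσ.trans_le h)

theorem deriv_subset_derivBelow (G : Set ℕ → Set ℕ) (ρ : Ordinal.{0}) :
    deriv G ρ ⊆ derivBelow G ρ := fun _ hn _ hσ => deriv_antitone G hσ.le hn

theorem derivBelow_add_one (G : Set ℕ → Set ℕ) (ρ : Ordinal.{0}) :
    derivBelow G (ρ + 1) = deriv G ρ := by
  ext n
  exact ⟨fun h => h ρ (lt_add_one ρ), fun h σ hσ => deriv_antitone G (Order.lt_add_one_iff.1 hσ) h⟩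

theorem deriv_add_one {G : Set ℕ → Set ℕ} (hG : Monotone G) (ρ : Ordinal.{0}) :
    deriv G (ρ + 1) = G (deriv G ρ) := by
  ext n
  rw [mem_deriv]
  exact ⟨fun h => h ρ (lt_add_one ρ),
    fun h σ hσ => hG (deriv_antitone G (Order.lt_add_one_iff.1 hσ)) h⟩

theorem deriv_limit {G : Set ℕ → Set ℕ} (hG : Monotone G) {ρ : Ordinal.{0}}
    (hρ : Order.IsSuccLimit ρ) : deriv G ρ = derivBelow G ρ := by
  refine (deriv_subset_derivBelow G ρ).antisymm fun n hn => mem_deriv.2 fun σ hσ => ?_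
  rw [← deriv_add_one hG]
  exact hn _ (hρ.add_one_lt hσ)

/-- The stage at which the iteration is seen to have stabilized. -/
def Stable (G : Set ℕ → Set ℕ) (ρ : Ordinal.{0}) : Prop :=
  ∃ κ, ρ = κ + 1 + 1 ∧ deriv G κ ⊆ deriv G (κ + 1)

theorem exists_stable (G : Set ℕ → Set ℕ) : ∃ ρ, Stable G ρ := by
  by_contra! h
  have hne (κ : Ordinal.{0}) : ¬deriv G κ ⊆ deriv G (κ + 1) := fun hκ => h _ ⟨κ, rfl, hκ⟩
  refine not_injective_of_ordinal (deriv G) fun σ τ hστ => ?_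
  by_contra hne'
  obtain hlt | hlt := lt_or_gt_of_ne hne'
  · exact hne σ (hστ.trans_subset (deriv_antitone G (Order.add_one_le_of_lt hlt)))
  · exact hne τ (hστ.symm.trans_subset (deriv_antitone G (Order.add_one_le_of_lt hlt)))

theorem mem_deriv_of_stable {G : Set ℕ → Set ℕ} (hG : Monotone G) {κ : Ordinal.{0}}
    (hκ : deriv G κ ⊆ deriv G (κ + 1)) {n : ℕ} :
    n ∈ deriv G (κ + 1) ↔ ∃ A : Set ℕ, A ⊆ G A ∧ n ∈ A := by
  constructor
  · intro hn
    refine ⟨deriv G κ, ?_, deriv_antitone G (lt_add_one κ).le hn⟩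
    rwa [← deriv_add_one hG]
  · rintro ⟨A, hA, hn⟩
    have : ∀ ρ, A ⊆ deriv G ρ := by
      intro ρ
      induction ρ using WellFoundedLT.induction with
      | ind ρ ih => exact fun m hm => mem_deriv.2 fun σ hσ => hG (ih σ hσ) (hA hm)
    exact this _ hn

/-- The stage at which a round of the block machine starts. -/
noncomputable def roundStart (ρ : Ordinal.{0}) : Ordinal.{0} :=
  (Ordinal.omega0 + Ordinal.omega0) * ρ

theorem roundStart_add_one (ρ : Ordinal.{0}) :
    roundStart (ρ + 1) = roundStart ρ + Ordinal.omega0 + Ordinal.omega0 := by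
  rw [roundStart, mul_add_one, ← add_assoc]
  rfl

theorem omega0_add_omega0_pos : (0 : Ordinal.{0}) < Ordinal.omega0 + Ordinal.omega0 :=
  Ordinal.omega0_pos.trans_le le_self_add

theorem roundStart_strictMono : StrictMono roundStart := fun _ _ h =>
  (mul_lt_mul_iff_right₀ omega0_add_omega0_pos).2 h

theorem isSuccLimit_roundStart {ρ : Ordinal.{0}} (hρ : Order.IsSuccLimit ρ) :
    Order.IsSuccLimit (roundStart ρ) :=
  Ordinal.isSuccLimit_mul_right omega0_add_omega0_pos hρ

theorem exists_lt_roundStart {ρ β : Ordinal.{0}} (hρ : Order.IsSuccLimit ρ)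
    (hβ : β < roundStart ρ) : ∃ σ < ρ, β < roundStart σ :=
  (Ordinal.lt_mul_iff_of_isSuccLimit hρ).1 hβ

theorem lt_roundStart_add_one {ρ β : Ordinal.{0}} (hβ : β < roundStart (ρ + 1)) :
    β < roundStart ρ ∨ (∃ t : ℕ, β = roundStart ρ + t) ∨
      ∃ t : ℕ, β = roundStart ρ + Ordinal.omega0 + t := by
  rw [roundStart_add_one] at hβ
  obtain h1 | h1 := lt_or_ge β (roundStart ρ)
  · exact .inl h1
  · obtain h2 | h2 := lt_or_ge β (roundStart ρ + Ordinal.omega0)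
    · exact .inr (.inl (lt_add_omega0 h2 h1))
    · exact .inr (.inr (lt_add_omega0 hβ h2))

namespace Flow

variable {P : Type} {F : Flow P} {dec : (ℕ → Bool) → Bool × Bool} {W : ℕ} {x : R}
  {hit : (ℕ → Bool) → ℕ → ℕ → Bool}

/-- The operator iterated by the block machine. -/
def image (hit : (ℕ → Bool) → ℕ → ℕ → Bool) (A : Set ℕ) : Set ℕ :=
  {n | ∃ j, hit (fun m => decide (m ∈ A)) j n = true}

/-- The configuration at the start of a round. -/
structure AtRound (hit : (ℕ → Bool) → ℕ → ℕ → Bool) (ρ : Ordinal.{0})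
    (γ : Cfg (Ctl ⊕ P × Option Bool)) : Prop where
  state : γ.state = .inl .limit
  head : γ.head = 0
  worked : γ.tr 0 1 = true
  limit : γ.tr 0 2 = true ↔ Order.IsSuccLimit ρ
  stable : γ.tr 0 3 = true ↔ ¬Stable (image hit) ρ
  below : ∀ n, γ.tr n 4 = true ↔ n ∈ derivBelow (image hit) ρ
  current : ∀ n, γ.tr n 6 = true ↔ n ∈ deriv (image hit) ρ

/-- What is known about the computation up to the start of a round. -/
structure Invariant (F : Flow P) (dec : (ℕ → Bool) → Bool × Bool) (W : ℕ) (x : R)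
    (hit : (ℕ → Bool) → ℕ → ℕ → Bool) (ρ : Ordinal.{0}) : Prop where
  now : AtRound hit ρ ((F.macroOf dec).run W x (roundStart ρ))
  act : ∀ β < roundStart ρ, ∃ v, (F.macroOf dec).actOn W x ((F.macroOf dec).run W x β) = .inr v
  bound : ∀ σ, 0 < σ → ∀ β, roundStart σ ≤ β → β < roundStart ρ → ∀ n,
    (((F.macroOf dec).run W x β).tr n 4 = true → n ∈ derivBelow (image hit) σ) ∧
    (((F.macroOf dec).run W x β).tr n 6 = true → n ∈ deriv (image hit) σ)
  mid : ∀ σ < ρ, 0 < σ →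
    ((F.macroOf dec).run W x (roundStart σ + Ordinal.omega0)).tr 0 2 = true

theorem Body.invariant_one (h : Body F dec W x hit) (hG : Monotone (image hit)) :
    Invariant F dec W x hit 1 := by
  have hfill := fill (F := F) (dec := dec) (W := W) (x := x)
  obtain ⟨hwork, γ, hγ, h1, h2, h3, h4, h5, h6, h7⟩ := h.work hfill.2
  have hst : roundStart 1 = Ordinal.omega0 + Ordinal.omega0 := by simp [roundStart]
  have hz : roundStart 0 = 0 := by simp [roundStart]
  have hnotlim : ¬Order.IsSuccLimit (1 : Ordinal.{0}) := by
    rw [← zero_add (1 : Ordinal.{0})]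
    exact Order.not_isSuccLimit_add_one 0
  refine ⟨?_, fun β hβ => ?_, fun σ hσ β h1 h2 => ?_, fun σ hσ h0 => ?_⟩
  · rw [hst, hγ]
    refine ⟨h1, h2, h3, ?_, ?_, fun n => ?_, fun n => ?_⟩
    · simp [h4, hnotlim]
    · simp only [h5, decide_true, true_or, true_iff]
      rintro ⟨κ, hκ, -⟩
      have : (0 : Ordinal.{0}) = κ + 1 := Order.add_one_inj.1 (by rwa [zero_add])
      exact (add_pos_of_right zero_lt_one κ).ne this
    · simp only [h6, true_iff]
      intro σ hσ
      obtain rfl := Order.lt_one_iff.1 hσ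
      exact mem_deriv.2 fun τ hτ => absurd hτ (not_lt_bot)
    · rw [h7, ← zero_add (1 : Ordinal.{0}), deriv_add_one hG]
      have : deriv (image hit) 0 = Set.univ :=
        Set.eq_univ_of_forall fun m => mem_deriv.2 fun τ hτ => absurd hτ (not_lt_bot)
      simp [this, image]
  · rw [← zero_add (1 : Ordinal.{0})] at hβ
    obtain h | ⟨t, rfl⟩ | ⟨t, rfl⟩ := lt_roundStart_add_one hβ
    · rw [hz] at h
      exact absurd h not_lt_bot
    · rw [hz, zero_add]
      exact hfill.1 t
    · rw [hz, zero_add]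
      exact (hwork t).1
  · have := roundStart_strictMono.lt_iff_lt.1 (h1.trans_lt h2)
    exact absurd (Order.lt_one_iff.1 this) hσ.ne'
  · exact absurd (Order.lt_one_iff.1 hσ) h0.ne'

theorem Body.invariant_add_one (h : Body F dec W x hit) (hG : Monotone (image hit))
    {ρ : Ordinal.{0}} (hρ0 : 0 < ρ) (hρ : Invariant F dec W x hit ρ)
    (hstab : ¬Stable (image hit) ρ) : Invariant F dec W x hit (ρ + 1) := by
  have hn := hρ.now
  obtain ⟨hs1, hs2⟩ := sweep (F := F) (dec := dec) (W := W) (x := x) rfl hn.state hn.head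
    (by simp [hn.worked]) (hn.stable.2 hstab)
  obtain ⟨hwork, γ, hγ, h1, h2, h3, h4, h5, h6, h7⟩ := h.work hs2
  have hcur : (fun n => ((F.macroOf dec).run W x (roundStart ρ)).tr n 6) =
      fun n => decide (n ∈ deriv (image hit) ρ) := by
    funext n
    rw [Bool.eq_iff_iff, hn.current, decide_eq_true_eq]
  have hbel : ∀ n, ((F.macroOf dec).run W x (roundStart ρ)).tr n 4 =
      decide (n ∈ derivBelow (image hit) ρ) := by
    intro n
    rw [Bool.eq_iff_iff, hn.below, decide_eq_true_eq]
  rw [hcur] at h7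
  have himg (n : ℕ) : (∃ j, hit (fun n => decide (n ∈ deriv (image hit) ρ)) j n = true) ↔
      n ∈ deriv (image hit) (ρ + 1) := by
    rw [deriv_add_one hG]
    rfl
  refine ⟨?_, fun β hβ => ?_, fun σ hσ β hσβ hβ n => ?_, fun σ hσ h0 => ?_⟩
  · rw [roundStart_add_one, hγ]
    refine ⟨h1, h2, h3, ?_, ?_, fun n => ?_, fun n => ?_⟩
    · simp [h4]
    · rw [h5]
      simp only [decide_true, Bool.true_and, hn.limit, hbel, congrFun hcur, decide_eq_true_eq,
        decide_eq_false_iff_not]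
      constructor
      · rintro (hl | ⟨j, hj, hj'⟩) ⟨κ, hκ, hsub⟩
        · obtain rfl := Order.add_one_inj.1 hκ
          exact Order.not_isSuccLimit_add_one κ hl
        · obtain rfl := Order.add_one_inj.1 hκ
          rw [derivBelow_add_one] at hj
          exact hj' (hsub hj)
      · intro hns
        by_contra! hcon
        obtain ⟨hl, hsub⟩ := hcon
        obtain rfl | ⟨κ, rfl⟩ | hl' := Ordinal.zero_or_succ_or_isSuccLimit ρ
        · exact hρ0.ne rfl
        · refine hns ⟨κ, by rw [Order.succ_eq_add_one], fun j hj => ?_⟩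
          rw [Order.succ_eq_add_one] at hsub
          exact hsub j (by rwa [derivBelow_add_one])
        · exact hl hl'
    · rw [h6, derivBelow_add_one, hn.current]
    · rw [h7, himg]
  · obtain h | ⟨t, rfl⟩ | ⟨t, rfl⟩ := lt_roundStart_add_one hβ
    · exact hρ.act β h
    · exact (hs1 t).1
    · exact (hwork t).1
  · have hσρ : σ ≤ ρ :=
      Order.lt_add_one_iff.1 (roundStart_strictMono.lt_iff_lt.1 (hσβ.trans_lt hβ))
    obtain h | ⟨t, rfl⟩ | ⟨t, rfl⟩ := lt_roundStart_add_one hβ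
    · exact hρ.bound σ hσ β hσβ h n
    · constructor
      · intro h'
        refine derivBelow_antitone _ hσρ ?_
        obtain h' | h' := ((hs1 t).2 n).1 h'
        · exact (hn.below n).1 h'
        · exact deriv_subset_derivBelow _ _ ((hn.current n).1 h')
      · intro h'
        exact deriv_antitone _ hσρ ((hn.current n).1 (((hs1 t).2 n).2 h'))
    · obtain ⟨ha, hb⟩ := (hwork t).2 n
      constructor
      · intro h'
        rw [ha] at h'
        exact derivBelow_antitone _ hσρ (deriv_subset_derivBelow _ _ ((hn.current n).1 h'))
      · intro h'
        have := hb h'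
        rw [hcur, himg] at this
        exact deriv_antitone _ (hσρ.trans (lt_add_one ρ).le) this
  · obtain rfl | hlt := (Order.lt_add_one_iff.1 hσ).eq_or_lt
    · rw [hs2.tr 0 2 (by have := h.width; omega)]
      simp
    · exact hρ.mid σ hlt h0

theorem invariant_limit (hG : Monotone (image hit))
    {ρ : Ordinal.{0}} (hρ : Order.IsSuccLimit ρ)
    (hinv : ∀ σ < ρ, 0 < σ → Invariant F dec W x hit σ)
    (hstab : ∀ σ < ρ, ¬Stable (image hit) σ) : Invariant F dec W x hit ρ := by
  have hmid : ∀ σ < ρ, 0 < σ →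
      ((F.macroOf dec).run W x (roundStart σ + Ordinal.omega0)).tr 0 2 = true := fun σ hσ h0 =>
    (hinv _ (hρ.add_one_lt hσ) (h0.trans (lt_add_one σ))).mid σ (lt_add_one σ) h0
  have hbound : ∀ σ, 0 < σ → ∀ β, roundStart σ ≤ β → β < roundStart ρ → ∀ n,
      (((F.macroOf dec).run W x β).tr n 4 = true → n ∈ derivBelow (image hit) σ) ∧
      (((F.macroOf dec).run W x β).tr n 6 = true → n ∈ deriv (image hit) σ) := by
    intro σ hσ β h1 h2
    obtain ⟨τ, hτ, hβτ⟩ := exists_lt_roundStart hρ h2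
    have := roundStart_strictMono.lt_iff_lt.1 (h1.trans_lt hβτ)
    exact (hinv τ hτ (hσ.trans this)).bound σ hσ β h1 hβτ
  have hpos {σ : Ordinal.{0}} : (0 : Ordinal.{0}) < σ + 1 := Order.lt_add_one_iff.2 bot_le
  have hcof {n k : ℕ} (h : ∀ σ < ρ, 0 < σ →
      ((F.macroOf dec).run W x (roundStart σ)).tr n k = true) :
      ((F.macroOf dec).run W x (roundStart ρ)).tr n k = true := by
    rw [Macro.run_limit _ _ _ (isSuccLimit_roundStart hρ)]
    refine limsupBelow_eq_true.2 fun β hβ => ?_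
    obtain ⟨σ, hσ, hβσ⟩ := exists_lt_roundStart hρ hβ
    exact ⟨roundStart (σ + 1), (hβσ.trans (roundStart_strictMono (lt_add_one σ))).le,
      roundStart_strictMono (hρ.add_one_lt hσ), h _ (hρ.add_one_lt hσ) hpos⟩
  have hev {n k : ℕ} (h : ((F.macroOf dec).run W x (roundStart ρ)).tr n k = true) (σ : Ordinal.{0})
      (hσ : σ < ρ) : ∃ β, roundStart σ ≤ β ∧ β < roundStart ρ ∧
        ((F.macroOf dec).run W x β).tr n k = true := by
    rw [Macro.run_limit _ _ _ (isSuccLimit_roundStart hρ)] at h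
    exact limsupBelow_eq_true.1 h _ (roundStart_strictMono hσ)
  have hnotstab : ¬Stable (image hit) ρ := by
    rintro ⟨κ, rfl, -⟩
    exact Order.not_isSuccLimit_add_one _ hρ
  refine ⟨⟨?_, ?_, ?_, ?_, ?_, fun n => ?_, fun n => ?_⟩, fun β hβ => ?_, hbound, hmid⟩
  · rw [Macro.run_limit _ _ _ (isSuccLimit_roundStart hρ)]; rfl
  · rw [Macro.run_limit _ _ _ (isSuccLimit_roundStart hρ)]
  · exact hcof fun σ hσ h0 => (hinv σ hσ h0).now.worked
  · simp only [hρ, iff_true]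
    rw [Macro.run_limit _ _ _ (isSuccLimit_roundStart hρ)]
    refine limsupBelow_eq_true.2 fun β hβ => ?_
    obtain ⟨σ, hσ, hβσ⟩ := exists_lt_roundStart hρ hβ
    refine ⟨roundStart (σ + 1) + Ordinal.omega0,
      (hβσ.trans (roundStart_strictMono (lt_add_one σ))).le.trans le_self_add, ?_,
      hmid _ (hρ.add_one_lt hσ) hpos⟩
    refine lt_of_le_of_lt ?_ (roundStart_strictMono (hρ.add_one_lt (hρ.add_one_lt hσ)))
    rw [roundStart_add_one (σ + 1)]
    exact le_self_add
  · simp only [hnotstab, not_false_eq_true, iff_true]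
    exact hcof fun σ hσ h0 => (hinv σ hσ h0).now.stable.2 (hstab σ hσ)
  · constructor
    · intro h σ hσ
      obtain ⟨β, h1, h2, h3⟩ := hev h (σ + 1) (hρ.add_one_lt hσ)
      exact (hbound _ hpos β h1 h2 n).1 h3 σ (lt_add_one σ)
    · intro hn
      exact hcof fun σ hσ h0 => ((hinv σ hσ h0).now.below n).2 (derivBelow_antitone _ hσ.le hn)
  · constructor
    · intro h
      rw [deriv_limit hG hρ]
      intro σ hσ
      obtain ⟨β, h1, h2, h3⟩ := hev h (σ + 1) (hρ.add_one_lt hσ)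
      exact deriv_antitone _ (lt_add_one σ).le ((hbound _ hpos β h1 h2 n).2 h3)
    · intro hn
      exact hcof fun σ hσ h0 => ((hinv σ hσ h0).now.current n).2 (deriv_antitone _ hσ.le hn)
  · obtain ⟨σ, hσ, hβσ⟩ := exists_lt_roundStart hρ hβ
    exact (hinv _ (hρ.add_one_lt hσ) hpos).act β
      (hβσ.trans (roundStart_strictMono (lt_add_one σ)))

/-- The block machine decides whether `0` belongs to the greatest fixed point. -/
theorem Body.exists_halt (h : Body F dec W x hit) (hG : Monotone (image hit)) :
    ∃ α, (∀ β < α, ∃ v, (F.macroOf dec).actOn W x ((F.macroOf dec).run W x β) = .inr v) ∧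
      ((F.macroOf dec).run W x α).head = 0 ∧
      (F.macroOf dec).actOn W x ((F.macroOf dec).run W x α) =
        .inl (decide (¬∃ A : Set ℕ, A ⊆ image hit A ∧ 0 ∈ A)) := by
  let ρ := Ordinal.lt_wf.min {ρ | Stable (image hit) ρ} (exists_stable _)
  have hρ : Stable (image hit) ρ := Ordinal.lt_wf.min_mem _ (exists_stable _)
  have hmin (σ : Ordinal.{0}) (hσ : σ < ρ) : ¬Stable (image hit) σ := fun hs =>
    Ordinal.lt_wf.not_lt_min {ρ | Stable (image hit) ρ} hs hσ
  have hinv : ∀ σ ≤ ρ, 0 < σ → Invariant F dec W x hit σ := by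
    intro σ
    induction σ using WellFoundedLT.induction with
    | ind σ ih =>
      intro hσ h0
      obtain rfl | ⟨τ, rfl⟩ | hl := Ordinal.zero_or_succ_or_isSuccLimit σ
      · exact absurd h0 (lt_irrefl _)
      · rw [Order.succ_eq_add_one] at *
        have hτ := lt_add_one τ
        obtain rfl | hτ0 := eq_or_ne τ 0
        · rw [zero_add]
          exact h.invariant_one hG
        · have hτ0 : 0 < τ := bot_lt_iff_ne_bot.2 hτ0
          exact h.invariant_add_one hG hτ0 (ih τ hτ (hτ.le.trans hσ) hτ0)
            (hmin τ (hτ.trans_le hσ))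
      · exact invariant_limit hG hl (fun τ hτ h0 => ih τ hτ (hτ.le.trans hσ) h0)
          fun τ hτ => hmin τ (hτ.trans_le hσ)
  have hfin := hinv ρ le_rfl (by
    obtain ⟨κ, hκ, -⟩ := hρ
    rw [hκ]
    exact Order.lt_add_one_iff.2 bot_le)
  refine ⟨_, hfin.act, hfin.now.head, ?_⟩
  have hn := hfin.now
  have h3 : ((F.macroOf dec).run W x (roundStart ρ)).tr 0 3 = false := by
    rw [← Bool.not_eq_true, hn.stable]
    exact not_not.2 hρ
  have h4 := hn.below 0
  obtain ⟨κ, hκ, hsub⟩ := hρ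
  rw [hκ, derivBelow_add_one, mem_deriv_of_stable hG hsub, ← hκ] at h4
  have hl : (F.macroOf dec).act = F.act dec := rfl
  simp only [Macro.actOn, hn.state, hn.head, hl, Flow.act, hn.worked, h3, if_true, and_false,
    if_false, reduceCtorEq]
  congr 1
  rw [decide_not, ← h4]
  simp

end Flow

namespace Kind

/-- A strict upper bound for the registers used by the operation on register `i`. -/
def bound (i : ℕ) : Kind → ℕ
  | .lt r => i + r + 1
  | _ => i + 1

theorem bounded_of_le {i b : ℕ} (k : Kind) (h : k.bound i ≤ b) : k.Bounded b i := by
  cases k <;> simp only [bound, Bounded] at h ⊢ <;> omega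

end Kind

/-- The graph described by an enumeration of edges, each carrying conditions on the real `y`. -/
def EdgeRel (edge : ℕ → ℕ × ℕ × List ℕ) (y : ℕ → Bool) (a b : ℕ) : Prop :=
  ∃ j, (edge j).1 = a ∧ (edge j).2.1 = b ∧ edgeOn edge y j

/-- The elements added to the image of `N` by the `j`-th pass. -/
noncomputable def edgeHit (edge : ℕ → ℕ × ℕ × List ℕ) (y inv N : ℕ → Bool) (j n : ℕ) : Bool :=
  decide (n = (edge j).2.1 ∧ edgeOn edge y j ∧ N (edge j).1 = true) ||
    decide (n = 0 ∧ inv j = true)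

theorem mem_image_edgeHit {edge : ℕ → ℕ × ℕ × List ℕ} {y inv : ℕ → Bool} {A : Set ℕ} {n : ℕ} :
    n ∈ Flow.image (edgeHit edge y inv) A ↔
      (∃ a ∈ A, EdgeRel edge y a n) ∨ n = 0 ∧ ∃ j, inv j = true := by
  simp only [Flow.image, edgeHit, Set.mem_ofPred_eq, Bool.or_eq_true, decide_eq_true_eq, exists_or,
    EdgeRel]
  refine or_congr ⟨?_, ?_⟩ (by simp)
  · rintro ⟨j, h1, h2, h3⟩
    exact ⟨_, h3, j, rfl, h1.symm, h2⟩
  · rintro ⟨a, ha, j, rfl, rfl, hj⟩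
    exact ⟨j, rfl, hj, ha⟩

theorem exists_postfixed_iff {edge : ℕ → ℕ × ℕ × List ℕ} {y inv : ℕ → Bool}
    (hroot : ∀ a, a ≠ 0 → EdgeRel edge y a 0) :
    (¬∃ A : Set ℕ, A ⊆ Flow.image (edgeHit edge y inv) A ∧ 0 ∈ A) ↔
      WellFounded (EdgeRel edge y) ∧ ∀ n, inv n = false := by
  constructor
  · intro h
    refine ⟨WellFounded.wellFounded_iff_has_min.2 fun A hA => ?_, fun n => ?_⟩
    · by_contra! hmin
      have hsub : ∀ n ∈ A, ∃ a ∈ A, EdgeRel edge y a n := fun n hn => by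
        obtain ⟨a, ha, h'⟩ := hmin n hn
        exact ⟨a, ha, h'⟩
      refine h ⟨insert 0 A, fun n hn => mem_image_edgeHit.2 (.inl ?_), Set.mem_insert _ _⟩
      obtain ⟨a, ha⟩ := hA
      obtain rfl | hn := hn
      · obtain rfl | ha0 := eq_or_ne a 0
        · obtain ⟨b, hb, hb'⟩ := hsub 0 ha
          exact ⟨b, Set.mem_insert_of_mem _ hb, hb'⟩
        · exact ⟨a, Set.mem_insert_of_mem _ ha, hroot a ha0⟩
      · obtain ⟨b, hb, hb'⟩ := hsub n hn
        exact ⟨b, Set.mem_insert_of_mem _ hb, hb'⟩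
    · by_contra hn
      refine h ⟨{0}, ?_, rfl⟩
      rintro _ rfl
      exact mem_image_edgeHit.2 (.inr ⟨rfl, n, by simpa using hn⟩)
  · rintro ⟨hwf, hinv⟩ ⟨A, hA, h0⟩
    obtain ⟨m, hm, hmin⟩ := WellFounded.wellFounded_iff_has_min.1 hwf A ⟨0, h0⟩
    obtain ⟨a, ha, h'⟩ | ⟨-, j, hj⟩ := mem_image_edgeHit.1 (hA hm)
    · exact hmin a ha h'
    · simp [hinv] at hj

theorem exists_decider {edge : ℕ → ℕ × ℕ × List ℕ} (hedge : Primrec edge)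
    (hroot : ∀ y a, a ≠ 0 → EdgeRel edge y a 0) :
    ∃ K, ∀ W, K ≤ W → ∀ dec : (ℕ → Bool) → Bool × Bool, ∃ M : Machine, ∀ x,
      M.outputs x (if WellFounded (EdgeRel edge fun n => (dec (Macro.window W x n)).1) ∧
        ∀ n, (dec (Macro.window W x n)).2 = false then oneR else zeroR) := by
  obtain ⟨c, hc⟩ := exists_body hedge
  obtain ⟨P, _, F, hF⟩ := Flow.exists_simulates c
  let b := Finset.univ.sup fun p => (F.instr p).2.bound (F.instr p).1
  refine ⟨b + 7, fun W hW dec => ?_⟩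
  obtain ⟨M, hM⟩ := (F.macroOf dec).exists_machine (W := W) (by omega)
  refine ⟨M, fun x => ?_⟩
  set y : ℕ → Bool := fun n => (dec (Macro.window W x n)).1 with hy
  set inv : ℕ → Bool := fun n => (dec (Macro.window W x n)).2 with hinv
  have hbody : Flow.Body F dec W x (edgeHit edge y inv) := by
    refine ⟨by omega, fun N Nold B E j γ hγ => ?_⟩
    have hexec := hc (Flow.ctx dec W x N Nold) B E j
    obtain ⟨t, ht⟩ := hγ.exec (b := b) (dec := dec) (x := x) hF hexec
      (fun p => Kind.bounded_of_le _
        (Finset.le_sup (f := fun p => (F.instr p).2.bound (F.instr p).1) (Finset.mem_univ p)))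
      hW (fun n => rfl)
    refine ⟨t, ?_⟩
    simp only [Bool.or_assoc] at ht
    exact ht
  have hmono : Monotone (Flow.image (edgeHit edge y inv)) := by
    intro A A' hA n hn
    rw [mem_image_edgeHit] at hn ⊢
    exact hn.imp_left fun ⟨a, ha, h⟩ => ⟨a, hA ha, h⟩
  obtain ⟨α, h1, h2, h3⟩ := hbody.exists_halt hmono
  have := hM x α _ h1 h2 h3
  simp only [exists_postfixed_iff (hroot y), decide_eq_true_eq] at this
  exact this

/-! ### A primitive recursive numbering of machines -/

/-- The machine with states `Fin (Q + 1)` whose transition table is read off from `f`. -/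
noncomputable def mkMachine (Q : ℕ) (f : ℕ → ℕ) : Machine where
  Q := Q
  start := Fin.ofNat (Q + 1) (f 0)
  limit := Fin.ofNat (Q + 1) (f 1)
  halt := Fin.ofNat (Q + 1) (f 2)
  trans := fun a =>
    let e := f (3 + 8 * a.1 + ((a.2 0).toNat + 2 * (a.2 1).toNat + 4 * (a.2 2).toNat))
    (Fin.ofNat (Q + 1) (e / 16), fun i => decide (e / 2 ^ (i : ℕ) % 2 = 1), decide (e / 8 % 2 = 1))

theorem exists_mkMachine (M : Machine) :
    ∃ f : ℕ → ℕ, ∀ g : ℕ → ℕ, (∀ j < 3 + 8 * (M.Q + 1), g j = f j) → mkMachine M.Q g = M := by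
  obtain ⟨Q, s, l, h, t⟩ := M
  let rd : ℕ → Fin 3 → Bool := fun r i => decide (r / 2 ^ (i : ℕ) % 2 = 1)
  let code : Fin (Q + 1) × (Fin 3 → Bool) × Bool → ℕ := fun a =>
    16 * a.1 + 8 * a.2.2.toNat + ((a.2.1 0).toNat + 2 * (a.2.1 1).toNat + 4 * (a.2.1 2).toNat)
  refine ⟨fun j => if j = 0 then s else if j = 1 then l else if j = 2 then h else
    code (t (Fin.ofNat (Q + 1) ((j - 3) / 8), rd ((j - 3) % 8))), fun g hg => ?_⟩
  have h0 : g 0 = s := by rw [hg 0 (by omega)]; simp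
  have h1 : g 1 = l := by rw [hg 1 (by omega)]; simp
  have h2 : g 2 = h := by rw [hg 2 (by omega)]; simp
  have key : ∀ b : Bool, ∀ n : ℕ, n = b.toNat → decide (n = 1) = b := by
    rintro (_ | _) n rfl <;> simp
  have ht : (mkMachine Q g).trans = t := by
    suffices H : ∀ (q : Fin (Q + 1)) (a : Fin 3 → Bool), (mkMachine Q g).trans (q, a) = t (q, a) from
      funext fun ⟨q, a⟩ => H q a
    intro q a
    set r := (a 0).toNat + 2 * (a 1).toNat + 4 * (a 2).toNat with hr
    have hr8 : r < 8 := by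
      have := Bool.toNat_le (a 0); have := Bool.toNat_le (a 1); have := Bool.toNat_le (a 2); omega
    have hrd : rd r = a := by
      funext i
      have := Bool.toNat_le (a 0)
      have := Bool.toNat_le (a 1)
      have := Bool.toNat_le (a 2)
      apply key
      fin_cases i <;> simp <;> omega
    have hq := q.2
    have hge : g (3 + 8 * q + r) = code (t (q, a)) := by
      rw [hg _ (by simp only; omega)]
      beta_reduce
      rw [if_neg (by omega), if_neg (by omega), if_neg (by omega)]
      have e1 : (3 + 8 * (q : ℕ) + r - 3) / 8 = q := by omega
      have e2 : (3 + 8 * (q : ℕ) + r - 3) % 8 = r := by omega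
      rw [e1, e2, hrd, Fin.ofNat_val_eq_self]
    simp only [mkMachine, ← hr, hge]
    rcases t (q, a) with ⟨q', w, d⟩
    simp only [code]
    have b0 := Bool.toNat_le (w 0)
    have b1 := Bool.toNat_le (w 1)
    have b2 := Bool.toNat_le (w 2)
    have b3 := Bool.toNat_le d
    refine Prod.ext ?_ (Prod.ext ?_ ?_)
    · have : (16 * (q' : ℕ) + 8 * d.toNat + ((w 0).toNat + 2 * (w 1).toNat + 4 * (w 2).toNat)) / 16
          = q' := by omega
      simp only [this, Fin.ofNat_val_eq_self]
    · funext i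
      apply key
      fin_cases i <;> simp <;> omega
    · change decide (_ = 1) = d
      apply key
      omega
  have : mkMachine Q g = ⟨Q, Fin.ofNat (Q + 1) (g 0), Fin.ofNat (Q + 1) (g 1),
      Fin.ofNat (Q + 1) (g 2), (mkMachine Q g).trans⟩ := rfl
  rw [this, ht, h0, h1, h2]
  simp

/-- The largest state of the machine numbered `p`. -/
def machQ (p : ℕ) : ℕ := p.unpair.1

/-- The table of the machine numbered `p`. -/
def machTab (p j : ℕ) : ℕ := (Denumerable.ofNat (List ℕ) p.unpair.2).getD j 0

/-- The machine numbered `p`. -/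
noncomputable def mach (p : ℕ) : Machine := mkMachine (machQ p) (machTab p)

theorem mach_surjective (M : Machine) : ∃ p, mach p = M := by
  obtain ⟨f, hf⟩ := exists_mkMachine M
  refine ⟨Nat.pair M.Q (Encodable.encode ((List.range (3 + 8 * (M.Q + 1))).map f)), ?_⟩
  have hQ : machQ (Nat.pair M.Q (Encodable.encode ((List.range (3 + 8 * (M.Q + 1))).map f)))
      = M.Q := by simp [machQ]
  rw [mach, hQ]
  apply hf
  intro j hj
  simp [machTab, hj]

theorem primrec_machQ : Primrec machQ := Primrec.fst.comp Primrec.unpair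

theorem primrec_machTab : Primrec₂ machTab :=
  (Primrec.list_getD 0).comp
    ((Primrec.ofNat (List ℕ)).comp (Primrec.snd.comp (Primrec.unpair.comp Primrec.fst))) Primrec.snd

/-! ### The bits of a snapshot -/

/-- The bit of kind `k` and index `m` of a snapshot: kinds `0,1,2` are tape cells, kind `3` is the
state and kind `4` is the head position, both in unary. -/
noncomputable def snapBit {Q : ℕ} (s : Snapshot Q) (k m : ℕ) : Bool :=
  if k = 3 then decide ((s.state : ℕ) = m) else if k = 4 then decide (s.head = m)
  else s.tape (Fin.ofNat 3 k) m

/-- The number of the machine that the bit numbered `i` belongs to. -/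
def bitP (i : ℕ) : ℕ := (i / 5).unpair.1

/-- The index of the bit numbered `i` within its kind. -/
def bitM (i : ℕ) : ℕ := (i / 5).unpair.2

/-- The number of the bit of kind `k` and index `m` of the machine numbered `p`. -/
def bitIdx (k p m : ℕ) : ℕ := 5 * Nat.pair p m + k

theorem bitIdx_mod {k p m : ℕ} (hk : k < 5) : bitIdx k p m % 5 = k := by
  unfold bitIdx; omega

theorem bitP_bitIdx {k p m : ℕ} (hk : k < 5) : bitP (bitIdx k p m) = p := by
  have : bitIdx k p m / 5 = Nat.pair p m := by unfold bitIdx; omega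
  simp [bitP, this]

theorem bitM_bitIdx {k p m : ℕ} (hk : k < 5) : bitM (bitIdx k p m) = m := by
  have : bitIdx k p m / 5 = Nat.pair p m := by unfold bitIdx; omega
  simp [bitM, this]

theorem bitIdx_eta (i : ℕ) : bitIdx (i % 5) (bitP i) (bitM i) = i := by
  simp only [bitIdx, bitP, bitM, Nat.pair_unpair]; omega

/-- Whether the bit numbered `i` is on at stage `α`, on input `0`. -/
noncomputable def trueBit (α : Ordinal.{0}) (i : ℕ) : Bool :=
  snapBit ((mach (bitP i)).snap zeroR α) (i % 5) (bitM i)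

theorem trueBit_bitIdx {α : Ordinal.{0}} {k p m : ℕ} (hk : k < 5) :
    trueBit α (bitIdx k p m) = snapBit ((mach p).snap zeroR α) k m := by
  rw [trueBit, bitP_bitIdx hk, bitM_bitIdx hk, bitIdx_mod hk]

/-- The initial value of a bit. -/
def iniBit (i : ℕ) : ℕ :=
  if i % 5 = 3 then if machTab (bitP i) 0 % (machQ (bitP i) + 1) = bitM i then 1 else 0
  else if i % 5 = 4 then if 0 = bitM i then 1 else 0 else 0

/-- The value of the non-tape bits at limit stages. -/
def limBit (i : ℕ) : ℕ :=
  if i % 5 = 3 then if machTab (bitP i) 1 % (machQ (bitP i) + 1) = bitM i then 1 else 0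
  else if 0 = bitM i then 1 else 0

/-- The value of the bit numbered `i` after a step in state `q` with head at `n` reading `r`,
if the previous value was `v`. -/
def nextBit (i q n r v : ℕ) : ℕ :=
  if i % 5 = 3 then
    if machTab (bitP i) (3 + 8 * q + r) / 16 % (machQ (bitP i) + 1) = bitM i then 1 else 0
  else if i % 5 = 4 then
    if (if machTab (bitP i) (3 + 8 * q + r) / 8 % 2 = 1 then n + 1 else n - 1) = bitM i
    then 1 else 0
  else if bitM i = n then
    if i % 5 = 0 then machTab (bitP i) (3 + 8 * q + r) % 2
    else if i % 5 = 1 then machTab (bitP i) (3 + 8 * q + r) / 2 % 2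
    else machTab (bitP i) (3 + 8 * q + r) / 4 % 2
  else v

theorem trueBit_zero (i : ℕ) : (trueBit 0 i).toNat = iniBit i := by
  have h5 : i % 5 < 5 := Nat.mod_lt _ (by norm_num)
  rw [trueBit, Machine.snap_zero, snapBit, iniBit]
  split_ifs <;> simp_all [Machine.init, mach, mkMachine, zeroR]

theorem trueBit_limit {α : Ordinal.{0}} (hα : Order.IsSuccLimit α) {i : ℕ} (hi : 3 ≤ i % 5) :
    (trueBit α i).toNat = limBit i := by
  have h5 : i % 5 < 5 := Nat.mod_lt _ (by norm_num)
  rw [trueBit, Machine.snap_limit _ _ hα, snapBit, limBit]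
  have h4 : i % 5 ≠ 3 → i % 5 = 4 := by omega
  split_ifs <;> simp_all [mach, mkMachine]

theorem trueBit_limit_tape {α : Ordinal.{0}} (hα : Order.IsSuccLimit α) {i : ℕ} (hi : i % 5 < 3) :
    trueBit α i = limsupBelow (fun γ => trueBit γ i) α := by
  simp only [trueBit, snapBit]
  rw [if_neg (by omega), if_neg (by omega), Machine.snap_limit _ _ hα]
  simp only [if_neg (show ¬ i % 5 = 3 by omega), if_neg (show ¬ i % 5 = 4 by omega)]

theorem trueBit_add_one (α : Ordinal.{0}) (i q n r0 r1 r2 : ℕ)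
    (hq : trueBit α (bitIdx 3 (bitP i) q) = true) (hn : trueBit α (bitIdx 4 (bitP i) n) = true)
    (h0 : (trueBit α (bitIdx 0 (bitP i) n)).toNat = r0)
    (h1 : (trueBit α (bitIdx 1 (bitP i) n)).toNat = r1)
    (h2 : (trueBit α (bitIdx 2 (bitP i) n)).toNat = r2) :
    (trueBit (α + 1) i).toNat =
      nextBit i q n (r0 + 2 * r1 + 4 * r2) (trueBit α i).toNat := by
  have h5 : i % 5 < 5 := Nat.mod_lt _ (by norm_num)
  rw [trueBit_bitIdx (by norm_num)] at hq hn h0 h1 h2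
  simp only [trueBit, Machine.snap_add_one]
  set s := (mach (bitP i)).snap zeroR α
  simp [snapBit] at hq hn h0 h1 h2
  subst hq hn h0 h1 h2
  rw [nextBit, snapBit, Machine.stepSnap]
  have hb : ∀ n : ℕ, (decide (n % 2 = 1)).toNat = n % 2 := by
    intro n; rcases Nat.mod_two_eq_zero_or_one n with h | h <;> simp [h]
  have hd : ∀ (P : Prop) [Decidable P], (decide P).toNat = if P then 1 else 0 := by
    intro P _; by_cases h : P <;> simp [h]
  by_cases c3 : i % 5 = 3
  · simp only [c3, if_true, hd]
    rfl
  · by_cases c4 : i % 5 = 4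
    · rw [if_neg c3, if_pos c4, if_neg c3, if_pos c4, hd]
      simp [mach, mkMachine]
      rfl
    · simp only [c3, c4, if_false, snapBit]
      by_cases cm : bitM i = s.head
      · simp only [cm, if_true, mach, mkMachine]
        have : i % 5 = 0 ∨ i % 5 = 1 ∨ i % 5 = 2 := by omega
        rcases this with h | h | h <;> simp [h, hb] <;> rfl
      · simp only [cm, if_false]

theorem exists_state (α : Ordinal.{0}) (p : ℕ) : ∃ q, trueBit α (bitIdx 3 p q) = true :=
  ⟨((mach p).snap zeroR α).state, by rw [trueBit_bitIdx (by norm_num)]; simp [snapBit]⟩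

theorem exists_head (α : Ordinal.{0}) (p : ℕ) : ∃ n, trueBit α (bitIdx 4 p n) = true :=
  ⟨((mach p).snap zeroR α).head, by rw [trueBit_bitIdx (by norm_num)]; simp [snapBit]⟩

/-- An enumeration of the tape bits. -/
def tapeBit (e : ℕ) : ℕ := 5 * (e / 3) + e % 3

theorem tapeBit_mod (e : ℕ) : tapeBit e % 5 < 3 := by unfold tapeBit; omega

theorem exists_tapeBit {i : ℕ} (hi : i % 5 < 3) : ∃ e, tapeBit e = i :=
  ⟨3 * (i / 5) + i % 5, by unfold tapeBit; omega⟩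

/-! ### Repeating stages -/

/-- The computations on input `0` repeat between the limit stages `ζ` and `Θ`. -/
def Repeats (ζ Θ : Ordinal.{0}) : Prop :=
  Order.IsSuccLimit ζ ∧ Order.IsSuccLimit Θ ∧ ζ < Θ ∧
    ∀ e, (trueBit ζ (tapeBit e) = true → trueBit Θ (tapeBit e) = true) ∧
      (trueBit ζ (tapeBit e) = false → ∀ u, ζ ≤ u → u ≤ Θ → trueBit u (tapeBit e) = false)

/-- Above every ordinal there is a limit below which every cofinally recurring property in a
countable list recurs cofinally. -/
theorem exists_limit_closed (P : ℕ → Ordinal.{0} → Prop)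
    (hP : ∀ e α, ∃ γ, α ≤ γ ∧ P e γ) (a : Ordinal.{0}) :
    ∃ l, a < l ∧ Order.IsSuccLimit l ∧ ∀ e, ∀ α < l, ∃ γ, α ≤ γ ∧ γ < l ∧ P e γ := by
  choose n hn using hP
  let g : Ordinal.{0} → Ordinal.{0} := fun α => max (α + 1) (⨆ e, n e α + 1)
  have hg1 : ∀ α, α < g α := fun α => (lt_add_one α).trans_le (le_max_left _ _)
  have hg2 : ∀ e α, n e α < g α := fun e α =>
    (lt_add_one _).trans_le ((Ordinal.le_iSup (fun e => n e α + 1) e).trans (le_max_right _ _))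
  have hit : ∀ k, g^[k] a < ⨆ k, g^[k] a := fun k => by
    refine lt_of_lt_of_le ?_ (Ordinal.le_iSup (fun k => g^[k] a) (k + 1))
    rw [Function.iterate_succ_apply']
    exact hg1 _
  refine ⟨⨆ k, g^[k] a, hit 0, ?_, fun e α hα => ?_⟩
  · rw [Order.isSuccLimit_iff]
    refine ⟨not_isMin_of_lt (hit 0), ?_⟩
    rw [Order.isSuccPrelimit_iff_succ_lt]
    intro b hb
    obtain ⟨k, hk⟩ := Ordinal.lt_iSup_iff.1 hb
    exact (Order.succ_le_of_lt hk).trans_lt (hit k)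
  · obtain ⟨k, hk⟩ := Ordinal.lt_iSup_iff.1 hα
    refine ⟨n e (g^[k] a), hk.le.trans (hn _ _).1, lt_trans ?_ (hit (k + 1)), (hn _ _).2⟩
    rw [Function.iterate_succ_apply']
    exact hg2 _ _

theorem exists_repeats : ∃ Θ ζ, Repeats ζ Θ := by
  let cof : ℕ → Prop := fun e => ∀ α, ∃ γ, α ≤ γ ∧ trueBit γ (tapeBit e) = true
  have hb : ∀ e, ∃ β, ¬ cof e → ∀ γ, β ≤ γ → trueBit γ (tapeBit e) = false := by
    intro e
    by_cases h : cof e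
    · exact ⟨0, fun h' => absurd h h'⟩
    · obtain ⟨β, hβ⟩ := not_forall.1 h
      refine ⟨β, fun _ γ hγ => ?_⟩
      by_contra hc
      exact hβ ⟨γ, hγ, by simpa using hc⟩
  choose β hβ using hb
  have hP : ∀ e α, ∃ γ, α ≤ γ ∧ (cof e → trueBit γ (tapeBit e) = true) := by
    intro e α
    by_cases h : cof e
    · obtain ⟨γ, h1, h2⟩ := h α
      exact ⟨γ, h1, fun _ => h2⟩
    · exact ⟨α, le_rfl, fun h' => absurd h' h⟩
  have key := exists_limit_closed _ hP
  have hval : ∀ l, (⨆ e, β e) < l → Order.IsSuccLimit l → (∀ e, ∀ α < l, ∃ γ, α ≤ γ ∧ γ < l ∧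
      (cof e → trueBit γ (tapeBit e) = true)) → ∀ e, cof e → trueBit l (tapeBit e) = true := by
    intro l _ hl h e he
    rw [trueBit_limit_tape hl (tapeBit_mod e), limsupBelow_eq_true]
    intro α hα
    obtain ⟨γ, h1, h2, h3⟩ := h e α hα
    exact ⟨γ, h1, h2, h3 he⟩
  obtain ⟨ζ, hζ1, hζ2, hζ3⟩ := key (⨆ e, β e)
  obtain ⟨Θ, hΘ1, hΘ2, hΘ3⟩ := key ζ
  refine ⟨Θ, ζ, hζ2, hΘ2, hΘ1, fun e => ?_⟩
  have hle : β e ≤ ζ := (Ordinal.le_iSup β e).trans hζ1.le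
  by_cases he : cof e
  · refine ⟨fun _ => hval Θ (hζ1.trans hΘ1) hΘ2 hΘ3 e he, fun h => ?_⟩
    rw [hval ζ hζ1 hζ2 hζ3 e he] at h
    cases h
  · refine ⟨fun h => ?_, fun _ u hu _ => hβ e he u (hle.trans hu)⟩
    rw [hβ e he ζ hle] at h
    cases h

theorem limsupBelow_add (f : Ordinal.{0} → Bool) (a : Ordinal.{0}) {α : Ordinal.{0}} (hα : 0 < α) :
    limsupBelow f (a + α) = limsupBelow (fun γ => f (a + γ)) α := by
  rw [Bool.eq_iff_iff, limsupBelow_eq_true, limsupBelow_eq_true]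
  constructor
  · intro h β hβ
    obtain ⟨γ, h1, h2, h3⟩ := h (a + β) (by simpa using hβ)
    obtain ⟨d, rfl⟩ := exists_add_of_le (le_self_add.trans h1)
    exact ⟨d, by simpa using h1, by simpa using h2, h3⟩
  · intro h β hβ
    rcases lt_or_ge β a with hlt | hge
    · obtain ⟨γ, -, h2, h3⟩ := h 0 hα
      exact ⟨a + γ, hlt.le.trans le_self_add, by simpa using h2, h3⟩
    · obtain ⟨d, rfl⟩ := exists_add_of_le hge
      obtain ⟨γ, h1, h2, h3⟩ := h d (by simpa using hβ)
      exact ⟨a + γ, by simpa using h1, by simpa using h2, h3⟩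

theorem Machine.snap_shift (M : Machine) (x : R) {a b : Ordinal.{0}} (h : M.snap x a = M.snap x b)
    (α : Ordinal.{0}) : M.snap x (a + α) = M.snap x (b + α) := by
  induction α using Ordinal.limitRecOn with
  | zero => simpa using h
  | add_one α ih => rw [← add_assoc, ← add_assoc, snap_add_one, snap_add_one, ih]
  | limit α hα ih =>
    rw [snap_limit _ _ (Ordinal.isSuccLimit_add a hα), snap_limit _ _ (Ordinal.isSuccLimit_add b hα)]
    congr 1
    funext i n
    rw [limsupBelow_add _ _ hα.bot_lt, limsupBelow_add _ _ hα.bot_lt]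
    simp only [limsupBelow]
    congr 1
    apply propext
    refine forall₂_congr fun β hβ => exists_congr fun γ => and_congr_right fun _ =>
      and_congr_right fun hγ => ?_
    rw [ih γ hγ]

theorem trueBit_tape (α : Ordinal.{0}) (p : ℕ) (i : Fin 3) (n : ℕ) :
    trueBit α (bitIdx i p n) = ((mach p).snap zeroR α).tape i n := by
  have := i.2
  rw [trueBit_bitIdx (by omega), snapBit, if_neg (by omega), if_neg (by omega)]
  simp

theorem Repeats.tape {ζ Θ : Ordinal.{0}} (h : Repeats ζ Θ) (p : ℕ) (i : Fin 3) (n : ℕ) :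
    (((mach p).snap zeroR ζ).tape i n = true → ((mach p).snap zeroR Θ).tape i n = true) ∧
      (((mach p).snap zeroR ζ).tape i n = false →
        ∀ u, ζ ≤ u → u ≤ Θ → ((mach p).snap zeroR u).tape i n = false) := by
  have := i.2
  obtain ⟨e, he⟩ := exists_tapeBit (i := bitIdx i p n) (by rw [bitIdx_mod] <;> omega)
  simpa only [he, trueBit_tape] using h.2.2.2 e

theorem Repeats.snap_eq {ζ Θ : Ordinal.{0}} (h : Repeats ζ Θ) (p : ℕ) :
    (mach p).snap zeroR Θ = (mach p).snap zeroR ζ := by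
  have key : ∀ i n, ((mach p).snap zeroR Θ).tape i n = ((mach p).snap zeroR ζ).tape i n := by
    intro i n
    obtain ⟨h1, h2⟩ := h.tape p i n
    cases hb : ((mach p).snap zeroR ζ).tape i n with
    | true => exact h1 hb
    | false => exact h2 hb Θ h.2.2.1.le le_rfl
  rw [Machine.snap_limit _ _ h.1, Machine.snap_limit _ _ h.2.1] at key ⊢
  congr 1
  funext i n
  exact key i n

theorem Repeats.snap_add_mul {ζ δ : Ordinal.{0}} (h : Repeats ζ (ζ + δ)) (p : ℕ) (q : Ordinal.{0}) :
    (mach p).snap zeroR (ζ + δ * q) = (mach p).snap zeroR ζ := by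
  have hδ : 0 < δ := by simpa using h.2.2.1
  induction q using Ordinal.limitRecOn with
  | zero => simp
  | add_one q ih =>
    rw [mul_add, mul_one, ← add_assoc, (mach p).snap_shift zeroR ih, h.snap_eq]
  | limit q hq ih =>
    have hl := Ordinal.isSuccLimit_mul_right hδ hq
    have hζ := Machine.snap_limit (mach p) zeroR h.1
    have key : ∀ i n, limsupBelow (fun γ => ((mach p).snap zeroR γ).tape i n) (ζ + δ * q) =
        ((mach p).snap zeroR ζ).tape i n := by
      intro i n
      cases hb : ((mach p).snap zeroR ζ).tape i n with
      | true =>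
        rw [limsupBelow_add _ _ hl.bot_lt, limsupBelow_eq_true]
        intro β hβ
        obtain ⟨c, hc, hβc⟩ := (Ordinal.lt_mul_iff_of_isSuccLimit hq).1 hβ
        refine ⟨δ * c, hβc.le, (mul_lt_mul_iff_right₀ hδ).2 hc, ?_⟩
        rw [ih c hc, hb]
      | false =>
        refine limsupBelow_of_eventually (β := ζ) ?_ fun γ h1 h2 => ?_
        · simpa using hl.bot_lt
        · obtain ⟨d, rfl⟩ := exists_add_of_le h1
          have hd : d < δ * q := by simpa using h2
          have hdiv : d / δ < q := (Ordinal.lt_mul_iff_div_lt hδ.ne').1 hd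
          have hmod : d % δ < δ := Ordinal.mod_lt _ hδ.ne'
          have := (mach p).snap_shift zeroR (ih _ hdiv) (d % δ)
          rw [add_assoc, Ordinal.div_add_mod] at this
          rw [this]
          exact (h.tape p i n).2 hb _ le_self_add (by simpa using hmod.le)
    rw [Machine.snap_limit _ _ (Ordinal.isSuccLimit_add ζ hl), hζ]
    rw [hζ] at key
    congr 1
    funext i n
    exact key i n

theorem Repeats.exists_snap_eq {ζ Θ : Ordinal.{0}} (h : Repeats ζ Θ) (p : ℕ) (α : Ordinal.{0}) :
    ∃ u < Θ, (mach p).snap zeroR α = (mach p).snap zeroR u := by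
  rcases lt_or_ge α ζ with hlt | hge
  · exact ⟨α, hlt.trans h.2.2.1, rfl⟩
  · obtain ⟨d, rfl⟩ := exists_add_of_le hge
    obtain ⟨δ, rfl⟩ := exists_add_of_le h.2.2.1.le
    have hδ : 0 < δ := by simpa using h.2.2.1
    refine ⟨ζ + d % δ, by simpa using Ordinal.mod_lt _ hδ.ne', ?_⟩
    have := (mach p).snap_shift zeroR (h.snap_add_mul p (d / δ)) (d % δ)
    rwa [add_assoc, Ordinal.div_add_mod] at this

/-- The first stage by which the computations on input `0` have repeated. -/
noncomputable def repEnd : Ordinal.{0} := sInf {Θ | ∃ ζ, Repeats ζ Θ}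

/-- The first stage that is repeated at stage `repEnd`. -/
noncomputable def repStart : Ordinal.{0} := sInf {ζ | Repeats ζ repEnd}

theorem repeats_repStart : Repeats repStart repEnd :=
  csInf_mem (s := {ζ | Repeats ζ repEnd}) (csInf_mem (s := {Θ | ∃ ζ, Repeats ζ Θ}) exists_repeats)

theorem repEnd_le {ζ Θ : Ordinal.{0}} (h : Repeats ζ Θ) : repEnd ≤ Θ :=
  csInf_le' (s := {Θ | ∃ ζ, Repeats ζ Θ}) ⟨ζ, h⟩

theorem repStart_le {ζ : Ordinal.{0}} (h : Repeats ζ repEnd) : repStart ≤ ζ :=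
  csInf_le' (s := {ζ | Repeats ζ repEnd}) h

/-! ### Terms for ordinals up to `repEnd` -/

/-- The least ordinal whose successor is at least `α`. -/
noncomputable def predO (α : Ordinal.{0}) : Ordinal.{0} := sInf {β | α ≤ β + 1}

/-- The least stage from `α` on at which the bit numbered `i` is on, or `Θ`. -/
noncomputable def nextO (Θ : Ordinal.{0}) (i : ℕ) (α : Ordinal.{0}) : Ordinal.{0} :=
  sInf {γ | α ≤ γ ∧ (trueBit γ i = true ∨ γ = Θ)}

/-- The least stage from which on the bit numbered `i` is off below `α`. -/
noncomputable def lastO (i : ℕ) (α : Ordinal.{0}) : Ordinal.{0} :=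
  sInf {β | ∀ γ, β ≤ γ → γ < α → trueBit γ i = false}

/-- The successor term. -/
def tSucc (s : ℕ) : ℕ := 4 * s + 3

/-- The predecessor term. -/
def tPred (s : ℕ) : ℕ := 4 * s + 4

/-- The term for `lastO`. -/
def tLast (i s : ℕ) : ℕ := 4 * Nat.pair i s + 5

/-- The term for `nextO`. -/
def tNext (i s : ℕ) : ℕ := 4 * Nat.pair i s + 6

/-- Every number is a term; `0`, `1` and `2` stand for `repEnd`, `0` and `repStart`. -/
theorem term_cases {P : ℕ → Prop} (h0 : P 0) (h1 : P 1) (h2 : P 2) (hsucc : ∀ s, P s → P (tSucc s))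
    (hpred : ∀ s, P s → P (tPred s)) (hlast : ∀ i s, P s → P (tLast i s))
    (hnext : ∀ i s, P s → P (tNext i s)) (n : ℕ) : P n := by
  induction n using Nat.strong_induction_on with
  | _ n ih =>
    rcases n with _ | _ | _ | n
    · exact h0
    · exact h1
    · exact h2
    · have hu := Nat.unpair_right_le (n / 4)
      have hp : Nat.pair (n / 4).unpair.1 (n / 4).unpair.2 = n / 4 := Nat.pair_unpair _
      have : n % 4 = 0 ∨ n % 4 = 1 ∨ n % 4 = 2 ∨ n % 4 = 3 := by omega
      rcases this with h | h | h | h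
      · rw [show n + 3 = tSucc (n / 4) by unfold tSucc; omega]
        exact hsucc _ (ih _ (by omega))
      · rw [show n + 3 = tPred (n / 4) by unfold tPred; omega]
        exact hpred _ (ih _ (by omega))
      · rw [show n + 3 = tLast (n / 4).unpair.1 (n / 4).unpair.2 by unfold tLast; omega]
        exact hlast _ _ (ih _ (by omega))
      · rw [show n + 3 = tNext (n / 4).unpair.1 (n / 4).unpair.2 by unfold tNext; omega]
        exact hnext _ _ (ih _ (by omega))

/-- The value of a term. -/
noncomputable def interp : ℕ → Ordinal.{0}
  | 0 => repEnd
  | 1 => 0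
  | 2 => repStart
  | n + 3 =>
    have : (n / 4).unpair.2 < n + 3 := by have := Nat.unpair_right_le (n / 4); omega
    if n % 4 = 0 then min (interp (n / 4) + 1) repEnd
    else if n % 4 = 1 then predO (interp (n / 4))
    else if n % 4 = 2 then lastO (n / 4).unpair.1 (interp (n / 4).unpair.2)
    else nextO repEnd (n / 4).unpair.1 (interp (n / 4).unpair.2)

theorem interp_tSucc (s : ℕ) : interp (tSucc s) = min (interp s + 1) repEnd := by
  have h1 : 4 * s % 4 = 0 := by omega
  have h2 : 4 * s / 4 = s := by omega
  rw [tSucc, interp, if_pos h1, h2]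

theorem interp_tPred (s : ℕ) : interp (tPred s) = predO (interp s) := by
  have h1 : (4 * s + 1) % 4 = 1 := by omega
  have h2 : (4 * s + 1) / 4 = s := by omega
  rw [tPred, show 4 * s + 4 = 4 * s + 1 + 3 from rfl, interp, h1, h2, if_neg (by norm_num), if_pos rfl]

theorem interp_tLast (i s : ℕ) : interp (tLast i s) = lastO i (interp s) := by
  have h1 : (4 * Nat.pair i s + 2) % 4 = 2 := by omega
  have h2 : (4 * Nat.pair i s + 2) / 4 = Nat.pair i s := by omega
  rw [tLast, show 4 * Nat.pair i s + 5 = 4 * Nat.pair i s + 2 + 3 from rfl, interp, h1, h2,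
    if_neg (by norm_num), if_neg (by norm_num), if_pos rfl, Nat.unpair_pair]

theorem interp_tNext (i s : ℕ) : interp (tNext i s) = nextO repEnd i (interp s) := by
  have h1 : (4 * Nat.pair i s + 3) % 4 = 3 := by omega
  have h2 : (4 * Nat.pair i s + 3) / 4 = Nat.pair i s := by omega
  rw [tNext, show 4 * Nat.pair i s + 6 = 4 * Nat.pair i s + 3 + 3 from rfl, interp, h1, h2,
    if_neg (by norm_num), if_neg (by norm_num), if_neg (by norm_num), Nat.unpair_pair]

theorem predO_le (α : Ordinal.{0}) : predO α ≤ α :=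
  csInf_le' (s := {β | α ≤ β + 1}) (le_self_add (a := α))

theorem le_predO (α : Ordinal.{0}) : α ≤ predO α + 1 :=
  csInf_mem (s := {β | α ≤ β + 1}) ⟨α, le_self_add (a := α)⟩

theorem predO_le_iff {α β : Ordinal.{0}} : predO α ≤ β ↔ α ≤ β + 1 :=
  ⟨fun h => (le_predO α).trans (by gcongr), fun h => csInf_le' (s := {β | α ≤ β + 1}) h⟩

theorem lastO_spec (i : ℕ) (α : Ordinal.{0}) :
    ∀ γ, lastO i α ≤ γ → γ < α → trueBit γ i = false :=
  csInf_mem (s := {β | ∀ γ, β ≤ γ → γ < α → trueBit γ i = false})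
    ⟨α, fun _ h1 h2 => absurd h2 h1.not_gt⟩

theorem lastO_le_iff {i : ℕ} {α β : Ordinal.{0}} :
    lastO i α ≤ β ↔ ∀ γ, β ≤ γ → γ < α → trueBit γ i = false :=
  ⟨fun h γ hγ => lastO_spec i α γ (h.trans hγ),
    fun h => csInf_le' (s := {β | ∀ γ, β ≤ γ → γ < α → trueBit γ i = false}) h⟩

theorem lastO_le (i : ℕ) (α : Ordinal.{0}) : lastO i α ≤ α :=
  lastO_le_iff.2 fun _ h1 h2 => absurd h2 h1.not_gt

theorem nextO_spec {Θ α : Ordinal.{0}} (i : ℕ) (h : α ≤ Θ) :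
    α ≤ nextO Θ i α ∧ (trueBit (nextO Θ i α) i = true ∨ nextO Θ i α = Θ) :=
  csInf_mem (s := {γ | α ≤ γ ∧ (trueBit γ i = true ∨ γ = Θ)}) ⟨Θ, h, Or.inr rfl⟩

theorem nextO_le {Θ α γ : Ordinal.{0}} {i : ℕ} (h : α ≤ γ) (h' : trueBit γ i = true ∨ γ = Θ) :
    nextO Θ i α ≤ γ :=
  csInf_le' (s := {γ | α ≤ γ ∧ (trueBit γ i = true ∨ γ = Θ)}) ⟨h, h'⟩

theorem interp_le (n : ℕ) : interp n ≤ repEnd := by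
  refine term_cases (P := fun n => interp n ≤ repEnd) ?_ ?_ ?_ ?_ ?_ ?_ ?_ n
  · rw [interp]
  · rw [interp]; exact zero_le
  · rw [interp]; exact repeats_repStart.2.2.1.le
  · intro s _; rw [interp_tSucc]; exact min_le_right _ _
  · intro s h; rw [interp_tPred]; exact (predO_le _).trans h
  · intro i s h; rw [interp_tLast]; exact (lastO_le _ _).trans h
  · intro i s h; rw [interp_tNext]; exact nextO_le h (Or.inr rfl)

theorem predO_lt_iff {α : Ordinal.{0}} : predO α < α ↔ ∃ β, α = β + 1 := by
  constructor
  · intro h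
    exact ⟨predO α, le_antisymm (le_predO α) (Order.add_one_le_of_lt h)⟩
  · rintro ⟨β, rfl⟩
    exact (predO_le_iff.2 le_rfl).trans_lt (lt_add_one β)

theorem isSuccLimit_iff_predO {α : Ordinal.{0}} : Order.IsSuccLimit α ↔ 0 < α ∧ ¬ predO α < α := by
  rw [predO_lt_iff]
  constructor
  · intro h
    refine ⟨h.bot_lt, ?_⟩
    rintro ⟨β, rfl⟩
    exact Order.not_isSuccLimit_add_one β h
  · rintro ⟨h1, h2⟩
    rcases Ordinal.zero_or_succ_or_isSuccLimit α with rfl | ⟨β, hβ⟩ | h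
    · exact absurd h1 (lt_irrefl _)
    · exact absurd ⟨β, by simpa using hβ.symm⟩ h2
    · exact h

/-! ### Closure properties of primitive recursive functions of one variable -/

section Prim

variable {σ : Type*} [Primcodable σ] {f g h : ℕ → ℕ} {a b : ℕ → σ}

theorem prim_ite_eq (hf : Primrec f) (hg : Primrec g) (ha : Primrec a) (hb : Primrec b) :
    Primrec fun m => if f m = g m then a m else b m :=
  Primrec.ite (Primrec.eq.comp hf hg) ha hb

theorem prim_add (hf : Primrec f) (hg : Primrec g) : Primrec fun m => f m + g m :=
  Primrec.nat_add.comp hf hg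

theorem prim_sub (hf : Primrec f) (hg : Primrec g) : Primrec fun m => f m - g m :=
  Primrec.nat_sub.comp hf hg

theorem prim_mul (hf : Primrec f) (hg : Primrec g) : Primrec fun m => f m * g m :=
  Primrec.nat_mul.comp hf hg

theorem prim_div (hf : Primrec f) (hg : Primrec g) : Primrec fun m => f m / g m :=
  Primrec.nat_div.comp hf hg

theorem prim_mod (hf : Primrec f) (hg : Primrec g) : Primrec fun m => f m % g m :=
  Primrec.nat_mod.comp hf hg

theorem prim_pair (hf : Primrec f) (hg : Primrec g) : Primrec fun m => Nat.pair (f m) (g m) :=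
  Primrec₂.natPair.comp hf hg

theorem prim_fst (hf : Primrec f) : Primrec fun m => (f m).unpair.1 :=
  Primrec.fst.comp (Primrec.unpair.comp hf)

theorem prim_snd (hf : Primrec f) : Primrec fun m => (f m).unpair.2 :=
  Primrec.snd.comp (Primrec.unpair.comp hf)

theorem prim_cons {l : ℕ → List σ} (ha : Primrec a) (hl : Primrec l) :
    Primrec fun m => a m :: l m :=
  Primrec.list_cons.comp ha hl

theorem prim_append {k l : ℕ → List σ} (hk : Primrec k) (hl : Primrec l) :
    Primrec fun m => k m ++ l m :=
  Primrec.list_append.comp hk hl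

theorem prim_mk {τ : Type*} [Primcodable τ] {c : ℕ → τ} (ha : Primrec a) (hc : Primrec c) :
    Primrec fun m => (a m, c m) :=
  Primrec.pair ha hc

theorem prim_machQ (hf : Primrec f) : Primrec fun m => machQ (f m) := primrec_machQ.comp hf

theorem prim_machTab (hf : Primrec f) (hg : Primrec g) : Primrec fun m => machTab (f m) (g m) :=
  primrec_machTab.comp hf hg

theorem prim_bitP (hf : Primrec f) : Primrec fun m => bitP (f m) :=
  prim_fst (prim_div hf (Primrec.const 5))

theorem prim_bitM (hf : Primrec f) : Primrec fun m => bitM (f m) :=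
  prim_snd (prim_div hf (Primrec.const 5))

theorem prim_bitIdx (hf : Primrec f) (hg : Primrec g) (hh : Primrec h) :
    Primrec fun m => bitIdx (f m) (g m) (h m) :=
  prim_add (prim_mul (Primrec.const 5) (prim_pair hg hh)) hf

theorem prim_tapeBit (hf : Primrec f) : Primrec fun m => tapeBit (f m) :=
  prim_add (prim_mul (Primrec.const 5) (prim_div hf (Primrec.const 3))) (prim_mod hf (Primrec.const 3))

theorem prim_tSucc (hf : Primrec f) : Primrec fun m => tSucc (f m) :=
  prim_add (prim_mul (Primrec.const 4) hf) (Primrec.const 3)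

theorem prim_tPred (hf : Primrec f) : Primrec fun m => tPred (f m) :=
  prim_add (prim_mul (Primrec.const 4) hf) (Primrec.const 4)

theorem prim_tLast (hf : Primrec f) (hg : Primrec g) : Primrec fun m => tLast (f m) (g m) :=
  prim_add (prim_mul (Primrec.const 4) (prim_pair hf hg)) (Primrec.const 5)

theorem prim_tNext (hf : Primrec f) (hg : Primrec g) : Primrec fun m => tNext (f m) (g m) :=
  prim_add (prim_mul (Primrec.const 4) (prim_pair hf hg)) (Primrec.const 6)

theorem prim_iniBit (hf : Primrec f) : Primrec fun m => iniBit (f m) := by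
  unfold iniBit
  repeat first
    | exact Primrec.const _ | exact hf | with_reducible refine prim_ite_eq ?_ ?_ ?_ ?_
    | with_reducible refine prim_machTab ?_ ?_
    | with_reducible refine prim_machQ ?_ | with_reducible refine prim_bitP ?_
    | with_reducible refine prim_bitM ?_ | with_reducible refine prim_mod ?_ ?_
    | with_reducible refine prim_add ?_ ?_

theorem prim_limBit (hf : Primrec f) : Primrec fun m => limBit (f m) := by
  unfold limBit
  repeat first
    | exact Primrec.const _ | exact hf | with_reducible refine prim_ite_eq ?_ ?_ ?_ ?_
    | with_reducible refine prim_machTab ?_ ?_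
    | with_reducible refine prim_machQ ?_ | with_reducible refine prim_bitP ?_
    | with_reducible refine prim_bitM ?_ | with_reducible refine prim_mod ?_ ?_
    | with_reducible refine prim_add ?_ ?_

theorem prim_nextBit {q n r v : ℕ → ℕ} (hf : Primrec f) (hq : Primrec q) (hn : Primrec n)
    (hr : Primrec r) (hv : Primrec v) :
    Primrec fun m => nextBit (f m) (q m) (n m) (r m) (v m) := by
  unfold nextBit
  repeat first
    | exact Primrec.const _ | exact hf | exact hq | exact hn | exact hr | exact hv
    | with_reducible refine prim_ite_eq ?_ ?_ ?_ ?_ | with_reducible refine prim_machTab ?_ ?_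
    | with_reducible refine prim_machQ ?_ | with_reducible refine prim_bitP ?_
    | with_reducible refine prim_bitM ?_ | with_reducible refine prim_mod ?_ ?_
    | with_reducible refine prim_div ?_ ?_ | with_reducible refine prim_add ?_ ?_
    | with_reducible refine prim_sub ?_ ?_ | with_reducible refine prim_mul ?_ ?_

end Prim

/-! ### Literals -/

/-- The literal saying that the value of the term `s` is less than that of `t`. -/
def lLt (s t : ℕ) : ℕ := 2 * (3 * Nat.pair s t) + 1

/-- The literal saying that the value of the term `s` is not less than that of `t`. -/
def lNLt (s t : ℕ) : ℕ := 2 * (3 * Nat.pair s t)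

/-- The literal saying that the bit numbered `i` has the parity of `v` at stage `s`. -/
def lB (s i v : ℕ) : ℕ := 2 * (3 * Nat.pair s i + 1) + v % 2

/-- The literal saying that the diagonal bit numbered `p`, `m` has the parity of `v`. -/
def lD (p m v : ℕ) : ℕ := 2 * (3 * Nat.pair p m + 2) + v % 2

/-- The comparison coded by `y`. -/
def yLt (y : R) (s t : ℕ) : Prop := y (3 * Nat.pair s t) = true

/-- The snapshot bits coded by `y`. -/
def yB (y : R) (s i : ℕ) : Bool := y (3 * Nat.pair s i + 1)

/-- The diagonal bits coded by `y`. -/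
def yD (y : R) (p m : ℕ) : Bool := y (3 * Nat.pair p m + 2)

/-- The Boolean value of a parity. -/
def par (v : ℕ) : Bool := decide (v % 2 = 1)

theorem par_toNat (b : Bool) : par b.toNat = b := by cases b <;> simp [par]

theorem par_zero : par 0 = false := rfl

theorem par_one : par 1 = true := rfl

theorem ne_par_add_one {b : Bool} {v : ℕ} : ¬ b = par (v + 1) ↔ b = par v := by
  have h : par (v + 1) = !par v := by
    unfold par
    rcases Nat.mod_two_eq_zero_or_one v with h | h <;> simp [Nat.add_mod, h]
  rw [h]
  cases b <;> cases par v <;> simp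

section Literals

variable {y : R} {s t i p m v : ℕ}

theorem litTrue_lLt : litTrue y (lLt s t) ↔ yLt y s t := by
  have h1 : lLt s t / 2 = 3 * Nat.pair s t := by unfold lLt; omega
  have h2 : lLt s t % 2 = 1 := by unfold lLt; omega
  simp [litTrue, yLt, h1, h2]

theorem litTrue_lNLt : litTrue y (lNLt s t) ↔ ¬ yLt y s t := by
  have h1 : lNLt s t / 2 = 3 * Nat.pair s t := by unfold lNLt; omega
  have h2 : lNLt s t % 2 = 0 := by unfold lNLt; omega
  simp [litTrue, yLt, h1, h2]

theorem litTrue_lB : litTrue y (lB s i v) ↔ yB y s i = par v := by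
  have h1 : lB s i v / 2 = 3 * Nat.pair s i + 1 := by unfold lB; omega
  have h2 : lB s i v % 2 = v % 2 := by unfold lB; omega
  simp only [litTrue, yB, par, h1, h2]

theorem litTrue_lD : litTrue y (lD p m v) ↔ yD y p m = par v := by
  have h1 : lD p m v / 2 = 3 * Nat.pair p m + 2 := by unfold lD; omega
  have h2 : lD p m v % 2 = v % 2 := by unfold lD; omega
  simp only [litTrue, yD, par, h1, h2]

end Literals

section PrimLiterals

variable {f g h : ℕ → ℕ}

theorem prim_lLt (hf : Primrec f) (hg : Primrec g) : Primrec fun m => lLt (f m) (g m) :=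
  prim_add (prim_mul (Primrec.const 2) (prim_mul (Primrec.const 3) (prim_pair hf hg)))
    (Primrec.const 1)

theorem prim_lNLt (hf : Primrec f) (hg : Primrec g) : Primrec fun m => lNLt (f m) (g m) :=
  prim_mul (Primrec.const 2) (prim_mul (Primrec.const 3) (prim_pair hf hg))

theorem prim_lB (hf : Primrec f) (hg : Primrec g) (hh : Primrec h) :
    Primrec fun m => lB (f m) (g m) (h m) :=
  prim_add (prim_mul (Primrec.const 2)
    (prim_add (prim_mul (Primrec.const 3) (prim_pair hf hg)) (Primrec.const 1)))
    (prim_mod hh (Primrec.const 2))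

theorem prim_lD (hf : Primrec f) (hg : Primrec g) (hh : Primrec h) :
    Primrec fun m => lD (f m) (g m) (h m) :=
  prim_add (prim_mul (Primrec.const 2)
    (prim_add (prim_mul (Primrec.const 3) (prim_pair hf hg)) (Primrec.const 2)))
    (prim_mod hh (Primrec.const 2))

end PrimLiterals

/-! ### Clauses -/

/-- The number of the halt state of the machine numbered `p`. -/
def machHalt (p : ℕ) : ℕ := machTab p 2 % (machQ p + 1)

/-- The term for the halting stage of the machine numbered `p`. -/
def tHalt (p : ℕ) : ℕ := tNext (bitIdx 3 p (machHalt p)) 1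

/-- The number of the output bit of the machine numbered `p` that the diagonal bit must avoid. -/
def diagBit (p m : ℕ) : ℕ := bitIdx 2 p (m * (3 * Nat.pair p m + 2))

/-- Conjunctions of literals that a code of the hierarchy of snapshots must falsify. -/
def clauseList (s t u i q n r0 r1 r2 v : ℕ) : List (List ℕ) :=
  [[lLt s u, lNLt s t, lNLt t u],
   [lLt 0 s],
   [lLt s 1],
   [lLt s 0, lNLt s (tSucc s)],
   [lLt s u, lLt u (tSucc s)],
   [lNLt s 0, lLt (tSucc s) 0],
   [lLt (tSucc (tPred t)) t],
   [lLt u (tPred t), lNLt (tSucc u) t],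
   [lLt (tNext i s) s],
   [lLt (tNext i s) 0, lB (tNext i s) i 0],
   [lNLt u s, lB u i 1, lLt u (tNext i s)],
   [lNLt u (tLast i t), lLt u t, lB u i 1],
   [lLt u (tLast i t), lNLt (tNext i u) t],
   [lNLt 1 t, lB t i (iniBit i + 1)],
   [lLt s t, lNLt (tSucc s) t, lB s (bitIdx 3 (bitP i) q) 1, lB s (bitIdx 4 (bitP i) n) 1,
     lB s (bitIdx 0 (bitP i) n) r0, lB s (bitIdx 1 (bitP i) n) r1, lB s (bitIdx 2 (bitP i) n) r2,
     lB s i v, lB t i (nextBit i q n (r0 % 2 + 2 * (r1 % 2) + 4 * (r2 % 2)) (v % 2) + 1)],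
   [lLt 1 t, lNLt (tPred t) t, lB t (5 * u + 3) (limBit (5 * u + 3) + 1)],
   [lLt 1 t, lNLt (tPred t) t, lB t (5 * u + 4) (limBit (5 * u + 4) + 1)],
   [lLt 1 t, lNLt (tPred t) t, lB t (tapeBit u) 1, lLt (tLast (tapeBit u) t) t],
   [lLt 1 t, lNLt (tPred t) t, lB t (tapeBit u) 0, lNLt (tLast (tapeBit u) t) t],
   [lNLt 1 2],
   [lLt (tPred 2) 2],
   [lNLt 2 0],
   [lLt (tPred 0) 0],
   [lB 2 (tapeBit i) 1, lB 0 (tapeBit i) 0],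
   [lB 2 (tapeBit i) 0, lNLt u 2, lB u (tapeBit i) 1],
   [lD q n 1, lB (tHalt q) (diagBit q n) 1],
   [lD q n 0, lB (tHalt q) (diagBit q n) 0]]

/-- The semantic content of the falsity of all clauses. -/
structure Good (y : R) : Prop where
  trans : ∀ s t u, ¬ (yLt y s u ∧ ¬ yLt y s t ∧ ¬ yLt y t u)
  top : ∀ s, ¬ yLt y 0 s
  zero : ∀ s, ¬ yLt y s 1
  succ_lt : ∀ s, ¬ (yLt y s 0 ∧ ¬ yLt y s (tSucc s))
  succ_le : ∀ s u, ¬ (yLt y s u ∧ yLt y u (tSucc s))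
  succ_top : ∀ s, ¬ (¬ yLt y s 0 ∧ yLt y (tSucc s) 0)
  le_pred : ∀ t, ¬ yLt y (tSucc (tPred t)) t
  pred_le : ∀ t u, ¬ (yLt y u (tPred t) ∧ ¬ yLt y (tSucc u) t)
  le_next : ∀ s i, ¬ yLt y (tNext i s) s
  next_on : ∀ s i, ¬ (yLt y (tNext i s) 0 ∧ yB y (tNext i s) i = false)
  next_le : ∀ s u i, ¬ (¬ yLt y u s ∧ yB y u i = true ∧ yLt y u (tNext i s))
  last_off : ∀ t u i, ¬ (¬ yLt y u (tLast i t) ∧ yLt y u t ∧ yB y u i = true)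
  last_le : ∀ t u i, ¬ (yLt y u (tLast i t) ∧ ¬ yLt y (tNext i u) t)
  ini : ∀ t i, ¬ (¬ yLt y 1 t ∧ yB y t i = par (iniBit i + 1))
  next : ∀ s t i q n r0 r1 r2 v, ¬ (yLt y s t ∧ ¬ yLt y (tSucc s) t ∧
    yB y s (bitIdx 3 (bitP i) q) = true ∧ yB y s (bitIdx 4 (bitP i) n) = true ∧
    yB y s (bitIdx 0 (bitP i) n) = par r0 ∧ yB y s (bitIdx 1 (bitP i) n) = par r1 ∧
    yB y s (bitIdx 2 (bitP i) n) = par r2 ∧ yB y s i = par v ∧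
    yB y t i = par (nextBit i q n (r0 % 2 + 2 * (r1 % 2) + 4 * (r2 % 2)) (v % 2) + 1))
  lim_state : ∀ t u, ¬ (yLt y 1 t ∧ ¬ yLt y (tPred t) t ∧
    yB y t (5 * u + 3) = par (limBit (5 * u + 3) + 1))
  lim_head : ∀ t u, ¬ (yLt y 1 t ∧ ¬ yLt y (tPred t) t ∧
    yB y t (5 * u + 4) = par (limBit (5 * u + 4) + 1))
  lim_on : ∀ t u, ¬ (yLt y 1 t ∧ ¬ yLt y (tPred t) t ∧ yB y t (tapeBit u) = true ∧
    yLt y (tLast (tapeBit u) t) t)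
  lim_off : ∀ t u, ¬ (yLt y 1 t ∧ ¬ yLt y (tPred t) t ∧ yB y t (tapeBit u) = false ∧
    ¬ yLt y (tLast (tapeBit u) t) t)
  start_pos : yLt y 1 2
  start_lim : ¬ yLt y (tPred 2) 2
  start_lt : yLt y 2 0
  end_lim : ¬ yLt y (tPred 0) 0
  rep_on : ∀ i, ¬ (yB y 2 (tapeBit i) = true ∧ yB y 0 (tapeBit i) = false)
  rep_off : ∀ u i, ¬ (yB y 2 (tapeBit i) = false ∧ ¬ yLt y u 2 ∧ yB y u (tapeBit i) = true)
  diag_on : ∀ q n, ¬ (yD y q n = true ∧ yB y (tHalt q) (diagBit q n) = true)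
  diag_off : ∀ q n, ¬ (yD y q n = false ∧ yB y (tHalt q) (diagBit q n) = false)

theorem good_iff {y : R} : Good y ↔ ∀ s t u i q n r0 r1 r2 v,
    ∀ cl ∈ clauseList s t u i q n r0 r1 r2 v, ¬ ∀ l ∈ cl, litTrue y l := by
  simp only [clauseList, List.forall_mem_cons, litTrue_lLt, litTrue_lNLt, litTrue_lB, litTrue_lD,
    par_zero, par_one, List.not_mem_nil, false_imp_iff, implies_true,
    and_true, not_not]
  constructor
  · intro G s t u i q n r0 r1 r2 v
    exact ⟨G.trans _ _ _, G.top _, G.zero _, G.succ_lt _, G.succ_le _ _, G.succ_top _, G.le_pred _,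
      G.pred_le _ _, G.le_next _ _, G.next_on _ _, G.next_le _ _ _, G.last_off _ _ _,
      G.last_le _ _ _, G.ini _ _, G.next _ _ _ _ _ _ _ _ _, G.lim_state _ _, G.lim_head _ _,
      G.lim_on _ _, G.lim_off _ _, G.start_pos, G.start_lim, G.start_lt, G.end_lim, G.rep_on _,
      G.rep_off _ _, G.diag_on _ _, G.diag_off _ _⟩
  · intro h
    simp only [forall_and] at h
    obtain ⟨h1, h2, h3, h4, h5, h6, h7, h8, h9, h10, h11, h12, h13, h14, h15, h16, h17, h18, h19,
      h20, h21, h22, h23, h24, h25, h26, h27⟩ := h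
    exact
      { trans := fun s t u => h1 s t u 0 0 0 0 0 0 0
        top := fun s => h2 s 0 0 0 0 0 0 0 0 0
        zero := fun s => h3 s 0 0 0 0 0 0 0 0 0
        succ_lt := fun s => h4 s 0 0 0 0 0 0 0 0 0
        succ_le := fun s u => h5 s 0 u 0 0 0 0 0 0 0
        succ_top := fun s => h6 s 0 0 0 0 0 0 0 0 0
        le_pred := fun t => h7 0 t 0 0 0 0 0 0 0 0
        pred_le := fun t u => h8 0 t u 0 0 0 0 0 0 0
        le_next := fun s i => h9 s 0 0 i 0 0 0 0 0 0
        next_on := fun s i => h10 s 0 0 i 0 0 0 0 0 0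
        next_le := fun s u i => h11 s 0 u i 0 0 0 0 0 0
        last_off := fun t u i => h12 0 t u i 0 0 0 0 0 0
        last_le := fun t u i => h13 0 t u i 0 0 0 0 0 0
        ini := fun t i => h14 0 t 0 i 0 0 0 0 0 0
        next := fun s t i q n r0 r1 r2 v => h15 s t 0 i q n r0 r1 r2 v
        lim_state := fun t u => h16 0 t u 0 0 0 0 0 0 0
        lim_head := fun t u => h17 0 t u 0 0 0 0 0 0 0
        lim_on := fun t u => h18 0 t u 0 0 0 0 0 0 0
        lim_off := fun t u => h19 0 t u 0 0 0 0 0 0 0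
        start_pos := h20 0 0 0 0 0 0 0 0 0 0
        start_lim := h21 0 0 0 0 0 0 0 0 0 0
        start_lt := h22 0 0 0 0 0 0 0 0 0 0
        end_lim := h23 0 0 0 0 0 0 0 0 0 0
        rep_on := fun i => h24 0 0 0 i 0 0 0 0 0 0
        rep_off := fun u i => h25 0 0 u i 0 0 0 0 0 0
        diag_on := fun q n => h26 0 0 0 0 q n 0 0 0 0
        diag_off := fun q n => h27 0 0 0 0 q n 0 0 0 0 }

/-! ### The graph -/

/-- The clause numbered `m`. -/
def clause (m : ℕ) : List ℕ :=
  let a : ℕ → ℕ := fun k => (Denumerable.ofNat (List ℕ) (m / 32)).getD k 0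
  (clauseList (a 0) (a 1) (a 2) (a 3) (a 4) (a 5) (a 6) (a 7) (a 8) (a 9)).getD (m % 32) [lLt 0 0]

theorem primrec_clause : Primrec clause := by
  have ha : ∀ k, Primrec fun m => (Denumerable.ofNat (List ℕ) (m / 32)).getD k 0 := fun k =>
    (Primrec.list_getD 0).comp
      ((Primrec.ofNat (List ℕ)).comp (prim_div Primrec.id (Primrec.const 32))) (Primrec.const k)
  refine (Primrec.list_getD [lLt 0 0]).comp ?_ (prim_mod Primrec.id (Primrec.const 32))
  unfold clauseList tHalt machHalt diagBit
  repeat first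
    | with_reducible exact Primrec.const _ | with_reducible exact ha _
    | with_reducible refine prim_cons ?_ ?_
    | with_reducible refine prim_lLt ?_ ?_ | with_reducible refine prim_lNLt ?_ ?_
    | with_reducible refine prim_lB ?_ ?_ ?_ | with_reducible refine prim_lD ?_ ?_ ?_
    | with_reducible refine prim_tNext ?_ ?_ | with_reducible refine prim_tLast ?_ ?_
    | with_reducible refine prim_tSucc ?_ | with_reducible refine prim_tPred ?_
    | with_reducible refine prim_tapeBit ?_ | with_reducible refine prim_bitIdx ?_ ?_ ?_
    | with_reducible refine prim_bitP ?_ | with_reducible refine prim_machTab ?_ ?_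
    | with_reducible refine prim_machQ ?_ | with_reducible refine prim_iniBit ?_
    | with_reducible refine prim_limBit ?_ | with_reducible refine prim_nextBit ?_ ?_ ?_ ?_ ?_
    | with_reducible refine prim_add ?_ ?_ | with_reducible refine prim_mul ?_ ?_
    | with_reducible refine prim_mod ?_ ?_ | with_reducible refine prim_pair ?_ ?_

theorem exists_clause {s t u i q n r0 r1 r2 v : ℕ} {cl : List ℕ}
    (h : cl ∈ clauseList s t u i q n r0 r1 r2 v) : ∃ m, clause m = cl := by
  obtain ⟨k, hk, rfl⟩ := List.getElem_of_mem h
  have hk32 : k < 32 := lt_of_lt_of_le hk (by simp [clauseList])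
  refine ⟨32 * Encodable.encode [s, t, u, i, q, n, r0, r1, r2, v] + k, ?_⟩
  have h1 : (32 * Encodable.encode [s, t, u, i, q, n, r0, r1, r2, v] + k) / 32 =
    Encodable.encode [s, t, u, i, q, n, r0, r1, r2, v] := by omega
  have h2 : (32 * Encodable.encode [s, t, u, i, q, n, r0, r1, r2, v] + k) % 32 = k := by omega
  rw [clause, h1, h2, Denumerable.ofNat_encode]
  exact List.getD_eq_getElem _ _ hk

theorem forall_clause_iff {y : R} : (∀ m, ¬ ∀ l ∈ clause m, litTrue y l) ↔ Good y := by
  rw [good_iff]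
  constructor
  · intro h s t u i q n r0 r1 r2 v cl hcl
    obtain ⟨m, rfl⟩ := exists_clause hcl
    exact h m
  · intro h m
    rw [clause]
    rcases lt_or_ge (m % 32) (clauseList ((Denumerable.ofNat (List ℕ) (m / 32)).getD 0 0)
      ((Denumerable.ofNat (List ℕ) (m / 32)).getD 1 0)
      ((Denumerable.ofNat (List ℕ) (m / 32)).getD 2 0)
      ((Denumerable.ofNat (List ℕ) (m / 32)).getD 3 0)
      ((Denumerable.ofNat (List ℕ) (m / 32)).getD 4 0)
      ((Denumerable.ofNat (List ℕ) (m / 32)).getD 5 0)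
      ((Denumerable.ofNat (List ℕ) (m / 32)).getD 6 0)
      ((Denumerable.ofNat (List ℕ) (m / 32)).getD 7 0)
      ((Denumerable.ofNat (List ℕ) (m / 32)).getD 8 0)
      ((Denumerable.ofNat (List ℕ) (m / 32)).getD 9 0)).length with hlt | hge
    · rw [List.getD_eq_getElem _ _ hlt]
      exact h _ _ _ _ _ _ _ _ _ _ _ (List.getElem_mem hlt)
    · rw [List.getD_eq_default _ _ hge]
      exact h 0 0 0 0 0 0 0 0 0 0 [lLt 0 0] (by simp [clauseList])

/-- The literals of the edges of the chain refuting the repetition `s`, `t`. -/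
def chainLits (s t b v : ℕ) : List ℕ :=
  [lLt s t, lLt 1 s, lNLt (tPred s) s, lLt 1 t, lNLt (tPred t) t] ++
    ((if v % 2 = 0 then [lLt t 0] else [lLt s 2]) ++
      (if v / 2 = 0 then [lB s b 1, lB t b 1] else [lB s b 0, lNLt (tNext b s) t, lB t b 0]))

/-- The graph: it has a root `0`, a looping node `1`, a node `2 * t + 2` for every term `t`, and a
descending chain of nodes for every pair of terms. -/
def graph (j : ℕ) : ℕ × ℕ × List ℕ :=
  if j % 4 = 0 then (j / 4 + 1, 0, [])
  else if j % 4 = 1 then (2 * (j / 4).unpair.1 + 2, 2 * (j / 4).unpair.2 + 2,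
    [lLt (j / 4).unpair.1 (j / 4).unpair.2])
  else if j % 4 = 2 then (1, 1, clause (j / 4))
  else (2 * Nat.pair (j / 4 / 4).unpair.1 ((j / 4 / 4).unpair.2 + 1) + 3, 2 * (j / 4 / 4) + 3,
    chainLits (j / 4 / 4).unpair.1.unpair.1 (j / 4 / 4).unpair.1.unpair.2
      (tapeBit (j / 4 / 4).unpair.2.unpair.1) (j / 4 % 4))

theorem primrec_graph : Primrec graph := by
  have hid : Primrec fun m : ℕ => m := Primrec.id
  have hc : Primrec fun j => clause (j / 4) :=
    primrec_clause.comp (prim_div Primrec.id (Primrec.const 4))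
  unfold graph chainLits
  repeat first
    | with_reducible exact Primrec.const _ | with_reducible exact hc | with_reducible exact hid
    | with_reducible refine prim_ite_eq ?_ ?_ ?_ ?_
    | with_reducible refine prim_mk ?_ ?_ | with_reducible refine prim_append ?_ ?_
    | with_reducible refine prim_cons ?_ ?_
    | with_reducible refine prim_lLt ?_ ?_ | with_reducible refine prim_lNLt ?_ ?_
    | with_reducible refine prim_lB ?_ ?_ ?_ | with_reducible refine prim_tNext ?_ ?_
    | with_reducible refine prim_tPred ?_ | with_reducible refine prim_tapeBit ?_
    | with_reducible refine prim_add ?_ ?_ | with_reducible refine prim_mul ?_ ?_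
    | with_reducible refine prim_div ?_ ?_ | with_reducible refine prim_mod ?_ ?_
    | with_reducible refine prim_pair ?_ ?_ | with_reducible refine prim_fst ?_
    | with_reducible refine prim_snd ?_

theorem graph_zero (m : ℕ) : graph (4 * m) = (m + 1, 0, []) := by
  rw [graph, if_pos (by omega), show 4 * m / 4 = m by omega]

theorem graph_one (m : ℕ) : graph (4 * m + 1) =
    (2 * m.unpair.1 + 2, 2 * m.unpair.2 + 2, [lLt m.unpair.1 m.unpair.2]) := by
  rw [graph, if_neg (by omega), if_pos (by omega), show (4 * m + 1) / 4 = m by omega]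

theorem graph_two (m : ℕ) : graph (4 * m + 2) = (1, 1, clause m) := by
  rw [graph, if_neg (by omega), if_neg (by omega), if_pos (by omega),
    show (4 * m + 2) / 4 = m by omega]

theorem graph_three (x v : ℕ) (hv : v < 4) : graph (4 * (4 * x + v) + 3) =
    (2 * Nat.pair x.unpair.1 (x.unpair.2 + 1) + 3, 2 * x + 3,
      chainLits x.unpair.1.unpair.1 x.unpair.1.unpair.2 (tapeBit x.unpair.2.unpair.1) v) := by
  rw [graph, if_neg (by omega), if_neg (by omega), if_neg (by omega),
    show (4 * (4 * x + v) + 3) / 4 = 4 * x + v by omega, show (4 * x + v) / 4 = x by omega,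
    show (4 * x + v) % 4 = v by omega]

theorem graph_cases (j : ℕ) : (∃ m, j = 4 * m) ∨ (∃ m, j = 4 * m + 1) ∨ (∃ m, j = 4 * m + 2) ∨
    ∃ x v, v < 4 ∧ j = 4 * (4 * x + v) + 3 := by
  have : j % 4 = 0 ∨ j % 4 = 1 ∨ j % 4 = 2 ∨ j % 4 = 3 := by omega
  rcases this with h | h | h | h
  · exact Or.inl ⟨j / 4, by omega⟩
  · exact Or.inr (Or.inl ⟨j / 4, by omega⟩)
  · exact Or.inr (Or.inr (Or.inl ⟨j / 4, by omega⟩))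
  · exact Or.inr (Or.inr (Or.inr ⟨j / 4 / 4, j / 4 % 4, by omega, by omega⟩))

/-- The condition for the chain of the terms `s`, `t` not to be interrupted at the bit `b`. -/
def ChainOn (y : R) (s t b : ℕ) : Prop :=
  (yLt y s t ∧ yLt y 1 s ∧ ¬ yLt y (tPred s) s ∧ yLt y 1 t ∧ ¬ yLt y (tPred t) t) ∧
    (yLt y t 0 ∨ yLt y s 2) ∧
    (yB y s b = true ∧ yB y t b = true ∨
      yB y s b = false ∧ ¬ yLt y (tNext b s) t ∧ yB y t b = false)

theorem exists_chainLits {y : R} {s t b : ℕ} :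
    (∃ v < 4, ∀ l ∈ chainLits s t b v, litTrue y l) ↔ ChainOn y s t b := by
  have key : ∀ v, (∀ l ∈ chainLits s t b v, litTrue y l) ↔
      (yLt y s t ∧ yLt y 1 s ∧ ¬ yLt y (tPred s) s ∧ yLt y 1 t ∧ ¬ yLt y (tPred t) t) ∧
      (if v % 2 = 0 then yLt y t 0 else yLt y s 2) ∧
      (if v / 2 = 0 then yB y s b = true ∧ yB y t b = true else
        yB y s b = false ∧ ¬ yLt y (tNext b s) t ∧ yB y t b = false) := by
    intro v
    rw [chainLits, List.forall_mem_append, List.forall_mem_append]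
    split_ifs <;>
    simp only [List.forall_mem_cons, litTrue_lLt, litTrue_lNLt, litTrue_lB,
      par_zero, par_one, List.not_mem_nil, false_imp_iff, implies_true, and_true]
  simp only [key]
  constructor
  · rintro ⟨v, -, h1, h2, h3⟩
    refine ⟨h1, ?_, ?_⟩
    · split_ifs at h2
      exacts [Or.inl h2, Or.inr h2]
    · split_ifs at h3
      exacts [Or.inl h3, Or.inr h3]
  · rintro ⟨h1, h2 | h2, h3 | h3⟩
    · exact ⟨0, by norm_num, h1, by simpa using h2, by simpa using h3⟩
    · exact ⟨2, by norm_num, h1, by simpa using h2, by simpa using h3⟩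
    · exact ⟨1, by norm_num, h1, by simpa using h2, by simpa using h3⟩
    · exact ⟨3, by norm_num, h1, by simpa using h2, by simpa using h3⟩

theorem edgeRel_graph_iff {y : R} {a b : ℕ} : EdgeRel graph y a b ↔
    (a ≠ 0 ∧ b = 0) ∨ (∃ s t, a = 2 * s + 2 ∧ b = 2 * t + 2 ∧ yLt y s t) ∨
    (a = 1 ∧ b = 1 ∧ ¬ Good y) ∨
    ∃ s t i, a = 2 * Nat.pair (Nat.pair s t) (i + 1) + 3 ∧ b = 2 * Nat.pair (Nat.pair s t) i + 3 ∧
      ChainOn y s t (tapeBit i.unpair.1) := by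
  constructor
  · rintro ⟨j, rfl, rfl, h⟩
    unfold edgeOn at h
    rcases graph_cases j with ⟨m, rfl⟩ | ⟨m, rfl⟩ | ⟨m, rfl⟩ | ⟨x, v, hv, rfl⟩
    · rw [graph_zero]; exact Or.inl ⟨by simp, rfl⟩
    · rw [graph_one] at h ⊢
      exact Or.inr (Or.inl ⟨m.unpair.1, m.unpair.2, rfl, rfl, litTrue_lLt.1 (h _ (by simp))⟩)
    · rw [graph_two] at h ⊢
      exact Or.inr (Or.inr (Or.inl ⟨rfl, rfl, fun G => forall_clause_iff.2 G m h⟩))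
    · rw [graph_three _ _ hv] at h ⊢
      refine Or.inr (Or.inr (Or.inr ⟨x.unpair.1.unpair.1, x.unpair.1.unpair.2, x.unpair.2, ?_, ?_,
        exists_chainLits.1 ⟨v, hv, h⟩⟩)) <;> simp
  · rintro (⟨h, rfl⟩ | ⟨s, t, rfl, rfl, h⟩ | ⟨rfl, rfl, h⟩ | ⟨s, t, i, rfl, rfl, h⟩)
    · refine ⟨4 * (a - 1), ?_⟩
      unfold edgeOn
      rw [graph_zero]
      exact ⟨by simp only; omega, rfl, by simp⟩
    · refine ⟨4 * Nat.pair s t + 1, ?_⟩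
      unfold edgeOn
      rw [graph_one]
      refine ⟨by simp, by simp, ?_⟩
      simpa [litTrue_lLt] using h
    · rw [← forall_clause_iff] at h
      push Not at h
      obtain ⟨m, hm⟩ := h
      refine ⟨4 * m + 2, ?_⟩
      unfold edgeOn
      rw [graph_two]
      exact ⟨rfl, rfl, hm⟩
    · obtain ⟨v, hv, h⟩ := exists_chainLits.2 h
      refine ⟨4 * (4 * Nat.pair (Nat.pair s t) i + v) + 3, ?_⟩
      unfold edgeOn
      rw [graph_three _ _ hv]
      simpa using h

theorem edgeRel_graph_zero (y : R) (a : ℕ) (ha : a ≠ 0) : EdgeRel graph y a 0 :=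
  edgeRel_graph_iff.2 (Or.inl ⟨ha, rfl⟩)

theorem wellFounded_graph_iff {y : R} : WellFounded (EdgeRel graph y) ↔
    WellFounded (yLt y) ∧ Good y ∧ ∀ s t, ¬ ∀ e, ChainOn y s t (tapeBit e) := by
  constructor
  · intro hwf
    refine ⟨?_, ?_, ?_⟩
    · refine (InvImage.wf (fun s => 2 * s + 2) hwf).mono fun s t h => ?_
      exact edgeRel_graph_iff.2 (Or.inr (Or.inl ⟨s, t, rfl, rfl, h⟩))
    · by_contra h
      have : EdgeRel graph y 1 1 := edgeRel_graph_iff.2 (Or.inr (Or.inr (Or.inl ⟨rfl, rfl, h⟩)))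
      exact hwf.asymmetric _ _ this this
    · intro s t h
      refine (wellFounded_iff_isEmpty_descending_chain.1 hwf).false
        ⟨fun i => 2 * Nat.pair (Nat.pair s t) i + 3, fun i => ?_⟩
      exact edgeRel_graph_iff.2 (Or.inr (Or.inr (Or.inr ⟨s, t, i, rfl, rfl, h _⟩)))
  · rintro ⟨hlt, G, hch⟩
    have hord : ∀ t, Acc (EdgeRel graph y) (2 * t + 2) := by
      intro t
      induction t using hlt.induction with
      | _ t ih =>
        refine ⟨_, fun a ha => ?_⟩
        rcases edgeRel_graph_iff.1 ha with ⟨-, h⟩ | ⟨s, t', rfl, h, hst⟩ | ⟨-, h, -⟩ |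
          ⟨s, t', i, -, h, -⟩
        · omega
        · obtain rfl : t = t' := by omega
          exact ih s hst
        · omega
        · omega
    have hchain : ∀ s t i, Acc (EdgeRel graph y) (2 * Nat.pair (Nat.pair s t) i + 3) := by
      intro s t i
      obtain ⟨e, he⟩ := not_forall.1 (hch s t)
      have hstep : ∀ i, (ChainOn y s t (tapeBit i.unpair.1) →
          Acc (EdgeRel graph y) (2 * Nat.pair (Nat.pair s t) (i + 1) + 3)) →
          Acc (EdgeRel graph y) (2 * Nat.pair (Nat.pair s t) i + 3) := by
        intro i hi
        refine ⟨_, fun a ha => ?_⟩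
        rcases edgeRel_graph_iff.1 ha with ⟨-, h⟩ | ⟨s, t', -, h, -⟩ | ⟨-, h, -⟩ |
          ⟨s', t', i', rfl, h, hc⟩
        · omega
        · omega
        · omega
        · have h' : Nat.pair (Nat.pair s t) i = Nat.pair (Nat.pair s' t') i' := by omega
          obtain ⟨h1, rfl⟩ := Nat.pair_eq_pair.1 h'
          obtain ⟨rfl, rfl⟩ := Nat.pair_eq_pair.1 h1
          exact hi hc
      have hbase : Acc (EdgeRel graph y) (2 * Nat.pair (Nat.pair s t) (Nat.pair e i) + 3) := by
        refine hstep _ fun h => absurd ?_ he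
        simpa using h
      have hle : i ≤ Nat.pair e i := Nat.right_le_pair e i
      generalize Nat.pair e i = k at hbase hle
      induction hle using Nat.decreasingInduction with
      | of_succ k _ ih => exact hstep _ fun _ => ih
      | self => exact hbase
    have hnz : ∀ a, a ≠ 0 → Acc (EdgeRel graph y) a := by
      intro a ha
      have : a = 1 ∨ (∃ t, a = 2 * t + 2) ∨ ∃ x, a = 2 * x + 3 := by
        have : a = 1 ∨ (a % 2 = 0) ∨ (a % 2 = 1 ∧ 3 ≤ a) := by omega
        rcases this with h | h | h
        · exact Or.inl h
        · exact Or.inr (Or.inl ⟨a / 2 - 1, by omega⟩)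
        · exact Or.inr (Or.inr ⟨a / 2 - 1, by omega⟩)
      rcases this with rfl | ⟨t, rfl⟩ | ⟨x, rfl⟩
      · refine ⟨_, fun a ha => ?_⟩
        rcases edgeRel_graph_iff.1 ha with ⟨-, h⟩ | ⟨s, t', -, h, -⟩ | ⟨-, -, h⟩ |
          ⟨s', t', i', rfl, h, hc⟩
        · omega
        · omega
        · exact absurd G h
        · omega
      · exact hord t
      · simpa using hchain x.unpair.1.unpair.1 x.unpair.1.unpair.2 x.unpair.2
    refine ⟨fun a => ?_⟩
    by_cases ha : a = 0
    · subst ha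
      refine ⟨_, fun b hb => hnz b ?_⟩
      rintro rfl
      rcases edgeRel_graph_iff.1 hb with ⟨h, -⟩ | ⟨s, t', h, -⟩ | ⟨h, -⟩ | ⟨s', t', i', h, -⟩
      · exact h rfl
      all_goals omega
    · exact hnz a ha

/-! ### The melody -/

/-- The code of the hierarchy of snapshots up to stage `repEnd`. -/
noncomputable def melody : R := fun n =>
  if n % 3 = 0 then decide (interp (n / 3).unpair.1 < interp (n / 3).unpair.2)
  else if n % 3 = 1 then trueBit (interp (n / 3).unpair.1) (n / 3).unpair.2
  else !trueBit (interp (tHalt (n / 3).unpair.1)) (diagBit (n / 3).unpair.1 (n / 3).unpair.2)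

theorem yLt_melody {s t : ℕ} : yLt melody s t ↔ interp s < interp t := by
  have h1 : 3 * Nat.pair s t % 3 = 0 := by omega
  have h2 : 3 * Nat.pair s t / 3 = Nat.pair s t := by omega
  simp [yLt, melody, h1, h2]

theorem yB_melody {s i : ℕ} : yB melody s i = trueBit (interp s) i := by
  have h1 : (3 * Nat.pair s i + 1) % 3 = 1 := by omega
  have h2 : (3 * Nat.pair s i + 1) / 3 = Nat.pair s i := by omega
  simp [yB, melody, h1, h2]

theorem yD_melody {p m : ℕ} :
    yD melody p m = !trueBit (interp (tHalt p)) (diagBit p m) := by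
  have h1 : (3 * Nat.pair p m + 2) % 3 = 2 := by omega
  have h2 : (3 * Nat.pair p m + 2) / 3 = Nat.pair p m := by omega
  simp [yD, melody, h1, h2]

/-- Two codes with the same components are equal. -/
theorem ext_components {y z : R} (h1 : ∀ s t, yLt y s t ↔ yLt z s t) (h2 : ∀ s i, yB y s i = yB z s i)
    (h3 : ∀ p m, yD y p m = yD z p m) : y = z := by
  funext n
  have hp : Nat.pair (n / 3).unpair.1 (n / 3).unpair.2 = n / 3 := Nat.pair_unpair _
  have : n % 3 = 0 ∨ n % 3 = 1 ∨ n % 3 = 2 := by omega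
  rcases this with h | h | h
  · have := h1 (n / 3).unpair.1 (n / 3).unpair.2
    rwa [yLt, yLt, hp, show 3 * (n / 3) = n by omega, ← Bool.eq_iff_iff] at this
  · have := h2 (n / 3).unpair.1 (n / 3).unpair.2
    rwa [yB, yB, hp, show 3 * (n / 3) + 1 = n by omega] at this
  · have := h3 (n / 3).unpair.1 (n / 3).unpair.2
    rwa [yD, yD, hp, show 3 * (n / 3) + 2 = n by omega] at this

theorem interp_zero : interp 0 = repEnd := by rw [interp]

theorem interp_one : interp 1 = 0 := by rw [interp]

theorem interp_two : interp 2 = repStart := by rw [interp]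

theorem tape_limit_iff {α : Ordinal.{0}} (hα : Order.IsSuccLimit α) {i : ℕ} (hi : i % 5 < 3) :
    trueBit α i = true ↔ ¬ lastO i α < α := by
  rw [trueBit_limit_tape hα hi, limsupBelow_eq_true]
  constructor
  · intro h hlt
    obtain ⟨γ, h1, h2, h3⟩ := h _ hlt
    rw [lastO_spec i α γ h1 h2] at h3
    cases h3
  · intro h β hβ
    by_contra hc
    refine h (lt_of_le_of_lt (lastO_le_iff.2 fun γ h1 h2 => ?_) hβ)
    by_contra h3
    exact hc ⟨γ, h1, h2, by simpa using h3⟩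

theorem isSuccLimit_interp {t : ℕ} (h1 : interp 1 < interp t) (h2 : ¬ interp (tPred t) < interp t) :
    Order.IsSuccLimit (interp t) := by
  rw [isSuccLimit_iff_predO]
  rw [interp_one] at h1
  rw [interp_tPred] at h2
  exact ⟨h1, h2⟩

theorem good_melody : Good melody := by
  have hR := repeats_repStart
  constructor <;> simp only [yLt_melody, yB_melody, yD_melody, ne_par_add_one, not_and]
  case trans =>
    intro s t u h1 h2 h3
    exact h3 ((not_lt.1 h2).trans_lt h1)
  case top =>
    intro s
    rw [interp_zero]
    exact (interp_le s).not_gt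
  case zero =>
    intro s
    rw [interp_one]
    exact not_lt_bot
  case succ_lt =>
    intro s h
    rw [interp_zero] at h
    rw [interp_tSucc, not_not]
    exact lt_min (lt_add_one _) h
  case succ_le =>
    intro s u h1 h2
    rw [interp_tSucc] at h2
    exact (Order.add_one_le_of_lt h1).not_gt (h2.trans_le (min_le_left _ _))
  case succ_top =>
    intro s h
    rw [interp_zero, not_lt] at h
    rw [interp_zero, interp_tSucc, not_lt]
    exact le_min (h.trans le_self_add) le_rfl
  case le_pred =>
    intro t
    rw [interp_tSucc, interp_tPred, not_lt]
    exact le_min (le_predO _) (interp_le t)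
  case pred_le =>
    intro t u h
    rw [interp_tPred] at h
    rw [interp_tSucc, not_not]
    refine (min_le_left _ _).trans_lt ?_
    by_contra hc
    exact (predO_le_iff.2 (not_lt.1 hc)).not_gt h
  case le_next =>
    intro s i
    rw [interp_tNext, not_lt]
    exact (nextO_spec i (interp_le s)).1
  case next_on =>
    intro s i h
    rw [interp_tNext, interp_zero] at h
    rw [interp_tNext]
    simpa using (nextO_spec i (interp_le s)).2.resolve_right h.ne
  case next_le =>
    intro s u i h1 h2
    rw [interp_tNext, not_lt]
    exact nextO_le (not_lt.1 h1) (Or.inl h2)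
  case last_off =>
    intro t u i h1 h2
    rw [interp_tLast, not_lt] at h1
    simpa using lastO_spec i _ _ h1 h2
  case last_le =>
    intro t u i h
    rw [interp_tLast] at h
    rw [interp_tNext, not_not]
    by_contra hc
    refine (lastO_le_iff.2 fun γ h1 h2 => ?_).not_gt h
    by_contra h3
    exact hc ((nextO_le h1 (Or.inl (by simpa using h3))).trans_lt h2)
  case ini =>
    intro t i h
    rw [interp_one, not_lt, nonpos_iff_eq_zero] at h
    rw [h, ← trueBit_zero, par_toNat]
  case next =>
    intro s t i q n r0 r1 r2 v h1 h2 hq hn h3 h4 h5 h6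
    have ht : interp t = interp s + 1 := by
      refine le_antisymm ?_ (Order.add_one_le_of_lt h1)
      rw [interp_tSucc, not_lt] at h2
      exact h2.trans (min_le_left _ _)
    have hpar : ∀ {b : Bool} {r : ℕ}, b = par r → b.toNat = r % 2 := by
      rintro b r rfl
      unfold par
      rcases Nat.mod_two_eq_zero_or_one r with h | h <;> simp [h]
    rw [ht, ← par_toNat (trueBit (interp s + 1) i),
      trueBit_add_one _ i q n _ _ _ hq hn (hpar h3) (hpar h4) (hpar h5), hpar h6]
  case lim_state =>
    intro t u h1 h2
    rw [← trueBit_limit (isSuccLimit_interp h1 h2) (by omega), par_toNat]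
  case lim_head =>
    intro t u h1 h2
    rw [← trueBit_limit (isSuccLimit_interp h1 h2) (by omega), par_toNat]
  case lim_on =>
    intro t u h1 h2 h3
    rw [interp_tLast]
    exact (tape_limit_iff (isSuccLimit_interp h1 h2) (tapeBit_mod u)).1 h3
  case lim_off =>
    intro t u h1 h2 h3
    rw [interp_tLast]
    intro h4
    rw [(tape_limit_iff (isSuccLimit_interp h1 h2) (tapeBit_mod u)).2 h4] at h3
    cases h3
  case start_pos =>
    rw [interp_one, interp_two]
    exact hR.1.bot_lt
  case start_lim =>
    rw [interp_tPred, interp_two]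
    exact (isSuccLimit_iff_predO.1 hR.1).2
  case start_lt =>
    rw [interp_zero, interp_two]
    exact hR.2.2.1
  case end_lim =>
    rw [interp_tPred, interp_zero]
    exact (isSuccLimit_iff_predO.1 hR.2.1).2
  case rep_on =>
    intro i h
    rw [interp_two] at h
    rw [interp_zero, (hR.2.2.2 i).1 h]
    simp
  case rep_off =>
    intro u i h1 h2
    rw [interp_two] at h1 h2
    rw [(hR.2.2.2 i).2 h1 _ (not_lt.1 h2) (interp_le u)]
    simp
  case diag_on => intro q n; simp
  case diag_off => intro q n; simp

theorem not_chainOn_melody (s t : ℕ) : ¬ ∀ e, ChainOn melody s t (tapeBit e) := by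
  intro h
  simp only [ChainOn, yLt_melody, yB_melody] at h
  obtain ⟨⟨h1, h2, h3, h4, h5⟩, h6, -⟩ := h 0
  have hrep : Repeats (interp s) (interp t) := by
    refine ⟨isSuccLimit_interp h2 h3, isSuccLimit_interp h4 h5, h1, fun e => ?_⟩
    rcases (h e).2.2 with ⟨h7, h8⟩ | ⟨h7, h8, h9⟩
    · exact ⟨fun _ => h8, fun h => absurd (h7.symm.trans h) (by simp)⟩
    · refine ⟨fun h => absurd (h7.symm.trans h) (by simp), fun _ u hu hu' => ?_⟩
      rcases hu'.lt_or_eq with hlt | rfl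
      · by_contra hc
        rw [interp_tNext] at h8
        exact h8 ((nextO_le hu (Or.inl (by simpa using hc))).trans_lt hlt)
      · exact h9
  have hend : interp t = repEnd := le_antisymm (interp_le t) (repEnd_le hrep)
  rw [hend] at hrep h6
  rw [interp_zero, interp_two] at h6
  rcases h6 with h6 | h6
  · exact lt_irrefl _ h6
  · exact (repStart_le hrep).not_gt h6

theorem wellFounded_melody : WellFounded (EdgeRel graph melody) := by
  refine wellFounded_graph_iff.2 ⟨?_, good_melody, not_chainOn_melody⟩
  refine (InvImage.wf interp Ordinal.lt_wf).mono fun s t h => ?_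
  exact yLt_melody.1 h

theorem interp_tHalt {p : ℕ} {τ : Ordinal.{0}} (h : (mach p).haltsAt zeroR τ) :
    interp (tHalt p) = τ := by
  have hbit : ∀ α, trueBit α (bitIdx 3 p (machHalt p)) = true ↔ (mach p).haltedAt zeroR α := by
    intro α
    rw [trueBit_bitIdx (by norm_num), snapBit, if_pos rfl, decide_eq_true_eq, Machine.haltedAt,
      Fin.ext_iff]
    rfl
  obtain ⟨u, hu, hs⟩ := repeats_repStart.exists_snap_eq p τ
  have hτ : τ < repEnd := by
    refine lt_of_le_of_lt ?_ hu
    by_contra hc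
    refine h.2 u (not_le.1 hc) ?_
    rw [Machine.haltedAt, ← hs]
    exact h.1
  rw [tHalt, interp_tNext, interp_one]
  refine le_antisymm (nextO_le zero_le (Or.inl ((hbit τ).2 h.1))) ?_
  by_contra hc
  rw [not_le] at hc
  rcases (nextO_spec (Θ := repEnd) (bitIdx 3 p (machHalt p)) zero_le).2 with h1 | h1
  · exact h.2 _ hc ((hbit _).1 h1)
  · rw [h1] at hc
    exact lt_asymm hc hτ

theorem not_outputs_melody (M : Machine) {K : ℕ} (hK : 0 < K) :
    ¬ M.outputs zeroR fun n => if K ∣ n then melody (n / K) else false := by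
  rintro ⟨τ, h, hout⟩
  obtain ⟨p, rfl⟩ := mach_surjective M
  have h1 := congrFun hout (K * (3 * Nat.pair p K + 2))
  have h2 : melody (3 * Nat.pair p K + 2) = yD melody p K := rfl
  simp only [dvd_mul_right, if_true, Nat.mul_div_cancel_left _ hK, h2, yD_melody,
    interp_tHalt h] at h1
  have h3 := trueBit_tape τ p 2 (K * (3 * Nat.pair p K + 2))
  rw [h1] at h3
  have h4 : diagBit p K = bitIdx ((2 : Fin 3) : ℕ) p (K * (3 * Nat.pair p K + 2)) := rfl
  rw [h4] at h3
  generalize trueBit τ _ = b at h3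
  cases b <;> cases h3

/-! ### Uniqueness of the melody -/

/-- The code `y` satisfies all clauses and `ρ` represents its comparison of terms by an initial
segment of the ordinals. -/
structure Ranked (y : R) (ρ : ℕ → Ordinal.{0}) : Prop where
  good : Good y
  lt_iff : ∀ s t, yLt y s t ↔ ρ s < ρ t
  exists_eq : ∀ {t β}, β ≤ ρ t → ∃ u, ρ u = β

theorem Good.exists_ranked {y : R} (G : Good y) (h : WellFounded (yLt y)) : ∃ ρ, Ranked y ρ := by
  have : IsWellFounded ℕ (yLt y) := ⟨h⟩
  refine ⟨IsWellFounded.rank (yLt y), G, fun s t => ⟨IsWellFounded.rank_lt_of_rel, fun hlt => ?_⟩,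
    fun hβ => IsWellFounded.mem_range_rank_of_le hβ⟩
  by_contra hc
  refine hlt.not_ge ?_
  rw [IsWellFounded.rank_eq (yLt y) t]
  refine Ordinal.iSup_le fun u => Order.succ_le_of_lt (IsWellFounded.rank_lt_of_rel ?_)
  by_contra hu
  exact G.trans u s t ⟨u.2, hu, hc⟩

namespace Ranked

variable {y : R} {ρ : ℕ → Ordinal.{0}}

theorem le_top (h : Ranked y ρ) (t : ℕ) : ρ t ≤ ρ 0 := by
  have := h.good.top t
  rwa [h.lt_iff, not_lt] at this

theorem one_eq (h : Ranked y ρ) : ρ 1 = 0 := by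
  obtain ⟨u, hu⟩ := h.exists_eq (t := 1) zero_le
  have := h.good.zero u
  rwa [h.lt_iff, hu, not_lt, nonpos_iff_eq_zero] at this

theorem tSucc_eq (h : Ranked y ρ) (s : ℕ) : ρ (tSucc s) = min (ρ s + 1) (ρ 0) := by
  have h1 := h.good.succ_lt s
  have h2 := h.good.succ_le s
  have h3 := h.good.succ_top s
  simp only [h.lt_iff, not_and, not_lt, not_le] at h1 h2 h3
  rcases (h.le_top s).lt_or_eq with hs | hs
  · rw [min_eq_left (Order.add_one_le_of_lt hs)]
    refine le_antisymm ?_ (Order.add_one_le_of_lt (h1 hs))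
    obtain ⟨u, hu⟩ := h.exists_eq (Order.add_one_le_of_lt hs)
    rw [← hu]
    exact h2 u (by rw [hu]; exact lt_add_one _)
  · rw [min_eq_right (by rw [← hs]; exact le_self_add)]
    exact le_antisymm (h.le_top _) (h3 hs.ge)

theorem tPred_eq (h : Ranked y ρ) (t : ℕ) : ρ (tPred t) = predO (ρ t) := by
  have h1 := h.good.le_pred t
  have h2 := h.good.pred_le t
  simp only [h.lt_iff, h.tSucc_eq, not_and, not_lt] at h1 h2
  refine le_antisymm ?_ (predO_le_iff.2 (h1.trans (min_le_left _ _)))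
  by_contra hc
  obtain ⟨u, hu⟩ := h.exists_eq (predO_le (ρ t))
  have h3 := h2 u (by rw [hu]; exact not_le.1 hc)
  rw [hu] at h3
  exact h3 (le_min (le_predO _) (h.le_top t))

theorem isSuccLimit_iff (h : Ranked y ρ) (t : ℕ) :
    Order.IsSuccLimit (ρ t) ↔ yLt y 1 t ∧ ¬ yLt y (tPred t) t := by
  rw [isSuccLimit_iff_predO, h.lt_iff, h.lt_iff, h.one_eq, h.tPred_eq]

theorem tLast_eq (h : Ranked y ρ) {i t : ℕ} (hB : ∀ u, ρ u < ρ t → yB y u i = trueBit (ρ u) i) :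
    ρ (tLast i t) = lastO i (ρ t) := by
  apply le_antisymm
  · by_contra hc
    obtain ⟨u, hu⟩ := h.exists_eq (lastO_le i (ρ t))
    have h1 := h.good.last_le t u i
    have h2 := h.good.le_next u i
    have h3 := h.good.next_on u i
    simp only [h.lt_iff, not_and, not_lt] at h1 h2 h3
    have h4 := not_le.1 (h1 (by rw [hu]; exact not_le.1 hc))
    have h5 := h3 (h4.trans_le (h.le_top t))
    rw [hB _ h4] at h5
    rw [hu] at h2
    exact h5 (lastO_spec i _ _ h2 h4)
  · refine lastO_le_iff.2 fun γ h1 h2 => ?_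
    obtain ⟨u, rfl⟩ := h.exists_eq h2.le
    have h3 := h.good.last_off t u i
    simp only [h.lt_iff, not_and, not_lt, hB u h2] at h3
    simpa using h3 h1 h2

theorem yB_eq (h : Ranked y ρ) (t i : ℕ) : yB y t i = trueBit (ρ t) i := by
  obtain ⟨α, hα⟩ : ∃ α, ρ t = α := ⟨_, rfl⟩
  induction α using WellFoundedLT.induction generalizing t i with
  | ind α ih =>
  subst hα
  have hB : ∀ u i, ρ u < ρ t → yB y u i = trueBit (ρ u) i := fun u i hu => ih _ hu u i rfl
  rcases Ordinal.zero_or_succ_or_isSuccLimit (ρ t) with h0 | ⟨β, hβ⟩ | hl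
  · have := h.good.ini t i
    rw [h.lt_iff, h.one_eq, h0, not_and, ne_par_add_one, ← trueBit_zero, par_toNat] at this
    rw [h0]
    exact this (lt_irrefl _)
  · have hβ' : ρ t = β + 1 := by simpa using hβ.symm
    have hlt : β < ρ t := by rw [hβ']; exact lt_add_one _
    obtain ⟨s, rfl⟩ := h.exists_eq hlt.le
    obtain ⟨q, hq⟩ := exists_state (ρ s) (bitP i)
    obtain ⟨n, hn⟩ := exists_head (ρ s) (bitP i)
    have hmod : ∀ b : Bool, b.toNat % 2 = b.toNat := by decide
    have := h.good.next s t i q n (trueBit (ρ s) (bitIdx 0 (bitP i) n)).toNat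
      (trueBit (ρ s) (bitIdx 1 (bitP i) n)).toNat (trueBit (ρ s) (bitIdx 2 (bitP i) n)).toNat
      (trueBit (ρ s) i).toNat
    simp only [hmod, par_toNat, hB s _ hlt, true_and, hq, hn, h.lt_iff, hlt, not_and,
      ne_par_add_one, h.tSucc_eq, not_lt] at this
    rw [this (le_min hβ'.le (h.le_top t)), hβ',
      ← trueBit_add_one (ρ s) i q n _ _ _ hq hn rfl rfl rfl, par_toNat]
  · obtain ⟨h1, h2⟩ := (h.isSuccLimit_iff t).1 hl
    by_cases hi : i % 5 < 3
    · obtain ⟨e, rfl⟩ := exists_tapeBit hi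
      have h3 := h.good.lim_on t e
      have h4 := h.good.lim_off t e
      rw [h.lt_iff (tLast _ _), h.tLast_eq fun u => hB u _] at h3 h4
      have h5 := tape_limit_iff hl hi
      rw [Bool.eq_iff_iff, h5]
      constructor
      · exact fun h6 h7 => h3 ⟨h1, h2, h6, h7⟩
      · intro h6
        by_contra h7
        exact h4 ⟨h1, h2, by simpa using h7, h6⟩
    · rw [← par_toNat (trueBit _ _), trueBit_limit hl (by omega)]
      have hi5 : i = 5 * (i / 5) + 3 ∨ i = 5 * (i / 5) + 4 := by omega
      rcases hi5 with hi5 | hi5 <;> rw [hi5]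
      · exact ne_par_add_one.1 fun h3 => h.good.lim_state t _ ⟨h1, h2, h3⟩
      · exact ne_par_add_one.1 fun h3 => h.good.lim_head t _ ⟨h1, h2, h3⟩

theorem tNext_eq (h : Ranked y ρ) (i s : ℕ) : ρ (tNext i s) = nextO (ρ 0) i (ρ s) := by
  have h1 := h.good.le_next s i
  have h2 := h.good.next_on s i
  simp only [h.lt_iff, h.yB_eq, not_and, not_lt, Bool.not_eq_false] at h1 h2
  apply le_antisymm
  · have h3 := nextO_spec i (h.le_top s)
    obtain ⟨u, hu⟩ := h.exists_eq (nextO_le (i := i) (h.le_top s) (Or.inr rfl))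
    rw [← hu] at h3 ⊢
    rcases h3.2 with h4 | h4
    · have h5 := h.good.next_le s u i
      simp only [h.lt_iff, h.yB_eq, not_and, not_lt] at h5
      exact h5 h3.1 h4
    · rw [h4]
      exact h.le_top _
  · refine nextO_le h1 ?_
    rcases (h.le_top (tNext i s)).lt_or_eq with h3 | h3
    · exact Or.inl (h2 h3)
    · exact Or.inr h3

theorem repeats (h : Ranked y ρ) : Repeats (ρ 2) (ρ 0) := by
  have hlt := (h.lt_iff _ _).1 h.good.start_lt
  refine ⟨(h.isSuccLimit_iff 2).2 ⟨h.good.start_pos, h.good.start_lim⟩,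
    (h.isSuccLimit_iff 0).2 ⟨(h.lt_iff _ _).2 ?_, h.good.end_lim⟩, hlt, fun e => ⟨fun h1 => ?_,
    fun h1 u hu hu' => ?_⟩⟩
  · rw [h.one_eq]
    exact zero_le.trans_lt hlt
  · have := h.good.rep_on e
    simpa [h.yB_eq, h1] using this
  · obtain ⟨u, rfl⟩ := h.exists_eq hu'
    have := h.good.rep_off u e
    simpa [h.yB_eq, h.lt_iff, h1, hu.not_gt] using this

theorem chainOn (h : Ranked y ρ) {s t : ℕ} (hrep : Repeats (ρ s) (ρ t))
    (hlex : ρ t < ρ 0 ∨ ρ s < ρ 2) (e : ℕ) :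
    ChainOn y s t (tapeBit e) := by
  obtain ⟨h1, h2, h3, h4⟩ := hrep
  rw [h.isSuccLimit_iff] at h1 h2
  refine ⟨⟨(h.lt_iff _ _).2 h3, h1.1, h1.2, h2⟩, ?_, ?_⟩
  · rwa [h.lt_iff, h.lt_iff]
  · rw [h.yB_eq, h.yB_eq, h.lt_iff, h.tNext_eq]
    cases hb : trueBit (ρ s) (tapeBit e) with
    | true => exact Or.inl ⟨rfl, (h4 e).1 hb⟩
    | false =>
      refine Or.inr ⟨rfl, fun hlt => ?_, (h4 e).2 hb _ h3.le le_rfl⟩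
      obtain ⟨h5, h6⟩ := nextO_spec (tapeBit e) (h.le_top s)
      rcases h6 with h6 | h6
      · rw [(h4 e).2 hb _ h5 hlt.le] at h6
        cases h6
      · rw [h6] at hlt
        exact hlt.not_ge (h.le_top t)

theorem eq_interp (h : Ranked y ρ) (hch : ∀ s t, ¬ ∀ e, ChainOn y s t (tapeBit e)) (t : ℕ) :
    ρ t = interp t := by
  have hend : ρ 0 = repEnd := by
    have hle := repEnd_le h.repeats
    obtain ⟨T, hT⟩ := h.exists_eq hle
    obtain ⟨S, hS⟩ := h.exists_eq (repeats_repStart.2.2.1.le.trans hle)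
    refine le_antisymm ?_ hle
    by_contra hc
    exact hch S T (h.chainOn (by rw [hS, hT]; exact repeats_repStart)
      (Or.inl (by rw [hT]; exact not_le.1 hc)))
  have hstart : ρ 2 = repStart := by
    have hrep := h.repeats
    rw [hend] at hrep
    have hle := repStart_le hrep
    obtain ⟨S, hS⟩ := h.exists_eq hle
    refine le_antisymm ?_ hle
    by_contra hc
    exact hch S 0 (h.chainOn (by rw [hS, hend]; exact repeats_repStart)
      (Or.inr (by rw [hS]; exact not_le.1 hc)))
  induction t using term_cases with
  | h0 => rw [hend, interp_zero]
  | h1 => rw [h.one_eq, interp_one]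
  | h2 => rw [hstart, interp_two]
  | hsucc s ih => rw [h.tSucc_eq, interp_tSucc, ih, hend]
  | hpred s ih => rw [h.tPred_eq, interp_tPred, ih]
  | hlast i s ih => rw [h.tLast_eq fun u _ => h.yB_eq u i, interp_tLast, ih]
  | hnext i s ih => rw [h.tNext_eq, interp_tNext, ih, hend]

end Ranked

theorem wellFounded_iff_eq_melody {y : R} : WellFounded (EdgeRel graph y) ↔ y = melody := by
  refine ⟨fun hy => ?_, fun hy => hy ▸ wellFounded_melody⟩
  obtain ⟨hwf, G, hch⟩ := wellFounded_graph_iff.1 hy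
  obtain ⟨ρ, h⟩ := G.exists_ranked hwf
  have hρ := h.eq_interp hch
  refine ext_components (fun s t => ?_) (fun s i => ?_) fun p m => ?_
  · rw [h.lt_iff, hρ, hρ, yLt_melody]
  · rw [h.yB_eq, hρ, yB_melody]
  · have h1 := G.diag_on p m
    have h2 := G.diag_off p m
    rw [h.yB_eq, hρ] at h1 h2
    rw [yD_melody]
    revert h1 h2
    cases yD y p m <;> cases trueBit (interp (tHalt p)) (diagBit p m) <;> simp

/-- The real with the bits of the melody at the multiples of `K`. -/
noncomputable def spreadMelody (K : ℕ) : R := fun n => if K ∣ n then melody (n / K) else false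

theorem eq_spreadMelody_iff {K : ℕ} (hK : 0 < K) {x : R} :
    x = spreadMelody K ↔
      (fun n => x (n * K)) = melody ∧ ∀ n, ∀ k < K, 0 < k → x (n * K + k) = false := by
  constructor
  · rintro rfl
    refine ⟨funext fun n => by simp [spreadMelody, hK], fun n k hk hk0 => if_neg fun hd => ?_⟩
    exact (Nat.le_of_dvd hk0 ((Nat.dvd_add_right (dvd_mul_left K n)).1 hd)).not_gt hk
  · rintro ⟨h1, h2⟩
    funext n
    have hn : n / K * K + n % K = n := Nat.div_add_mod' n K
    rw [spreadMelody]
    split_ifs with hd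
    · rw [← h1]
      dsimp only
      rw [Nat.div_mul_cancel hd]
    · have h3 := h2 (n / K) (n % K) (Nat.mod_lt _ hK)
        (Nat.pos_of_ne_zero fun h => hd (Nat.dvd_of_mod_eq_zero h))
      rwa [hn] at h3

/-- For large `K`, it is decidable whether the bits of a real with indices in an arithmetic
progression form the real `spreadMelody K`. -/
theorem exists_decidable_spreadMelody :
    ∃ K > 0, ∀ a d, d < a → ITTMDecidable {x : R | (fun n => x (a * n + d)) = spreadMelody K} := by
  obtain ⟨K₀, hK₀⟩ := exists_decider primrec_graph edgeRel_graph_zero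
  refine ⟨K₀ + 1, Nat.succ_pos _, fun a d hd => ?_⟩
  generalize hK : K₀ + 1 = K
  have hpos : 0 < K := by omega
  obtain ⟨M, hM⟩ := hK₀ (a * K) (by nlinarith) fun w =>
    (w d, decide (∃ k < K, 0 < k ∧ w (a * k + d) = true))
  have hlt : ∀ k < K, a * k + d < a * K := fun k hk => by
    calc a * k + d < a * k + a := by omega
      _ = a * (k + 1) := by ring
      _ ≤ a * K := Nat.mul_le_mul_left a hk
  have hw : ∀ x n k, k < K → Macro.window (a * K) x n (a * k + d) = x (a * (n * K + k) + d) := by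
    intro x n k hk
    rw [Macro.window, if_pos (hlt k hk)]
    congr 1
    ring
  have hiff : ∀ x : R, (WellFounded (EdgeRel graph fun n => Macro.window (a * K) x n d) ∧
      ∀ n, decide (∃ k < K, 0 < k ∧ Macro.window (a * K) x n (a * k + d) = true) = false) ↔
      (fun n => x (a * n + d)) = spreadMelody K := by
    intro x
    rw [wellFounded_iff_eq_melody, eq_spreadMelody_iff hpos]
    refine and_congr ?_ (forall_congr' fun n => ?_)
    · have h0 : ∀ n, Macro.window (a * K) x n d = x (a * (n * K) + d) := fun n => by
        simpa using hw x n 0 hpos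
      simp only [h0]
    · rw [decide_eq_false_iff_not]
      push Not
      refine forall₂_congr fun k hk => imp_congr_right fun _ => ?_
      rw [hw x n k hk, ne_eq, Bool.not_eq_true]
  refine ⟨M, fun x => ?_⟩
  have hx := hM x
  exact ⟨fun h => by rwa [if_pos ((hiff x).2 h)] at hx, fun h => by rwa [if_neg (mt (hiff x).1 h)] at hx⟩

end ITTM

/-- **Lost Melody Theorem.** There is a real `c` such that `{c}` is infinite
time decidable but `c` is not writable; consequently the set
`{(x,y) : y = c}` — the graph of the constant function `f(x) = c` — is
infinite time decidable, while `f` itself is not infinite time computable. -/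
theorem lost_melody :
    ∃ c : ITTM.R,
      ITTM.ITTMDecidable ({c} : Set ITTM.R) ∧
      ¬ ITTM.WritableReal c ∧
      ITTM.ITTMDecidable (pairCodes {q : ITTM.R × ITTM.R | q.2 = c}) ∧
      ¬ ∃ M : ITTM.Machine, ∀ x : ITTM.R, M.outputs x c := by
  obtain ⟨K, hK, hdec⟩ := ITTM.exists_decidable_spreadMelody
  have hnot : ∀ M : ITTM.Machine, ¬ M.outputs ITTM.zeroR (ITTM.spreadMelody K) :=
    fun M => ITTM.not_outputs_melody M hK
  refine ⟨ITTM.spreadMelody K, ?_, fun ⟨M, hM⟩ => hnot M hM, hdec 2 1 one_lt_two,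
    fun ⟨M, hM⟩ => hnot M (hM _)⟩
  simpa using hdec 1 0 one_pos
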